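/- Let (R,m,k) be a regular local ring, let I be an ideal of height d such that R/I satisfies Serre's condition S_2, and let z_1,…,z_d ∈ I be an R-regular sequence with (z_1,…,z_d) ≠ I. Let P_• be a minimal free resolution of the R-module I/(z_1,…,z_d), and let ψ_• : P_• → K_•(z;R) be a chain map lifting the inclusion I/(z) ↪ R/(z), where the Koszul complex K_•(z;R) is a free resolution of R/(z). Then ψ_d : P_d → K_d(z;R) = R is surjective. -/

import Mathlib

open IsLocalRing

universe u

variable (R : Type u) [CommRing R]

/-- Index type for the degree-`n` part of the Koszul complex on `s` generators:
`n`-element subsets of `Fin s` (i.e. strictly increasing `n`-tuples). -/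
abbrev KIdx (s n : ℕ) : Type := {T : Finset (Fin s) // T.card = n}

/-- The degree-`n` part of the Koszul complex `K_•(x₁,…,x_s; R)`:
the free `R`-module on `KIdx s n`. -/
abbrev KMod (s n : ℕ) : Type u := KIdx s n →₀ R

/-- The Koszul differential `K_{n+1}(x;R) → K_n(x;R)`,
`e_T ↦ ∑_{j ∈ T} (-1)^{#{i ∈ T : i < j}} x_j e_{T∖{j}}`. -/
noncomputable def koszulD {s : ℕ} (x : Fin s → R) (n : ℕ) :
    KMod R s (n + 1) →ₗ[R] KMod R s n :=
  Finsupp.lsum R fun T => LinearMap.toSpanSingleton R (KMod R s n)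
    (∑ j ∈ T.1.attach,
      ((-1 : R) ^ (T.1.filter (fun i => i < j.1)).card * x j.1) •
        Finsupp.single ⟨T.1.erase j.1, by
          simp [Finset.card_erase_of_mem j.2, T.2]⟩ (1 : R))

/-- A projective resolution `⋯ → F 1 → F 0 → M → 0` of an `R`-module `M`. -/
structure ProjRes (M : Type u) [AddCommGroup M] [Module R M] where
  F : ℕ → ModuleCat.{u} R
  d : ∀ n, F (n + 1) →ₗ[R] F n
  ε : F 0 →ₗ[R] M
  projective : ∀ n, Module.Projective R (F n)
  surj : Function.Surjective ε
  exact0 : LinearMap.ker ε = LinearMap.range (d 0)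
  exact : ∀ n, LinearMap.ker (d n) = LinearMap.range (d (n + 1))

/-- A minimal free resolution of `M` over the local ring `R`: a resolution by
finitely generated free modules all of whose differentials (and the kernel of
whose augmentation) land in `m` times the target. -/
structure MinFreeRes [IsLocalRing R] (M : Type u) [AddCommGroup M] [Module R M]
    extends ProjRes R M where
  free : ∀ n, Module.Free R (F n)
  fin : ∀ n, Module.Finite R (F n)
  min_aug : LinearMap.ker ε ≤ (maximalIdeal R) • (⊤ : Submodule R (F 0))
  min : ∀ n, LinearMap.range (d n) ≤ (maximalIdeal R) • (⊤ : Submodule R (F n))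

/-- `R` is a regular local ring: a Noetherian local ring whose maximal ideal is
generated by `dim R` elements. -/
def IsRegularLocal [IsLocalRing R] : Prop :=
  IsNoetherianRing R ∧ ∃ (n : ℕ) (x : Fin n → R),
    Ideal.span (Set.range x) = maximalIdeal R ∧ ringKrullDim R = n

/-- The ideal `I` has height `d`: `d` is the minimum of the heights of the primes
containing `I`, the height of a prime `P` being `dim R_P`. -/
def HeightEq (I : Ideal R) (d : ℕ) : Prop :=
  (∃ (P : Ideal R) (h : P.IsPrime), I ≤ P ∧
      ringKrullDim (@Localization.AtPrime R _ P h) = d) ∧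
    ∀ (P : Ideal R) (h : P.IsPrime), I ≤ P →
      (d : WithBot ℕ∞) ≤ ringKrullDim (@Localization.AtPrime R _ P h)

/-- Serre's condition `S_n` for the ring `A`: for every prime `P` of `A`,
`depth A_P ≥ min(n, dim A_P)`, expressed by the existence of regular sequences
in the maximal ideal of `A_P` of every length `j ≤ min(n, dim A_P)`. -/
def SerreS (A : Type u) [CommRing A] (n : ℕ) : Prop :=
  ∀ (P : Ideal A) (h : P.IsPrime) (j : ℕ), j ≤ n →
    (j : WithBot ℕ∞) ≤ ringKrullDim (@Localization.AtPrime A _ P h) →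
      ∃ rs : List (@Localization.AtPrime A _ P h), rs.length = j ∧
        (∀ r ∈ rs, r ∈ maximalIdeal (@Localization.AtPrime A _ P h)) ∧
        RingTheory.Sequence.IsWeaklyRegular (@Localization.AtPrime A _ P h) rs

namespace ExtTools
open CategoryTheory Abelian

variable {S : Type u} [CommRing S]

abbrev EX (S : Type u) [CommRing S] (N Y : Type u) [AddCommGroup N] [Module S N]
    [AddCommGroup Y] [Module S Y] (i : ℕ) : Type u :=
  Ext (ModuleCat.of S N) (ModuleCat.of S Y) i

variable {N N' N'' Y Y' Y'' : Type u}
  [AddCommGroup N] [Module S N] [AddCommGroup N'] [Module S N'] [AddCommGroup N''] [Module S N'']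
  [AddCommGroup Y] [Module S Y] [AddCommGroup Y'] [Module S Y'] [AddCommGroup Y''] [Module S Y'']

/-- Precomposition on `Ext`. -/
noncomputable def pre (Y : Type u) [AddCommGroup Y] [Module S Y] (i : ℕ) (f : N' →ₗ[S] N) :
    EX S N Y i →ₗ[S] EX S N' Y i where
  toFun e := (Ext.mk₀ (ModuleCat.ofHom f)).comp e (zero_add i)
  map_add' a b := by simp
  map_smul' r a := by simp

/-- Postcomposition on `Ext`. -/
noncomputable def post (N : Type u) [AddCommGroup N] [Module S N] (i : ℕ) (g : Y →ₗ[S] Y') :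
    EX S N Y i →ₗ[S] EX S N Y' i where
  toFun e := e.comp (Ext.mk₀ (ModuleCat.ofHom g)) (add_zero i)
  map_add' a b := by simp
  map_smul' r a := by simp

lemma ofHom_smul' (r : S) (f : N' →ₗ[S] N) :
    ModuleCat.ofHom (r • f) = r • ModuleCat.ofHom f := rfl

lemma pre_comp (i : ℕ) (f : N' →ₗ[S] N) (g : N'' →ₗ[S] N') (e : EX S N Y i) :
    pre Y i (f.comp g) e = pre Y i g (pre Y i f e) := by
  simp only [pre, LinearMap.coe_mk, AddHom.coe_mk]
  rw [← Ext.comp_assoc_of_second_deg_zero, Ext.mk₀_comp_mk₀]; rfl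

lemma post_comp (i : ℕ) (f : Y' →ₗ[S] Y'') (g : Y →ₗ[S] Y') (e : EX S N Y i) :
    post N i (f.comp g) e = post N i f (post N i g e) := by
  simp only [post, LinearMap.coe_mk, AddHom.coe_mk]
  rw [Ext.comp_assoc_of_third_deg_zero, Ext.mk₀_comp_mk₀]; rfl

lemma pre_smul (i : ℕ) (r : S) (f : N' →ₗ[S] N) (e : EX S N Y i) :
    pre Y i (r • f) e = r • pre Y i f e := by
  simp only [pre, LinearMap.coe_mk, AddHom.coe_mk, ofHom_smul', Ext.mk₀_smul, Ext.smul_comp]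

lemma pre_id (i : ℕ) (e : EX S N Y i) : pre Y i LinearMap.id e = e := by
  simp [pre]

lemma post_smul (i : ℕ) (r : S) (f : Y →ₗ[S] Y') (e : EX S N Y i) :
    post N i (r • f) e = r • post N i f e := by
  simp only [post, LinearMap.coe_mk, AddHom.coe_mk, ofHom_smul', Ext.mk₀_smul, Ext.comp_smul]

lemma post_id (i : ℕ) (e : EX S N Y i) : post N i LinearMap.id e = e := by
  simp [post]

lemma pre_add (i : ℕ) (f g : N' →ₗ[S] N) (e : EX S N Y i) :
    pre Y i (f + g) e = pre Y i f e + pre Y i g e := by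
  simp only [pre, LinearMap.coe_mk, AddHom.coe_mk, ModuleCat.ofHom_add, Ext.mk₀_add, Ext.add_comp]

lemma pre_zero (i : ℕ) (e : EX S N Y i) :
    pre Y i (0 : N' →ₗ[S] N) e = 0 := by
  have := pre_smul i (0 : S) (0 : N' →ₗ[S] N) e
  simpa using this

lemma smul_eq_zero_of_left (i : ℕ) (r : S) (h : ∀ n : N, r • n = 0) (e : EX S N Y i) :
    r • e = 0 := by
  have h1 : (r • LinearMap.id : N →ₗ[S] N) = 0 := by ext; simp [h]
  rw [← pre_id i e, ← pre_smul, h1, pre_zero]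

section SES

variable {f : N' →ₗ[S] N} {g : N →ₗ[S] N''}

abbrev sc (f : N' →ₗ[S] N) (g : N →ₗ[S] N'') (h : Function.Exact f g) :
    ShortComplex (ModuleCat.{u} S) :=
  ShortComplex.mk (ModuleCat.ofHom f) (ModuleCat.ofHom g)
    (by rw [← ModuleCat.ofHom_comp, h.linearMap_comp_eq_zero]; rfl)

lemma sc_shortExact (hf : Function.Injective f) (h : Function.Exact f g)
    (hg : Function.Surjective g) : (sc f g h).ShortExact where
  exact := by
    rw [ShortComplex.ShortExact.moduleCat_exact_iff_function_exact]; exact h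
  mono_f := (ModuleCat.mono_iff_injective _).2 hf
  epi_g := (ModuleCat.epi_iff_surjective _).2 hg

/-- The long exact sequence in the first variable. -/
lemma contra_les (hf : Function.Injective f) (h : Function.Exact f g)
    (hg : Function.Surjective g) (Y : Type u) [AddCommGroup Y] [Module S Y] (i : ℕ) :
    Function.Exact (pre Y i g) (pre Y i f) ∧
    ∃ δ : EX S N' Y i →ₗ[S] EX S N'' Y (i + 1),
      Function.Exact (pre Y i f) δ ∧ Function.Exact δ (pre Y (i + 1) g) := by
  have hS := sc_shortExact hf h hg
  have zz : g.comp f = 0 := h.linearMap_comp_eq_zero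
  refine ⟨fun e => ⟨fun he => ?_, ?_⟩, ⟨⟨⟨fun e => hS.extClass.comp e (add_comm 1 i), ?_⟩, ?_⟩, ?_, ?_⟩⟩
  · obtain ⟨x, hx⟩ := Ext.contravariant_sequence_exact₂ hS (ModuleCat.of S Y) e he
    exact ⟨x, hx⟩
  · rintro ⟨x, rfl⟩
    rw [← pre_comp, zz, pre_zero]
  · intro a b; simp
  · intro a b; simp
  · intro e
    constructor
    · intro he
      obtain ⟨x, hx⟩ := Ext.contravariant_sequence_exact₁ hS (ModuleCat.of S Y) e (add_comm 1 i) he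
      exact ⟨x, hx⟩
    · rintro ⟨x, rfl⟩
      simp only [pre, LinearMap.coe_mk, AddHom.coe_mk]
      exact hS.extClass_comp_assoc _
  · intro e
    constructor
    · intro he
      obtain ⟨x, hx⟩ := Ext.contravariant_sequence_exact₃ hS (ModuleCat.of S Y) e he (add_comm 1 i)
      exact ⟨x, hx⟩
    · rintro ⟨x, rfl⟩
      simp only [pre, LinearMap.coe_mk, AddHom.coe_mk]
      exact hS.comp_extClass_assoc _ _

/-- The long exact sequence in the second variable, natural in the first one. -/
lemma co_les {f : Y' →ₗ[S] Y} {g : Y →ₗ[S] Y''} (hf : Function.Injective f)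
    (h : Function.Exact f g) (hg : Function.Surjective g) (i : ℕ) :
    (∀ A : ModuleCat.{u} S, Function.Exact (post A i f) (post A i g)) ∧
    ∃ δ : ∀ A : ModuleCat.{u} S, EX S A Y'' i →ₗ[S] EX S A Y' (i + 1),
      (∀ A : ModuleCat.{u} S, Function.Exact (post A i g) (δ A)) ∧ (∀ A : ModuleCat.{u} S, Function.Exact (δ A) (post A (i + 1) f)) ∧
      ∀ (A B : ModuleCat.{u} S) (φ : B →ₗ[S] A) (e : EX S A Y'' i),
        δ B (pre Y'' i φ e) = pre Y' (i + 1) φ (δ A e) := by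
  have hS := sc_shortExact hf h hg
  have zz : g.comp f = 0 := h.linearMap_comp_eq_zero
  refine ⟨fun N e => ⟨fun he => ?_, ?_⟩,
    fun N => ⟨⟨fun e => e.comp hS.extClass rfl, ?_⟩, ?_⟩, ?_, ?_, ?_⟩
  · obtain ⟨x, hx⟩ := Ext.covariant_sequence_exact₂ (ModuleCat.of S N) hS e he
    exact ⟨x, hx⟩
  · rintro ⟨x, rfl⟩
    rw [← post_comp, zz]
    have := post_smul i (0 : S) (0 : Y' →ₗ[S] Y'') x
    simpa using this
  · intro a b; simp
  · intro a b; simp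
  · intro N e
    constructor
    · intro he
      obtain ⟨x, hx⟩ := Ext.covariant_sequence_exact₃ (ModuleCat.of S N) hS e rfl he
      exact ⟨x, hx⟩
    · rintro ⟨x, rfl⟩
      simp only [post, LinearMap.coe_mk, AddHom.coe_mk]
      rw [Ext.comp_assoc_of_second_deg_zero, hS.comp_extClass, Ext.comp_zero]
  · intro N e
    constructor
    · intro he
      obtain ⟨x, hx⟩ := Ext.covariant_sequence_exact₁ (ModuleCat.of S N) hS e he rfl
      exact ⟨x, hx⟩
    · rintro ⟨x, rfl⟩
      simp only [post, LinearMap.coe_mk, AddHom.coe_mk]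
      rw [Ext.comp_assoc_of_third_deg_zero, hS.extClass_comp, Ext.comp_zero]
  · intro N N' φ e
    simp only [pre, LinearMap.coe_mk, AddHom.coe_mk]
    rw [Ext.comp_assoc _ _ _ (zero_add i) rfl (by lia)]

end SES

/-- Degree zero `Ext` is `Hom`. -/
lemma mk0_surj (e : EX S N Y 0) : ∃ f : N →ₗ[S] Y, e = Ext.mk₀ (ModuleCat.ofHom f) := by
  obtain ⟨f, hf⟩ := (Ext.mk₀_bijective (ModuleCat.of S N) (ModuleCat.of S Y)).2 e
  exact ⟨f.hom, by rw [← hf]; rfl⟩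

lemma mk0_inj {f g : N →ₗ[S] Y} (h : (Ext.mk₀ (ModuleCat.ofHom f) : EX S N Y 0) =
    Ext.mk₀ (ModuleCat.ofHom g)) : f = g := by
  have := (Ext.mk₀_bijective (ModuleCat.of S N) (ModuleCat.of S Y)).1 h
  exact congrArg ModuleCat.Hom.hom this

lemma pre_mk0 (f : N →ₗ[S] Y) (φ : N' →ₗ[S] N) :
    pre Y 0 φ (Ext.mk₀ (ModuleCat.ofHom f)) = Ext.mk₀ (ModuleCat.ofHom (f.comp φ)) := by
  simp only [pre, LinearMap.coe_mk, AddHom.coe_mk, Ext.mk₀_comp_mk₀]; rfl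

lemma smul_mk0 (r : S) (f : N →ₗ[S] Y) :
    r • (Ext.mk₀ (ModuleCat.ofHom f) : EX S N Y 0) = Ext.mk₀ (ModuleCat.ofHom (r • f)) := by
  rw [ofHom_smul', Ext.mk₀_smul]

lemma eq_zero_of_projective [Module.Projective S N] (i : ℕ) (e : EX S N Y (i + 1)) : e = 0 :=
  e.eq_zero_of_projective

end ExtTools

namespace Koszul
variable {R : Type u} [CommRing R]

/-- The basis element of the Koszul complex attached to a finset (zero in the wrong degree). -/
noncomputable def E (R : Type u) [CommRing R] {s : ℕ} (n : ℕ) (U : Finset (Fin s)) : KMod R s n :=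
  if h : U.card = n then Finsupp.single ⟨U, h⟩ 1 else 0

lemma E_of {s n : ℕ} (T : KIdx s n) : E R n T.1 = Finsupp.single T 1 := by
  simp [E, T.2]

lemma koszulD_E {s : ℕ} (x : Fin s → R) (n : ℕ) (U : Finset (Fin s)) (hU : U.card = n + 1) :
    koszulD R x n (E R (n + 1) U) =
      ∑ j ∈ U, ((-1 : R) ^ (U.filter (fun i => i < j)).card * x j) • E R n (U.erase j) := by
  rw [← Finset.sum_attach U]
  simp only [E, hU, dif_pos]
  simp only [koszulD, Finsupp.lsum_apply, Finsupp.sum_single_index,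
    LinearMap.toSpanSingleton_apply, one_smul, map_zero]
  refine Finset.sum_congr rfl fun j _ => ?_
  have : (U.erase j.1).card = n := by simp [Finset.card_erase_of_mem j.2, hU]
  simp [this]

lemma ext_E {s n : ℕ} {M : Type*} [AddCommGroup M] [Module R M] {f g : KMod R s n →ₗ[R] M}
    (h : ∀ U : Finset (Fin s), U.card = n → f (E R n U) = g (E R n U)) : f = g := by
  refine Finsupp.lhom_ext' fun T => LinearMap.ext_ring ?_
  have := h T.1 T.2
  rwa [E_of] at this

lemma induct_E {s n : ℕ} {p : KMod R s n → Prop} (h0 : p 0) (ha : ∀ a b, p a → p b → p (a + b))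
    (hs : ∀ (r : R) a, p a → p (r • a))
    (h : ∀ U : Finset (Fin s), U.card = n → p (E R n U)) (a : KMod R s n) : p a := by
  induction a using Finsupp.induction_linear with
  | zero => exact h0
  | add f g hf hg => exact ha _ _ hf hg
  | single T r =>
    have := hs r _ (h T.1 T.2)
    rwa [E_of, Finsupp.smul_single, smul_eq_mul, mul_one] at this

noncomputable def i0 (R : Type u) [CommRing R] (s n : ℕ) : KMod R s n →ₗ[R] KMod R (s + 1) n :=
  Finsupp.lmapDomain R R (fun T => ⟨T.1.map Fin.castSuccEmb, by simp [T.2]⟩)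

noncomputable def i1 (R : Type u) [CommRing R] (s n : ℕ) :
    KMod R s n →ₗ[R] KMod R (s + 1) (n + 1) :=
  Finsupp.lmapDomain R R (fun T => ⟨insert (Fin.last s) (T.1.map Fin.castSuccEmb), by
    rw [Finset.card_insert_of_notMem (by simp [Fin.castSucc_ne_last])]; simp [T.2]⟩)

lemma last_notMem {s : ℕ} (U : Finset (Fin s)) : Fin.last s ∉ U.map Fin.castSuccEmb := by
  simp [Fin.castSucc_ne_last]

lemma i0_E {s n : ℕ} (U : Finset (Fin s)) :
    i0 R s n (E R n U) = E R n (U.map Fin.castSuccEmb) := by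
  by_cases h : U.card = n
  · simp [E, h, i0]
  · simp [E, h]

lemma i1_E {s n : ℕ} (U : Finset (Fin s)) :
    i1 R s n (E R n U) = E R (n + 1) (insert (Fin.last s) (U.map Fin.castSuccEmb)) := by
  by_cases h : U.card = n
  · simp [E, h, i1, Finset.card_insert_of_notMem (last_notMem U)]
  · simp [E, h, Finset.card_insert_of_notMem (last_notMem U)]

lemma koszulD_i0 {s : ℕ} (x : Fin (s + 1) → R) (n : ℕ) (a : KMod R s (n + 1)) :
    koszulD R x n (i0 R s (n + 1) a) = i0 R s n (koszulD R (fun i => x i.castSucc) n a) := by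
  suffices h : (koszulD R x n).comp (i0 R s (n + 1)) =
      (i0 R s n).comp (koszulD R (fun i => x i.castSucc) n) from LinearMap.congr_fun h a
  refine ext_E fun U hU => ?_
  rw [LinearMap.comp_apply, LinearMap.comp_apply, i0_E, koszulD_E _ _ _ hU,
    koszulD_E _ _ _ (by simpa using hU), Finset.sum_map, map_sum]
  refine Finset.sum_congr rfl fun j _ => ?_
  rw [map_smul, i0_E, Finset.filter_map, Finset.card_map, Finset.map_erase]
  simp [Function.comp_def]

lemma koszulD_i1_E {s : ℕ} (x : Fin (s + 1) → R) (n : ℕ) (U : Finset (Fin s)) (hU : U.card = n) :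
    koszulD R x n (i1 R s n (E R n U)) =
      ((-1) ^ n * x (Fin.last s)) • i0 R s n (E R n U) +
      ∑ j ∈ U, ((-1 : R) ^ (U.filter (fun i => i < j)).card * x j.castSucc) •
        E R n (insert (Fin.last s) ((U.erase j).map Fin.castSuccEmb)) := by
  have hl := last_notMem U
  rw [i1_E, koszulD_E _ _ _ (by rw [Finset.card_insert_of_notMem hl]; simp [hU]),
    Finset.sum_insert hl, Finset.sum_map, Finset.erase_insert hl, i0_E]
  congr 1
  · congr 3
    rw [Finset.filter_insert, if_neg (lt_irrefl _), Finset.filter_true_of_mem]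
    · simp [hU]
    · intro i hi
      obtain ⟨k, _, rfl⟩ := Finset.mem_map.1 hi
      exact Fin.castSucc_lt_last k
  · refine Finset.sum_congr rfl fun j _ => ?_
    have h1 : (Fin.castSuccEmb j) ≠ Fin.last s := Fin.castSucc_ne_last j
    rw [Finset.filter_insert, if_neg (by exact not_lt.2 (Fin.le_last _)), Finset.filter_map,
      Finset.card_map, Finset.erase_insert_of_ne h1.symm, Finset.map_erase]
    simp [Function.comp_def]

lemma koszulD_i1 {s : ℕ} (x : Fin (s + 1) → R) (n : ℕ) (a : KMod R s (n + 1)) :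
    koszulD R x (n + 1) (i1 R s (n + 1) a) =
      ((-1) ^ (n + 1) * x (Fin.last s)) • i0 R s (n + 1) a +
      i1 R s n (koszulD R (fun i => x i.castSucc) n a) := by
  suffices h : (koszulD R x (n + 1)).comp (i1 R s (n + 1)) =
      ((-1) ^ (n + 1) * x (Fin.last s)) • i0 R s (n + 1) +
      (i1 R s n).comp (koszulD R (fun i => x i.castSucc) n) from LinearMap.congr_fun h a
  refine ext_E fun U hU => ?_
  rw [LinearMap.comp_apply, koszulD_i1_E _ _ _ hU, LinearMap.add_apply, LinearMap.smul_apply,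
    LinearMap.comp_apply, koszulD_E _ _ _ hU, map_sum]
  simp only [map_smul, i1_E]

lemma koszulD_i1_zero {s : ℕ} (x : Fin (s + 1) → R) (a : KMod R s 0) :
    koszulD R x 0 (i1 R s 0 a) = x (Fin.last s) • i0 R s 0 a := by
  suffices h : (koszulD R x 0).comp (i1 R s 0) = x (Fin.last s) • i0 R s 0
    from LinearMap.congr_fun h a
  refine ext_E fun U hU => ?_
  rw [LinearMap.comp_apply, koszulD_i1_E _ _ _ hU]
  rw [Finset.card_eq_zero] at hU
  subst hU
  simp

lemma exists_map {s : ℕ} (U : Finset (Fin (s + 1))) (h : Fin.last s ∉ U) :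
    ∃ V : Finset (Fin s), U = V.map Fin.castSuccEmb := by
  refine ⟨Finset.univ.filter (fun i => i.castSucc ∈ U), ?_⟩
  ext i
  induction i using Fin.lastCases with
  | last => simp [h, Fin.castSucc_ne_last]
  | cast i => simp

lemma decomp {s n : ℕ} (c : KMod R (s + 1) (n + 1)) : ∃ a b, c = i0 R s (n + 1) a + i1 R s n b := by
  induction c using induct_E with
  | h0 => exact ⟨0, 0, by simp⟩
  | ha c c' h h' =>
    obtain ⟨a, b, rfl⟩ := h
    obtain ⟨a', b', rfl⟩ := h'
    exact ⟨a + a', b + b', by simp only [map_add]; abel⟩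
  | hs r c h =>
    obtain ⟨a, b, rfl⟩ := h
    exact ⟨r • a, r • b, by simp only [map_smul, smul_add]⟩
  | h U hU =>
    by_cases hl : Fin.last s ∈ U
    · obtain ⟨V, hV⟩ := exists_map (U.erase (Fin.last s)) (by simp)
      refine ⟨0, E R n V, ?_⟩
      rw [i1_E, ← hV, Finset.insert_erase hl]; simp
    · obtain ⟨V, rfl⟩ := exists_map U hl
      exact ⟨E R (n + 1) V, 0, by rw [i0_E]; simp⟩

lemma i0_apply {s n : ℕ} (a : KMod R s n) (T : KIdx s n) :
    i0 R s n a ⟨T.1.map Fin.castSuccEmb, by simp [T.2]⟩ = a T := by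
  refine Finsupp.mapDomain_apply (fun T T' h => ?_) a T
  simpa [Subtype.ext_iff] using h

lemma i1_apply {s n : ℕ} (a : KMod R s n) (T : KIdx s n) :
    i1 R s n a ⟨insert (Fin.last s) (T.1.map Fin.castSuccEmb), by
      rw [Finset.card_insert_of_notMem (last_notMem _)]; simp [T.2]⟩ = a T := by
  refine Finsupp.mapDomain_apply (fun T T' h => ?_) a T
  have h := congrArg (fun T => T.1.erase (Fin.last s)) h
  simp only [Finset.erase_insert (last_notMem _)] at h
  simpa [Subtype.ext_iff] using h

lemma i0_i1_eq_zero {s n : ℕ} {a : KMod R s (n + 1)} {b : KMod R s n}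
    (h : i0 R s (n + 1) a + i1 R s n b = 0) : a = 0 ∧ b = 0 := by
  have h1 : ∀ T : KIdx s (n + 1), i1 R s n b ⟨T.1.map Fin.castSuccEmb, by simp [T.2]⟩ = 0 := by
    intro T
    refine Finsupp.mapDomain_of_notMem_range _ _ ?_
    rintro ⟨T', h⟩
    have := congrArg (fun T => T.1) h
    simp only at this
    exact last_notMem T.1 (this ▸ Finset.mem_insert_self _ _)
  have ha : a = 0 := by
    ext T
    have := DFunLike.congr_fun h ⟨T.1.map Fin.castSuccEmb, by simp [T.2]⟩
    rw [Finsupp.add_apply, i0_apply, h1, add_zero] at this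
    simpa using this
  subst ha
  refine ⟨rfl, ?_⟩
  ext T
  have := DFunLike.congr_fun h ⟨insert (Fin.last s) (T.1.map Fin.castSuccEmb), by
      rw [Finset.card_insert_of_notMem (last_notMem _)]; simp [T.2]⟩
  rw [map_zero, zero_add, i1_apply] at this
  simpa using this

lemma i0_inj {s n : ℕ} {a : KMod R s n} (h : i0 R s n a = 0) : a = 0 := by
  ext T
  rw [← i0_apply, h]; rfl

end Koszul

namespace Koszul
variable {R : Type u} [CommRing R]

lemma ofList_ofFn {s : ℕ} (x : Fin s → R) :
    Ideal.ofList (List.ofFn x) = Ideal.span (Set.range x) := by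
  rw [Ideal.ofList]; congr 1; ext r; simp [List.mem_ofFn]

lemma regular_snoc {s : ℕ} {x : Fin (s + 1) → R}
    (h : RingTheory.Sequence.IsWeaklyRegular R (List.ofFn x)) :
    RingTheory.Sequence.IsWeaklyRegular R (List.ofFn fun i : Fin s => x i.castSucc) ∧
    ∀ r, x (Fin.last s) * r ∈ Ideal.span (Set.range fun i : Fin s => x i.castSucc) →
      r ∈ Ideal.span (Set.range fun i : Fin s => x i.castSucc) := by
  rw [List.ofFn_succ', List.concat_eq_append, RingTheory.Sequence.isWeaklyRegular_append_iff,
    RingTheory.Sequence.isWeaklyRegular_singleton_iff] at h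
  refine ⟨h.1, fun r hr => ?_⟩
  rw [← ofList_ofFn] at hr ⊢
  have := @h.2 (Submodule.Quotient.mk r) 0 (by
    simp only [smul_zero, ← Submodule.Quotient.mk_smul]
    rw [Submodule.Quotient.mk_eq_zero]; simpa using hr)
  rw [Submodule.Quotient.mk_eq_zero] at this
  simpa using this

lemma range_D0 {s : ℕ} (x : Fin s → R) (a : KMod R s 0) :
    a ∈ LinearMap.range (koszulD R x 0) ↔ a ⟨∅, rfl⟩ ∈ Ideal.span (Set.range x) := by
  have key : ∀ r : R, ∀ j, koszulD R x 0 (r • E R 1 {j}) = (x j * r) • Finsupp.single ⟨∅, rfl⟩ 1 := by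
    intro r j
    rw [map_smul, koszulD_E _ _ _ (by simp), Finset.sum_singleton, Finset.filter_singleton,
      if_neg (lt_irrefl _), Finset.erase_singleton, smul_smul, E, dif_pos Finset.card_empty]
    simp [mul_comm]
  have uniq : ∀ T : KIdx s 0, T = ⟨∅, rfl⟩ := fun T => Subtype.ext (Finset.card_eq_zero.1 T.2)
  constructor
  · rintro ⟨c, rfl⟩
    induction c using induct_E with
    | h0 => simp
    | ha a b h h' => rw [map_add]; exact add_mem h h'
    | hs r a h => rw [map_smul]; exact Ideal.mul_mem_left _ _ h
    | h U hU =>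
      obtain ⟨j, rfl⟩ := Finset.card_eq_one.1 hU
      have := key 1 j
      rw [one_smul] at this
      rw [this]
      simpa using Ideal.subset_span (Set.mem_range_self j)
  · intro h
    have ha : a = (a (⟨∅, rfl⟩ : KIdx s 0)) • Finsupp.single (⟨∅, rfl⟩ : KIdx s 0) (1 : R) := by
      ext T; rw [uniq T]; simp
    rw [ha]
    generalize a ⟨∅, rfl⟩ = r at h
    induction h using Submodule.span_induction with
    | mem y hy =>
      obtain ⟨j, rfl⟩ := hy
      exact ⟨(1 : R) • E R 1 {j}, by rw [key, mul_one]⟩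
    | zero => simp
    | add y y' _ _ h h' => rw [add_smul]; exact add_mem h h'
    | smul r y _ h => rw [smul_assoc]; exact Submodule.smul_mem _ _ h

lemma exact {s : ℕ} (x : Fin s → R)
    (h : RingTheory.Sequence.IsWeaklyRegular R (List.ofFn x)) (n : ℕ) :
    LinearMap.ker (koszulD R x n) = LinearMap.range (koszulD R x (n + 1)) := by
  induction s generalizing n with
  | zero =>
    have : ∀ a : KMod R 0 (n + 1), a = 0 := fun a => by
      ext T
      have := T.2
      rw [Subsingleton.elim T.1 ∅] at this
      simp at this
    ext a
    rw [this a]; simp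
  | succ s ih =>
    obtain ⟨h1, h2⟩ := regular_snoc h
    have ih := ih _ h1
    set x' := fun i : Fin s => x i.castSucc with hx'
    ext c
    rw [LinearMap.mem_ker, LinearMap.mem_range]
    constructor
    · intro hc
      obtain ⟨a, b, rfl⟩ := decomp c
      obtain ⟨e, rfl⟩ : ∃ e, b = koszulD R x' n e := by
        cases n with
        | zero =>
          rw [map_add, koszulD_i0, koszulD_i1_zero, ← map_smul, ← map_add] at hc
          have := i0_inj hc
          suffices hb : b ∈ LinearMap.range (koszulD R x' 0) by
            obtain ⟨e, he⟩ := hb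
            exact ⟨e, he.symm⟩
          refine (range_D0 x' b).2 (h2 _ ?_)
          rw [show x (Fin.last s) * b ⟨∅, rfl⟩ = (x (Fin.last s) • b) ⟨∅, rfl⟩ from rfl, 
            ← range_D0, eq_neg_of_add_eq_zero_right this]
          exact neg_mem ⟨_, rfl⟩
        | succ n =>
          rw [map_add, koszulD_i0, koszulD_i1, ← map_smul, ← add_assoc, ← map_add] at hc
          have := (i0_i1_eq_zero hc).2
          have : b ∈ LinearMap.ker (koszulD R x' n) := this
          rw [ih] at this
          obtain ⟨e, he⟩ := this
          exact ⟨e, he.symm⟩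
      have hk : a - ((-1) ^ (n + 1) * x (Fin.last s)) • e ∈ LinearMap.ker (koszulD R x' n) := by
        rw [LinearMap.mem_ker, map_sub, map_smul]
        cases n with
        | zero =>
          rw [map_add, koszulD_i0, koszulD_i1_zero, ← map_smul, ← map_add] at hc
          have := i0_inj hc
          simpa using this
        | succ n =>
          rw [map_add, koszulD_i0, koszulD_i1, ← map_smul, ← add_assoc, ← map_add] at hc
          have := (i0_i1_eq_zero hc).1
          rw [← this, sub_eq_add_neg, ← neg_smul]
          congr 2
          ring
      rw [ih] at hk
      obtain ⟨f, hf⟩ := hk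
      refine ⟨i0 R s _ f + i1 R s _ e, ?_⟩
      rw [map_add, koszulD_i0, koszulD_i1, hf, map_sub, map_smul]
      abel
    · rintro ⟨y, rfl⟩
      obtain ⟨a, b, rfl⟩ := decomp y
      have dd : ∀ (m) (w : KMod R s (m + 2)), koszulD R x' m (koszulD R x' (m + 1) w) = 0 := by
        intro m w
        rw [← LinearMap.mem_ker, ih]; exact ⟨_, rfl⟩
      rw [map_add, koszulD_i0, koszulD_i1, map_add, map_add, koszulD_i0, dd, map_zero, map_smul,
        koszulD_i0]
      cases n with
      | zero =>
        rw [koszulD_i1_zero]; simp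
      | succ n =>
        rw [koszulD_i1, dd, map_zero, pow_succ _ (n + 1)]; simp

noncomputable def aug {s : ℕ} (x : Fin s → R) : KMod R s 0 →ₗ[R] R ⧸ Ideal.span (Set.range x) :=
  (Submodule.mkQ _).comp (Finsupp.lapply ⟨∅, rfl⟩)

/-- The Koszul resolution. -/
noncomputable def res {s : ℕ} (x : Fin s → R)
    (h : RingTheory.Sequence.IsWeaklyRegular R (List.ofFn x)) :
    ProjRes R (R ⧸ Ideal.span (Set.range x)) where
  F n := ModuleCat.of R (KMod R s n)
  d n := koszulD R x n
  ε := aug x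
  projective n := inferInstanceAs (Module.Projective R (KMod R s n))
  surj := by
    intro y
    obtain ⟨r, rfl⟩ := Submodule.Quotient.mk_surjective _ y
    exact ⟨Finsupp.single ⟨∅, rfl⟩ r, by simp [aug]⟩
  exact0 := by
    ext a
    change a ∈ LinearMap.ker (aug x) ↔ a ∈ LinearMap.range (koszulD R x 0)
    rw [range_D0, LinearMap.mem_ker]
    simp [aug]
    exact Ideal.Quotient.eq_zero_iff_mem
  exact := exact x h

end Koszul

namespace ExtTools
open CategoryTheory Abelian

variable {S : Type u} [CommRing S] {M M' : Type u} [AddCommGroup M] [Module S M]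
  [AddCommGroup M'] [Module S M'] {Y Y' : Type u} [AddCommGroup Y] [Module S Y]
  [AddCommGroup Y'] [Module S Y']

noncomputable def cplx (F : ProjRes S M) : ChainComplex (ModuleCat.{u} S) ℕ :=
  ChainComplex.of F.F (fun n => ModuleCat.ofHom (F.d n)) (fun n => by
    have : (F.d n).comp (F.d (n + 1)) = 0 := by
      ext x
      have : F.d (n + 1) x ∈ LinearMap.ker (F.d n) := by rw [F.exact]; exact ⟨x, rfl⟩
      exact this
    rw [← ModuleCat.ofHom_comp, this]; rfl)

lemma cplx_d (F : ProjRes S M) (n : ℕ) : (cplx F).d (n + 1) n = ModuleCat.ofHom (F.d n) :=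
  ChainComplex.of_d (V := ModuleCat.{u} S) F.F (fun n => ModuleCat.ofHom (F.d n)) n

lemma eps_d (F : ProjRes S M) : F.ε.comp (F.d 0) = 0 := by
  ext x
  have : F.d 0 x ∈ LinearMap.ker F.ε := by rw [F.exact0]; exact ⟨x, rfl⟩
  exact this

noncomputable def cplxπ (F : ProjRes S M) :
    cplx F ⟶ (ChainComplex.single₀ (ModuleCat.{u} S)).obj (ModuleCat.of S M) :=
  (ChainComplex.toSingle₀Equiv _ _).symm ⟨(ModuleCat.ofHom F.ε : F.F 0 ⟶ ModuleCat.of S M), by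
    rw [cplx_d]
    change ModuleCat.ofHom (F.ε.comp (F.d 0)) = 0
    rw [eps_d]; rfl⟩

lemma cplx_exactAt (F : ProjRes S M) (n : ℕ) : (cplx F).ExactAt (n + 1) := by
  rw [HomologicalComplex.exactAt_iff' _ (n + 1 + 1) (n + 1) n (by simp) (by simp)]
  rw [ShortComplex.ShortExact.moduleCat_exact_iff_function_exact]
  change Function.Exact ((cplx F).d (n + 1 + 1) (n + 1)) ((cplx F).d (n + 1) n)
  rw [cplx_d, cplx_d]
  exact LinearMap.exact_iff.2 (F.exact n)

noncomputable def toPR (F : ProjRes S M) : ProjectiveResolution (ModuleCat.of S M) where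
  complex := cplx F
  projective n := by
    have := F.projective n
    exact (IsProjective.iff_projective (F.F n)).1 this
  π := cplxπ F
  quasiIso := ⟨fun n => by
    cases n
    · rw [ChainComplex.quasiIsoAt₀_iff, ShortComplex.quasiIso_iff_of_zeros']
      · have hex : Function.Exact (F.d 0) F.ε := LinearMap.exact_iff.2 F.exact0
        refine (ShortComplex.exact_and_epi_g_iff_of_iso (S₁ := sc (F.d 0) F.ε hex) ?_).1
          ⟨?_, ?_⟩
        · refine ShortComplex.isoMk (Iso.refl _) (Iso.refl _) (Iso.refl _) ?_ ?_
          · exact (Category.id_comp _).trans ((cplx_d F 0).trans (Category.comp_id _).symm)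
          · exact (Category.id_comp _).trans
              ((ChainComplex.toSingle₀Equiv_symm_apply_f_zero _ _).trans (Category.comp_id _).symm)
        · rw [ShortComplex.ShortExact.moduleCat_exact_iff_function_exact]; exact hex
        · exact (ModuleCat.epi_iff_surjective _).2 F.surj
      all_goals rfl
    · rw [quasiIsoAt_iff_exactAt']
      · apply cplx_exactAt
      · apply ChainComplex.exactAt_succ_single_obj⟩

/-- The class of a cocycle. -/
noncomputable def cls (F : ProjRes S M) (n : ℕ) (y : F.F n →ₗ[S] Y) (hy : y.comp (F.d n) = 0) :
    EX S M Y n :=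
  (toPR F).extMk (Y := ModuleCat.of S Y) (n := n) (ModuleCat.ofHom y : F.F n ⟶ _) (n + 1) rfl
    (by
      change (cplx F).d (n + 1) n ≫ _ = _
      rw [cplx_d]
      exact congrArg ModuleCat.ofHom hy)

lemma cls_eq_zero (F : ProjRes S M) (n : ℕ) (y : F.F (n + 1) →ₗ[S] Y)
    (hy : y.comp (F.d (n + 1)) = 0) (h : cls F (n + 1) y hy = 0) :
    ∃ g : F.F n →ₗ[S] Y, y = g.comp (F.d n) := by
  obtain ⟨g, hg⟩ := ((toPR F).extMk_eq_zero_iff _ _ _ _ n rfl).1 h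
  change (cplx F).d (n + 1) n ≫ g = _ at hg
  rw [cplx_d] at hg
  exact ⟨g.hom, (congrArg ModuleCat.Hom.hom hg).symm⟩

lemma cls_surj (F : ProjRes S M) (n : ℕ) (e : EX S M Y n) :
    ∃ (y : F.F n →ₗ[S] Y) (hy : y.comp (F.d n) = 0), e = cls F n y hy := by
  obtain ⟨f, hf, he⟩ := (toPR F).extMk_surjective e (n + 1) rfl
  refine ⟨f.hom, ?_, he.symm⟩
  change (cplx F).d (n + 1) n ≫ _ = _ at hf
  rw [cplx_d] at hf
  exact congrArg ModuleCat.Hom.hom hf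

lemma cls_add (F : ProjRes S M) (n : ℕ) (y y' : F.F n →ₗ[S] Y) (hy : y.comp (F.d n) = 0)
    (hy' : y'.comp (F.d n) = 0) (h : (y + y').comp (F.d n) = 0) :
    cls F n (y + y') h = cls F n y hy + cls F n y' hy' :=
  ((toPR F).add_extMk _ _ _ _ _ _).symm

lemma post_cls (F : ProjRes S M) (n : ℕ) (g : Y →ₗ[S] Y') (y : F.F n →ₗ[S] Y)
    (hy : y.comp (F.d n) = 0) (h : (g.comp y).comp (F.d n) = 0) :
    post M n g (cls F n y hy) = cls F n (g.comp y) h :=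
  (toPR F).extMk_comp_mk₀ (Y := ModuleCat.of S Y) (Y' := ModuleCat.of S Y')
    (ModuleCat.ofHom y : F.F n ⟶ _) (n + 1) rfl _ (ModuleCat.ofHom g)

lemma cls_smul (F : ProjRes S M) (n : ℕ) (r : S) (y : F.F n →ₗ[S] Y) (hy : y.comp (F.d n) = 0)
    (h : (r • y).comp (F.d n) = 0) :
    cls F n (r • y) h = r • cls F n y hy := by
  have h1 := post_smul n r LinearMap.id (cls F n y hy)
  rw [post_id] at h1
  have h2 : ((r • LinearMap.id : Y →ₗ[S] Y).comp y).comp (F.d n) = 0 := by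
    rw [LinearMap.comp_assoc, hy, LinearMap.comp_zero]
  have h3 := post_cls F n (r • LinearMap.id) y hy h2
  exact h3.symm.trans h1

lemma cls_zero (F : ProjRes S M) (n : ℕ) (h : (0 : F.F n →ₗ[S] Y).comp (F.d n) = 0) :
    cls F n (0 : F.F n →ₗ[S] Y) h = 0 :=
  (toPR F).extMk_zero _ _

lemma pre_cls (F : ProjRes S M) (F' : ProjRes S M') (f : M' →ₗ[S] M)
    (ψ : ∀ n, F'.F n →ₗ[S] F.F n) (h : ∀ n, (F.d n).comp (ψ (n + 1)) = (ψ n).comp (F'.d n))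
    (hε : F.ε.comp (ψ 0) = f.comp F'.ε)
    (n : ℕ) (y : F.F n →ₗ[S] Y) (hy : y.comp (F.d n) = 0) (hy' : (y.comp (ψ n)).comp (F'.d n) = 0) :
    pre Y n f (cls F n y hy) = cls F' n (y.comp (ψ n)) hy' := by
  let χ : cplx F' ⟶ cplx F := ChainComplex.ofHom (V := ModuleCat.{u} S)
    (fun n => ModuleCat.ofHom (ψ n)) (fun n => by
      rw [cplx_d, cplx_d]; exact congrArg ModuleCat.ofHom (h n))
  let φ : (toPR F').Hom (toPR F) (ModuleCat.ofHom f) :=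
    { hom := χ
      hom_f_zero_comp_π_f_zero := by
        change ModuleCat.ofHom (ψ 0) ≫ (cplxπ F).f 0 = (cplxπ F').f 0 ≫ _
        have e1 := ChainComplex.toSingle₀Equiv_symm_apply_f_zero (C := cplx F)
          (X := ModuleCat.of S M) (ModuleCat.ofHom F.ε : F.F 0 ⟶ ModuleCat.of S M) (by 
            rw [cplx_d]; exact congrArg ModuleCat.ofHom (eps_d F))
        have e2 := ChainComplex.toSingle₀Equiv_symm_apply_f_zero (C := cplx F')
          (X := ModuleCat.of S M') (ModuleCat.ofHom F'.ε : F'.F 0 ⟶ ModuleCat.of S M') (by 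
            rw [cplx_d]; exact congrArg ModuleCat.ofHom (eps_d F'))
        unfold cplxπ
        erw [e1, e2]
        exact congrArg ModuleCat.ofHom hε }
  exact ProjectiveResolution.mk₀_comp_extMk (R := toPR F) (Y := ModuleCat.of S Y)
    (ModuleCat.ofHom y : F.F n ⟶ _) (n + 1) rfl _ φ

end ExtTools

namespace ExtTools
open CategoryTheory Abelian

variable {S : Type u} [CommRing S] {M M' : Type u} [AddCommGroup M] [Module S M]
  [AddCommGroup M'] [Module S M'] {Y Y' : Type u} [AddCommGroup Y] [Module S Y]
  [AddCommGroup Y'] [Module S Y']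

lemma pre_sum {ι : Type*} (s : Finset ι) (i : ℕ) (f : ι → (M' →ₗ[S] M)) (e : EX S M Y i) :
    pre Y i (∑ k ∈ s, f k) e = ∑ k ∈ s, pre Y i (f k) e := by
  classical
  induction s using Finset.induction_on with
  | empty => simp [pre_zero]
  | insert a s ha ih => rw [Finset.sum_insert ha, pre_add, ih, Finset.sum_insert ha]

/-- Vanishing of `Ext` passes to finite powers. -/
lemma eq_zero_pi (i r : ℕ) (h : ∀ e : EX S M Y i, e = 0) (e : EX S (Fin r → M) Y i) : e = 0 := by
  have hid : (LinearMap.id : (Fin r → M) →ₗ[S] (Fin r → M)) =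
      ∑ k, (LinearMap.single S (fun _ => M) k).comp (LinearMap.proj k) := by
    ext; simp [Pi.single_apply, Finset.sum_apply]
  rw [← pre_id i e, hid, pre_sum]
  refine Finset.sum_eq_zero fun k _ => ?_
  rw [pre_comp, h (pre Y i (LinearMap.single S (fun _ => M) k) e), map_zero]

/-- The duality argument: a class on `S/𝔷` vanishing on `I/𝔷` lies in `J`. -/
theorem mem_smul_of_restrict_zero [IsNoetherianRing S] (I J 𝔷 : Ideal S) (hI : 𝔷 ≤ I)
    (U0 : ∀ a ∈ I, ∀ j ∈ J, a * j ∈ 𝔷)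
    (U1 : ∀ r, (∀ j ∈ J, r * j ∈ 𝔷) → r ∈ I)
    (U2 : ∀ f : J →ₗ[S] S ⧸ 𝔷, (∀ j : J, j.1 ∈ 𝔷 → f j = 0) →
      ∃ a : S, ∀ j : J, f j = Ideal.Quotient.mk 𝔷 (a * j.1))
    (hJ : 𝔷 ≤ J) (d : ℕ)
    (hv1 : ∀ e : EX S (S ⧸ 𝔷) Y (d + 1), e = 0)
    (hv2 : ∀ (N : ModuleCat.{u} S), Module.Finite S N → ∀ e : EX S N Y (d + 2), e = 0)
    (c : Y →ₗ[S] EX S (S ⧸ 𝔷) Y d) (hc : Function.Surjective c)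
    (hc0 : ∀ y, c y = 0 → y ∈ 𝔷 • (⊤ : Submodule S Y)) (y : Y)
    (hy : pre Y d (Submodule.mapQ (Submodule.comap I.subtype 𝔷) 𝔷 I.subtype
      (fun a ha => ha)) (c y) = 0) :
    y ∈ J • (⊤ : Submodule S Y) := by
  classical
  obtain ⟨r, j, hj⟩ := Submodule.fg_iff_exists_fin_generating_family.1 (IsNoetherian.noetherian J)
  have hjm : ∀ i, j i ∈ J := fun i => hj ▸ Submodule.subset_span ⟨i, rfl⟩
  -- the map `S/I → (S/𝔷)^r`
  let α0 : S →ₗ[S] (Fin r → S ⧸ 𝔷) := LinearMap.pi fun i =>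
    LinearMap.toSpanSingleton S (S ⧸ 𝔷) (Ideal.Quotient.mk 𝔷 (j i))
  have hα0 : ∀ a i, α0 a i = Ideal.Quotient.mk 𝔷 (a * j i) := fun a i => by
    simp [α0, Algebra.smul_def]
  have hker : LinearMap.ker α0 = I := by
    ext a
    rw [LinearMap.mem_ker]
    constructor
    · intro h
      refine U1 a fun b hb => ?_
      rw [← hj] at hb
      induction hb using Submodule.span_induction with
      | mem x hx =>
        obtain ⟨i, rfl⟩ := hx
        have := congrFun h i
        rw [hα0] at this
        exact Ideal.Quotient.eq_zero_iff_mem.1 this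
      | zero => simp
      | add x y _ _ h h' => rw [mul_add]; exact add_mem h h'
      | smul t x _ h => rw [smul_eq_mul, mul_left_comm]; exact Ideal.mul_mem_left _ _ h
    · intro h
      ext i
      rw [hα0]
      exact Ideal.Quotient.eq_zero_iff_mem.2 (U0 a h _ (hjm i))
  let α : (S ⧸ I) →ₗ[S] (Fin r → S ⧸ 𝔷) := Submodule.liftQ I α0 hker.ge
  have hαi : Function.Injective α := by
    rw [← LinearMap.ker_eq_bot]
    exact Submodule.ker_liftQ_eq_bot _ _ _ hker.le
  -- relations
  let ρ : (Fin r → S) →ₗ[S] S := ∑ i, (LinearMap.proj i).smulRight (j i)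
  have hρ : ∀ t, ρ t = ∑ i, t i * j i := fun t => by simp [ρ]
  obtain ⟨r', t, ht⟩ := Submodule.fg_iff_exists_fin_generating_family.1
    (IsNoetherian.noetherian (Submodule.comap ρ 𝔷))
  let β : (Fin r → S ⧸ 𝔷) →ₗ[S] (Fin r' → S ⧸ 𝔷) :=
    LinearMap.pi fun k => ∑ i, t k i • LinearMap.proj i
  have hβ : ∀ b k, β b k = ∑ i, t k i • b i := fun b k => by simp [β]
  have hex : Function.Exact α β := by
    intro b
    constructor
    · intro hb
      have hb' : ∀ s : Fin r → S, ρ s ∈ 𝔷 → ∑ i, s i • b i = 0 := by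
        intro s hs
        have hs' : s ∈ Submodule.comap ρ 𝔷 := hs
        rw [← ht] at hs'
        clear hs
        induction hs' using Submodule.span_induction with
        | mem x hx =>
          obtain ⟨k, rfl⟩ := hx
          rw [← hβ, hb]; rfl
        | zero => simp
        | add x y _ _ h h' => simp [add_smul, Finset.sum_add_distrib, h, h']
        | smul a x _ h => simp only [Pi.smul_apply, smul_assoc, ← Finset.smul_sum, h, smul_zero]
      -- lift to a homomorphism on J
      have hsur : ∀ x : J, ∃ s : Fin r → S, ρ s = x.1 := by
        intro x
        have hx : x.1 ∈ Submodule.span S (Set.range j) := hj.ge x.2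
        obtain ⟨s, hs⟩ := (Submodule.mem_span_range_iff_exists_fun S).1 hx
        exact ⟨s, by rw [hρ]; simpa using hs⟩
      choose σ hσ using hsur
      have hval : ∀ (x : J) (s : Fin r → S), ρ s = x.1 → ∑ i, s i • b i = ∑ i, σ x i • b i := by
        intro x s hs
        have := hb' (s - σ x) (by rw [map_sub, hs, hσ, sub_self]; exact zero_mem _)
        simpa [sub_smul, Finset.sum_sub_distrib, sub_eq_zero] using this
      let f : J →ₗ[S] S ⧸ 𝔷 :=
        { toFun x := ∑ i, σ x i • b i
          map_add' x x' := by
            rw [← hval (x + x') (σ x + σ x') (by rw [map_add, hσ, hσ]; rfl)]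
            simp [add_smul, Finset.sum_add_distrib]
          map_smul' a x := by
            rw [← hval (a • x) (a • σ x) (by rw [map_smul, hσ]; rfl)]
            simp [Finset.smul_sum, mul_smul] }
      obtain ⟨a, ha⟩ := U2 f (fun x hx => hb' _ (by rw [hσ]; exact hx))
      refine ⟨Submodule.Quotient.mk a, ?_⟩
      ext i
      have h1 := ha ⟨j i, hjm i⟩
      have h2 := hval ⟨j i, hjm i⟩ (Pi.single i 1) (by simp [hρ, Pi.single_apply])
      change α0 a i = b i
      rw [hα0, ← h1]
      change ∑ i', σ ⟨j i, hjm i⟩ i' • b i' = _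
      rw [← h2]
      simp [Pi.single_apply]
    · rintro ⟨a, rfl⟩
      obtain ⟨a, rfl⟩ := Submodule.Quotient.mk_surjective _ a
      ext k
      change β (α0 a) k = 0
      have hk : ρ (t k) ∈ 𝔷 := by
        have : t k ∈ Submodule.comap ρ 𝔷 := ht ▸ Submodule.subset_span ⟨k, rfl⟩
        exact this
      rw [hβ]
      have : ∑ i, t k i • α0 a i = Ideal.Quotient.mk 𝔷 (a * ρ (t k)) := by
        rw [hρ, Finset.mul_sum, map_sum]
        refine Finset.sum_congr rfl fun i _ => ?_
        rw [hα0, Algebra.smul_def, Ideal.Quotient.algebraMap_eq, ← map_mul]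
        congr 1; ring
      rw [this]
      exact Ideal.Quotient.eq_zero_iff_mem.2 (Ideal.mul_mem_left _ _ hk)
  -- `Ext^{d+1}` of the image of `β` vanishes
  have hB : ∀ e : EX S (LinearMap.range β) Y (d + 1), e = 0 := by
    intro e
    obtain ⟨-, δ, h1, h2⟩ := contra_les (LinearMap.range β).injective_subtype
      (LinearMap.exact_subtype_mkQ (LinearMap.range β)) (Submodule.mkQ_surjective _) Y (d + 1)
    have h3 : δ e = 0 := hv2 (ModuleCat.of S _) (by
      change Module.Finite S ((Fin r' → S ⧸ 𝔷) ⧸ LinearMap.range β); infer_instance) _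
    obtain ⟨e', rfl⟩ := (h1 e).1 h3
    rw [eq_zero_pi _ _ hv1 e', map_zero]
  have hex' : Function.Exact α β.rangeRestrict := by
    intro b
    rw [← hex b]
    exact ⟨fun h => congrArg Subtype.val h, fun h => Subtype.ext h⟩
  obtain ⟨-, δ, h1, -⟩ := contra_les hαi hex' β.surjective_rangeRestrict Y d
  -- the class comes from `S/I`
  let π : (S ⧸ 𝔷) →ₗ[S] (S ⧸ I) := Submodule.mapQ 𝔷 I LinearMap.id hI
  have hπ : Function.Exact (Submodule.mapQ (Submodule.comap I.subtype 𝔷) 𝔷 I.subtype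
      (fun a ha => ha)) π := by
    intro b
    obtain ⟨b, rfl⟩ := Submodule.Quotient.mk_surjective _ b
    change (Submodule.Quotient.mk b : S ⧸ I) = 0 ↔ _
    rw [Submodule.Quotient.mk_eq_zero]
    constructor
    · intro hb
      exact ⟨Submodule.Quotient.mk ⟨b, hb⟩, rfl⟩
    · rintro ⟨w, hw⟩
      obtain ⟨w, rfl⟩ := Submodule.Quotient.mk_surjective _ w
      have : (Submodule.Quotient.mk w.1 : S ⧸ 𝔷) = Submodule.Quotient.mk b := hw
      rw [Submodule.Quotient.eq] at this
      have := I.sub_mem w.2 (hI this)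
      simpa using this
  have hinj : Function.Injective (Submodule.mapQ (Submodule.comap I.subtype 𝔷) 𝔷 I.subtype
      (fun a ha => ha)) := by
    rw [← LinearMap.ker_eq_bot, Submodule.ker_mapQ]
    ext w
    obtain ⟨w, rfl⟩ := Submodule.Quotient.mk_surjective _ w
    simp
  have hπs : Function.Surjective π := by
    intro b
    obtain ⟨b, rfl⟩ := Submodule.Quotient.mk_surjective _ b
    exact ⟨Submodule.Quotient.mk b, rfl⟩
  obtain ⟨h4, -⟩ := contra_les hinj hπ hπs Y d
  obtain ⟨e, he⟩ := (h4 (c y)).1 hy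
  obtain ⟨e', rfl⟩ := (h1 e).1 (hB _)
  have hcomp : α.comp π = ∑ i, j i • LinearMap.single S (fun _ => S ⧸ 𝔷) i := by
    refine LinearMap.ext fun b => ?_
    obtain ⟨b, rfl⟩ := Submodule.Quotient.mk_surjective _ b
    change α0 b = _
    ext i
    rw [hα0]
    simp only [LinearMap.sum_apply, LinearMap.smul_apply, LinearMap.single_apply, Finset.sum_apply,
      Pi.smul_apply, Pi.single_apply, smul_ite, smul_zero, Finset.sum_ite_eq, Finset.mem_univ,
      if_true]
    rw [mul_comm]; rfl
  rw [← pre_comp, hcomp, pre_sum] at he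
  choose y' hy' using fun i => hc (pre Y d (LinearMap.single S (fun _ => S ⧸ 𝔷) i) e')
  have h5 : c (∑ i, j i • y' i) = c y := by
    rw [← he, map_sum]
    refine Finset.sum_congr rfl fun i _ => ?_
    rw [map_smul, hy', pre_smul]
  have h6 := hc0 (y - ∑ i, j i • y' i) (by rw [map_sub, h5, sub_self])
  have h7 : ∑ i, j i • y' i ∈ J • (⊤ : Submodule S Y) :=
    Submodule.sum_mem _ fun i _ => Submodule.smul_mem_smul (hjm i) trivial
  have := add_mem (Submodule.smul_mono_left hJ h6) h7
  simpa using this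

end ExtTools

namespace ExtTools

variable {S : Type u} [CommRing S] {Y : Type u} [AddCommGroup Y] [Module S Y]

instance kIdxEmpty (d : ℕ) : IsEmpty (KIdx d (d + 1)) :=
  ⟨fun T => by
    have := Finset.card_le_univ T.1
    rw [T.2, Fintype.card_fin] at this
    omega⟩

lemma kIdx_eq_univ {d : ℕ} (T : KIdx d d) : T = ⟨Finset.univ, Finset.card_fin d⟩ :=
  Subtype.ext ((Finset.card_eq_iff_eq_univ T.1).1 (T.2.trans (Fintype.card_fin d).symm))

/-- The functional on the top term of the Koszul complex with value `y`. -/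
noncomputable def topMap (d : ℕ) : Y →ₗ[S] KMod S d d →ₗ[S] Y :=
  LinearMap.flip ((LinearMap.lsmul S Y).comp (Finsupp.lapply ⟨Finset.univ, Finset.card_fin d⟩))

lemma topMap_apply (d : ℕ) (y : Y) (f : KMod S d d) :
    topMap d y f = f ⟨Finset.univ, Finset.card_fin d⟩ • y := rfl

lemma comp_koszulD_top {d : ℕ} (z : Fin d → S) (g : KMod S d d →ₗ[S] Y) :
    g.comp (koszulD S z d) = 0 := by
  refine LinearMap.ext fun f => ?_
  rw [Subsingleton.elim f 0, map_zero, map_zero]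

lemma cls_congr {M : Type u} [AddCommGroup M] [Module S M] (F : ProjRes S M) (n : ℕ)
    {y y' : F.F n →ₗ[S] Y} (h : y = y') (hy : y.comp (F.d n) = 0) :
    cls F n y hy = cls F n y' (h ▸ hy) := by subst h; rfl

/-- Koszul top classes. -/
noncomputable def topCls {d : ℕ} (z : Fin d → S)
    (h : RingTheory.Sequence.IsWeaklyRegular S (List.ofFn z)) :
    Y →ₗ[S] EX S (S ⧸ Ideal.span (Set.range z)) Y d where
  toFun y := cls (Koszul.res z h) d (topMap d y) (comp_koszulD_top z _)
  map_add' y y' := by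
    have := cls_add (Koszul.res z h) d (topMap d y) (topMap d y') (comp_koszulD_top z _)
      (comp_koszulD_top z _) (comp_koszulD_top z _)
    refine Eq.trans ?_ this
    exact cls_congr _ _ (map_add _ _ _) _
  map_smul' r y := by
    have := cls_smul (Koszul.res z h) d r (topMap d y) (comp_koszulD_top z _)
      (comp_koszulD_top z _)
    refine Eq.trans ?_ this
    exact cls_congr _ _ (map_smul _ _ _) _

lemma topCls_surj {d : ℕ} (z : Fin d → S)
    (h : RingTheory.Sequence.IsWeaklyRegular S (List.ofFn z)) :
    Function.Surjective (topCls (Y := Y) z h) := by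
  intro e
  obtain ⟨g, hg, rfl⟩ := cls_surj (Koszul.res z h) d e
  refine ⟨g (Finsupp.single ⟨Finset.univ, Finset.card_fin d⟩ (1 : S)), ?_⟩
  refine cls_congr (Koszul.res z h) d ?_ (comp_koszulD_top z _)
  refine Finsupp.lhom_ext fun T b => ?_
  obtain rfl := kIdx_eq_univ T
  rw [topMap_apply, Finsupp.single_eq_same]
  refine (LinearMap.map_smul g b _).symm.trans ?_
  congr 1
  exact (Finsupp.smul_single_one _ b)

lemma topCls_eq_zero {d : ℕ} (z : Fin (d + 1) → S)
    (h : RingTheory.Sequence.IsWeaklyRegular S (List.ofFn z)) (y : Y)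
    (hy : topCls z h y = 0) : y ∈ Ideal.span (Set.range z) • (⊤ : Submodule S Y) := by
  obtain ⟨g, hg⟩ := cls_eq_zero (Koszul.res z h) d (topMap (d + 1) y) (comp_koszulD_top z _) hy
  have h1 := LinearMap.congr_fun hg (Finsupp.single ⟨Finset.univ, Finset.card_fin (d + 1)⟩ (1 : S))
  have h2 : y = g (koszulD S z d (Finsupp.single ⟨Finset.univ, Finset.card_fin (d + 1)⟩ (1 : S))) := by
    refine Eq.trans ?_ h1
    rw [topMap_apply, Finsupp.single_eq_same, one_smul]
  rw [h2, koszulD, Finsupp.lsum_single, LinearMap.toSpanSingleton_apply, one_smul]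
  refine (congrArg (· ∈ _) (map_sum g _ _)).mpr ?_
  refine Submodule.sum_mem _ fun j _ => ?_
  refine (congrArg (· ∈ _) (LinearMap.map_smul g _ _)).mpr ?_
  exact Submodule.smul_mem_smul (Ideal.mul_mem_left _ _ (Ideal.subset_span ⟨_, rfl⟩)) trivial

lemma koszul_ext_succ {d : ℕ} (z : Fin d → S)
    (h : RingTheory.Sequence.IsWeaklyRegular S (List.ofFn z))
    (e : EX S (S ⧸ Ideal.span (Set.range z)) Y (d + 1)) : e = 0 := by
  obtain ⟨g, hg, rfl⟩ := cls_surj (Koszul.res z h) (d + 1) e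
  have : g = 0 := by
    refine LinearMap.ext fun f => ?_
    have : f = 0 := Subsingleton.elim (α := KMod S d (d + 1)) f 0
    rw [this, map_zero, map_zero]
  subst this
  exact cls_zero _ _ _

/-- A module `X` with an element `ξ` killed by `J`, not in `𝔪X`, and with vanishing
`Ext` into its character module forces `ψ_d` to be onto. -/
theorem psi_surj [IsLocalRing S] [IsNoetherianRing S] (I J : Ideal S) (d : ℕ)
    (z : Fin (d + 1) → S) (hzI : Ideal.span (Set.range z) ≤ I)
    (hz : RingTheory.Sequence.IsWeaklyRegular S (List.ofFn z))
    (U0 : ∀ a ∈ I, ∀ j ∈ J, a * j ∈ Ideal.span (Set.range z))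
    (U1 : ∀ r, (∀ j ∈ J, r * j ∈ Ideal.span (Set.range z)) → r ∈ I)
    (U2 : ∀ f : J →ₗ[S] S ⧸ Ideal.span (Set.range z),
      (∀ j : J, j.1 ∈ Ideal.span (Set.range z) → f j = 0) →
      ∃ a : S, ∀ j : J, f j = Ideal.Quotient.mk (Ideal.span (Set.range z)) (a * j.1))
    (hJ : Ideal.span (Set.range z) ≤ J)
    (X : Type u) [AddCommGroup X] [Module S X] (ξ : X) (hJξ : ∀ j ∈ J, j • ξ = 0)
    (hξ : ξ ∉ maximalIdeal S • (⊤ : Submodule S X))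
    (hX : ∀ (N : ModuleCat.{u} S), Module.Finite S N →
      ∀ e : EX S N (CharacterModule X) (d + 1 + 2), e = 0)
    (P : ProjRes S (↥I ⧸ Submodule.comap I.subtype (Ideal.span (Set.range z))))
    (ψ : ∀ n, P.F n →ₗ[S] KMod S (d + 1) n)
    (hcomm : ∀ n, (koszulD S z n).comp (ψ (n + 1)) = (ψ n).comp (P.d n))
    (haug : ∀ w : P.F 0,
      Ideal.Quotient.mk (Ideal.span (Set.range z)) ((ψ 0 w) ⟨∅, rfl⟩) =
        Submodule.mapQ (Submodule.comap I.subtype (Ideal.span (Set.range z)))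
          (Ideal.span (Set.range z)) I.subtype (fun a ha => ha) (P.ε w)) :
    Function.Surjective (ψ (d + 1)) := by
  let q : KMod S (d + 1) (d + 1) →ₗ[S] S :=
    Finsupp.lapply ⟨Finset.univ, Finset.card_fin (d + 1)⟩
  by_contra hns
  have hrange : ∀ w, q (ψ (d + 1) w) ∈ maximalIdeal S := by
    intro w
    by_contra hw
    rw [IsLocalRing.mem_maximalIdeal, mem_nonunits_iff, not_not] at hw
    obtain ⟨v, hv⟩ := hw
    refine hns fun f => ⟨(q f * ↑v⁻¹ : S) • w, ?_⟩
    ext T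
    obtain rfl := kIdx_eq_univ T
    rw [map_smul]
    change (q f * ↑v⁻¹ : S) * q (ψ (d + 1) w) = q f
    rw [← hv, mul_assoc, Units.inv_mul, mul_one]
  have hne : Submodule.Quotient.mk (p := maximalIdeal S • (⊤ : Submodule S X)) ξ ≠ 0 := by
    rwa [Ne, Submodule.Quotient.mk_eq_zero]
  obtain ⟨χ, hχ⟩ := CharacterModule.exists_character_apply_ne_zero_of_ne_zero hne
  let y : CharacterModule X := CharacterModule.dual
    (Submodule.mkQ (maximalIdeal S • (⊤ : Submodule S X))) χ
  have hyξ : y ξ ≠ 0 := hχ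
  have hmy : ∀ r ∈ maximalIdeal S, r • y = 0 := by
    intro r hr
    refine DFunLike.ext _ _ fun x => ?_
    change χ (Submodule.mkQ _ (r • x)) = 0
    have : Submodule.mkQ (maximalIdeal S • (⊤ : Submodule S X)) (r • x) = 0 :=
      (Submodule.Quotient.mk_eq_zero _).2 (Submodule.smul_mem_smul hr trivial)
    rw [this, map_zero]
  have key := mem_smul_of_restrict_zero I J _ hzI U0 U1 U2 hJ (d + 1)
    (koszul_ext_succ (Y := CharacterModule X) z hz) hX (topCls z hz) (topCls_surj z hz)
    (topCls_eq_zero z hz) y (by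
      have := pre_cls (Koszul.res z hz) P
        (Submodule.mapQ (Submodule.comap I.subtype (Ideal.span (Set.range z))) 
          (Ideal.span (Set.range z)) I.subtype (fun a ha => ha)) ψ hcomm
        (LinearMap.ext haug) (d + 1) (topMap (d + 1) y) (comp_koszulD_top z _) (by
          change (topMap (d + 1) y).comp ((ψ (d + 1)).comp (P.d (d + 1))) = 0
          rw [← hcomm]
          change ((topMap (d + 1) y).comp (koszulD S z (d + 1))).comp (ψ (d + 1 + 1)) = 0
          rw [comp_koszulD_top, LinearMap.zero_comp])
      refine this.trans ?_
      have h0 : (topMap (d + 1) y).comp (ψ (d + 1)) = 0 :=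
        LinearMap.ext fun w => hmy _ (hrange w)
      have h1 := cls_zero (Y := CharacterModule X) P (d + 1) (LinearMap.zero_comp _)
      exact (cls_congr P (d + 1) h0 _).trans h1)
  refine hyξ (Submodule.smul_induction_on (p := fun v : CharacterModule X => v ξ = 0) key ?_ ?_)
  · intro r hr n _
    change n (r • ξ) = 0
    rw [hJξ r hr, map_zero]
  · intro a b ha hb
    change a ξ + b ξ = 0
    rw [ha, hb, add_zero]

end ExtTools

namespace CMTools
open RingTheory.Sequence Pointwise

/-- `Q` is prime and the annihilator of an element of `M`. -/
def AssP {S : Type*} [CommRing S] (Q : Ideal S) (M : Type*) [AddCommGroup M] [Module S M] : Prop :=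
  Q.IsPrime ∧ ∃ x : M, ∀ r, r ∈ Q ↔ r • x = 0

variable {S : Type u} [CommRing S] {M : Type*} [AddCommGroup M] [Module S M]
  {M' : Type*} [AddCommGroup M'] [Module S M']

lemma assP_iff [IsNoetherianRing S] (Q : Ideal S) : AssP Q M ↔ Q ∈ associatedPrimes S M := by
  rw [AssociatedPrimes.mem_iff, isAssociatedPrime_iff]
  refine and_congr_right fun _ => exists_congr fun x => ?_
  rw [SetLike.ext_iff]
  refine forall_congr' fun r => ?_
  rw [Submodule.mem_colon_singleton, Submodule.mem_bot]

lemma AssP.of_injective {Q : Ideal S} (h : AssP Q M) (f : M →ₗ[S] M') (hf : Function.Injective f) :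
    AssP Q M' := by
  obtain ⟨hQ, x, hx⟩ := h
  refine ⟨hQ, f x, fun r => ?_⟩
  rw [hx, ← map_smul, map_eq_zero_iff f hf]

lemma exists_assP [IsNoetherianRing S] (x : M) (P : Ideal S) [P.IsPrime]
    (h : ∀ r : S, r • x = 0 → r ∈ P) :
    ∃ Q, AssP Q M ∧ (∀ r : S, r • x = 0 → r ∈ Q) ∧ Q ≤ P := by
  have hle : (⊥ : Submodule S M).colon {x} ≤ P := fun r hr => h r (by
    rwa [Submodule.mem_colon_singleton, Submodule.mem_bot] at hr)
  obtain ⟨Q, hQ, hQP⟩ := Ideal.exists_minimalPrimes_le hle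
  obtain ⟨y, hy⟩ := Submodule.exists_eq_colon_of_mem_minimalPrimes hQ
  refine ⟨Q, ⟨hQ.1.1, y, fun r => ?_⟩, fun r hr => hQ.1.2 ?_, hQP⟩
  · rw [hy, Submodule.mem_colon_singleton, Submodule.mem_bot]
  · rwa [Submodule.mem_colon_singleton, Submodule.mem_bot]

lemma exists_assP_of_not_regular [IsNoetherianRing S] {r : S} (h : ¬ IsSMulRegular M r) :
    ∃ Q, AssP Q M ∧ r ∈ Q := by
  have : r ∈ ({ r : S | IsSMulRegular M r }ᶜ : Set S) := h
  rw [← biUnion_associatedPrimes_eq_compl_regular, Set.mem_iUnion₂] at this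
  obtain ⟨Q, hQ, hr⟩ := this
  exact ⟨Q, (assP_iff Q).2 hQ, hr⟩

lemma AssP.not_regular {Q : Ideal S} (h : AssP Q M) {r : S} (hr : r ∈ Q) : ¬ IsSMulRegular M r := by
  obtain ⟨hQ, x, hx⟩ := h
  intro hreg
  have h1 : r • x = r • (0 : M) := by rw [smul_zero, ← hx]; exact hr
  have h2 : x = 0 := hreg h1
  exact hQ.ne_top ((Ideal.eq_top_iff_one _).2 ((hx 1).2 (by rw [h2, smul_zero])))

/-- Cayley–Hamilton. -/
lemma exists_notMem_smul_eq_zero [Module.Finite S M] (P : Ideal S) [hP : P.IsPrime]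
    (A : Ideal S) (hA : A ≤ P) (s : S) (hs : s ∉ P) (h : ∀ m : M, s • m ∈ A • (⊤ : Submodule S M)) :
    ∃ s' ∉ P, ∀ m : M, s' • m = 0 := by
  obtain ⟨p, hp, -, hc, h0⟩ :=
    LinearMap.exists_monic_and_natDegree_eq_and_coeff_mem_pow_and_aeval_eq_zero S
      (LinearMap.lsmul S M s) A (by rintro _ ⟨m, rfl⟩; exact h m)
  refine ⟨p.eval s, fun hmem => ?_, fun m => ?_⟩
  · rw [Polynomial.eval_eq_sum_range, Finset.sum_range_succ, hp.coeff_natDegree, one_mul] at hmem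
    have h1 : ∑ i ∈ Finset.range p.natDegree, p.coeff i * s ^ i ∈ P := by
      refine Ideal.sum_mem _ fun i hi => Ideal.mul_mem_right _ _ (hA ?_)
      have := hc i
      exact Ideal.pow_le_self (Nat.sub_ne_zero_of_lt (Finset.mem_range.1 hi)) this
    exact hs (hP.mem_of_pow_mem _ ((Submodule.add_mem_iff_right _ h1).1 hmem))
  · have h1 := LinearMap.congr_fun h0 m
    have h2 : Polynomial.aeval (LinearMap.lsmul S M s) p = LinearMap.lsmul S M (p.eval s) := by
      have := Polynomial.aeval_algHom_apply (Algebra.ofId S (Module.End S M)) s p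
      rw [Polynomial.coe_aeval_eq_eval] at this
      exact this
    rw [h2] at h1
    exact h1

/-- A finitely generated module all of whose elements are killed off `P`. -/
lemma exists_notMem_of_forall [Module.Finite S M] (P : Ideal S) [hP : P.IsPrime]
    (N : Submodule S M) (h : ∀ m : M, ∃ s ∉ P, s • m ∈ N) : ∃ s ∉ P, ∀ m : M, s • m ∈ N := by
  classical
  obtain ⟨t, ht⟩ := (Module.finite_def (R := S) (M := M)).1 inferInstance
  choose σ hσ hσ' using h
  refine ⟨∏ m ∈ t, σ m, fun hmem => ?_, fun m => ?_⟩
  · obtain ⟨m, _, hm⟩ := hP.prod_mem_iff.1 hmem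
    exact hσ m hm
  · have hm : m ∈ Submodule.span S (t : Set M) := ht ▸ trivial
    induction hm using Submodule.span_induction with
    | mem x hx =>
      rw [← Finset.prod_erase_mul _ _ hx, mul_smul]
      exact N.smul_mem _ (hσ' x)
    | zero => simp
    | add x y _ _ h h' => rw [smul_add]; exact N.add_mem h h'
    | smul a x _ h => rw [smul_comm]; exact N.smul_mem _ h

/-- Going up along a regular element. -/
theorem assP_step [IsNoetherianRing S] [Module.Finite S M] {Q P : Ideal S} [hP : P.IsPrime]
    (hQ : AssP Q M) (hQP : Q ≤ P) {b : S} (hb : b ∈ P) (hreg : IsSMulRegular M b) :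
    ∃ Q', AssP Q' (QuotSMulTop b M) ∧ Q ≤ Q' ∧ b ∈ Q' ∧ Q' ≤ P := by
  obtain ⟨hQp, x, hx⟩ := hQ
  let N : Submodule S M := Submodule.torsionBySet S M Q
  have hN : ∀ n, n ∈ N ↔ ∀ q ∈ Q, q • n = 0 := fun n => by
    simp [N, Submodule.mem_torsionBySet_iff]
  have hxN : x ∈ N := (hN x).2 fun q hq => (hx q).1 hq
  by_cases hex : ∃ n ∈ N, ∀ s, s • n ∈ b • (⊤ : Submodule S M) → s ∈ P
  · obtain ⟨n, hn, hs⟩ := hex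
    obtain ⟨Q', h1, h2, h3⟩ := exists_assP (M := QuotSMulTop b M) (Submodule.Quotient.mk n) P
      (fun r hr => hs r (by
        rwa [← Submodule.Quotient.mk_smul, Submodule.Quotient.mk_eq_zero] at hr))
    refine ⟨Q', h1, fun q hq => h2 q ?_, h2 b ?_, h3⟩
    · rw [← Submodule.Quotient.mk_smul, (hN n).1 hn q hq, Submodule.Quotient.mk_zero]
    · rw [← Submodule.Quotient.mk_smul, Submodule.Quotient.mk_eq_zero]
      exact Submodule.smul_mem_pointwise_smul _ _ _ trivial
  · exfalso
    push Not at hex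
    have h1 : ∀ n : N, ∃ s ∉ P, s • n ∈ Ideal.span {b} • (⊤ : Submodule S N) := by
      intro n
      obtain ⟨s, hs, hsP⟩ := hex n.1 n.2
      refine ⟨s, hsP, ?_⟩
      obtain ⟨m, -, hm⟩ := (Submodule.mem_smul_pointwise_iff_exists _ _ _).1 hs
      have hmN : m ∈ N := (hN m).2 fun q hq => hreg (by
        change b • q • m = b • (0 : M)
        rw [smul_comm, hm, smul_comm, (hN n.1).1 n.2 q hq, smul_zero, smul_zero])
      have : s • n = b • (⟨m, hmN⟩ : N) := Subtype.ext hm.symm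
      rw [this]
      exact Submodule.smul_mem_smul (Ideal.mem_span_singleton_self b) trivial
    obtain ⟨s, hs, h2⟩ := exists_notMem_of_forall P _ h1
    obtain ⟨s', hs', h3⟩ := exists_notMem_smul_eq_zero P (Ideal.span {b})
      ((Ideal.span_singleton_le_iff_mem P).2 hb) s hs h2
    exact hs' (hQP ((hx s').2 (congrArg Subtype.val (h3 ⟨x, hxN⟩))))

/-- Chains of associated primes along a regular sequence, measured by any function which
increases strictly along primes containing `Q`. -/
theorem assP_chain [IsNoetherianRing S] (rs : List S) (P : Ideal S) [hP : P.IsPrime]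
    (hrs : ∀ r ∈ rs, r ∈ P) {M : Type u} [AddCommGroup M] [Module S M] [Module.Finite S M]
    {Q : Ideal S} (hQ : AssP Q M) (hQP : Q ≤ P) (hreg : IsWeaklyRegular M rs)
    (h : Ideal S → ℕ∞) (hh : ∀ Q₁ Q₂ : Ideal S, Q₁.IsPrime → Q₂.IsPrime → Q ≤ Q₁ → Q₁ < Q₂ →
      h Q₁ + 1 ≤ h Q₂) :
    ∃ Q', AssP Q' (M ⧸ (Ideal.ofList rs • (⊤ : Submodule S M))) ∧ Q ≤ Q' ∧ Ideal.ofList rs ≤ Q' ∧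
      Q' ≤ P ∧ h Q + rs.length ≤ h Q' := by
  induction rs generalizing M Q with
  | nil =>
    refine ⟨Q, hQ.of_injective (Submodule.mkQ _) ?_, le_rfl, by simp, hQP, by simp⟩
    rw [← LinearMap.ker_eq_bot, Submodule.ker_mkQ, Ideal.ofList_nil, Submodule.bot_smul]
  | cons r rs ih =>
    rw [isWeaklyRegular_cons_iff] at hreg
    obtain ⟨Q₁, h1, h2, h3, h4⟩ := assP_step hQ hQP (hrs r (by simp)) hreg.1
    have hlt : Q < Q₁ := lt_of_le_of_ne h2 fun he => hQ.not_regular (he ▸ h3) hreg.1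
    obtain ⟨Q₂, g1, g2, g3, g4, g5⟩ := ih (fun r hr => hrs r (by simp [hr])) h1 h4 hreg.2
      (fun A B hA hB hQA => hh A B hA hB (h2.trans hQA))
    refine ⟨Q₂, ?_, h2.trans g2, ?_, g4, ?_⟩
    · exact g1.of_injective
        (Submodule.quotOfListConsSMulTopEquivQuotSMulTopInner M r rs).symm.toLinearMap
        (LinearEquiv.injective _)
    · rw [Ideal.ofList_cons, sup_le_iff]
      exact ⟨(Ideal.span_singleton_le_iff_mem _).2 (g2 h3), g3⟩
    · refine le_trans ?_ g5
      have := hh Q Q₁ hQ.1 h1.1 le_rfl hlt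
      calc h Q + ((r :: rs).length : ℕ) = (h Q + 1) + (rs.length : ℕ) := by
            rw [List.length_cons, Nat.cast_add, Nat.cast_one, add_assoc, add_comm (1 : ℕ∞)]
        _ ≤ _ := by gcongr

end CMTools

namespace CMTools
open RingTheory.Sequence Pointwise CategoryTheory Abelian ModuleCat

variable {S : Type u} [CommRing S]

section Local
variable [IsLocalRing S] [IsNoetherianRing S]
  {M : Type u} [AddCommGroup M] [Module S M] [Module.Finite S M]

omit [IsNoetherianRing S] in
lemma smul_top_lt [Nontrivial M] : maximalIdeal S • (⊤ : Submodule S M) < ⊤ := by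
  refine lt_top_iff_ne_top.2 fun h => ?_
  have := Submodule.eq_bot_of_le_smul_of_le_jacobson_bot (maximalIdeal S) (⊤ : Submodule S M)
    (Module.finite_def.1 inferInstance) h.ge (IsLocalRing.maximalIdeal_le_jacobson _)
  exact top_ne_bot this

lemma exists_regular_quot [Nontrivial M] (n : ℕ) (rs : List S) (hlen : rs.length = n + 1)
    (hrs : ∀ r ∈ rs, r ∈ maximalIdeal S) (hreg : IsWeaklyRegular M rs) (r : S)
    (hr : r ∈ maximalIdeal S) (hrr : IsSMulRegular M r) :
    ∃ rs' : List S, rs'.length = n ∧ (∀ a ∈ rs', a ∈ maximalIdeal S) ∧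
      IsWeaklyRegular (QuotSMulTop r M) rs' := by
  have hreg' : IsRegular M rs :=
    (IsLocalRing.isRegular_iff_isWeaklyRegular_of_subset_maximalIdeal hrs).2 hreg
  have hsupp : Module.support S (ModuleCat.of S (S ⧸ maximalIdeal S)) =
      PrimeSpectrum.zeroLocus (maximalIdeal S) := by
    change Module.support S (S ⧸ maximalIdeal S) = _
    rw [Module.support_eq_zeroLocus, Ideal.annihilator_quotient]
  have h1 : ∀ i < rs.length,
      Subsingleton (Ext (ModuleCat.of S (S ⧸ maximalIdeal S)) (ModuleCat.of S M) i) :=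
    ModuleCat.subsingleton_ext_of_exists_isRegular (maximalIdeal S) _ hsupp.subset
      (ModuleCat.of S M) smul_top_lt rs hrs hreg'
  have h2 : ∀ i < n, Subsingleton
      (Ext (ModuleCat.of S (S ⧸ maximalIdeal S)) (ModuleCat.of S (QuotSMulTop r M)) i) := by
    intro i hi
    have zero1 := AddCommGrpCat.isZero_of_iff_subsingleton.mpr (h1 i (by omega))
    have zero2 := AddCommGrpCat.isZero_of_iff_subsingleton.mpr (h1 (i + 1) (by omega))
    have hrr' : IsSMulRegular (ModuleCat.of S M) r := hrr
    exact AddCommGrpCat.subsingleton_of_isZero <| ShortComplex.Exact.isZero_of_both_zeros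
        ((Ext.covariant_sequence_exact₃' _ hrr'.smulShortComplex_shortExact) i (i + 1) rfl)
        (zero1.eq_zero_of_src _) (zero2.eq_zero_of_tgt _)
  have : Nontrivial (QuotSMulTop r M) := nontrivial_quotSMulTop_of_mem_maximalIdeal M hr
  obtain ⟨rs', g1, g2, g3⟩ := ModuleCat.exists_isRegular_of_exists_subsingleton_ext
    (maximalIdeal S) n (ModuleCat.of S (QuotSMulTop r M)) smul_top_lt
    (ModuleCat.of S (S ⧸ maximalIdeal S)) hsupp h2
  exact ⟨rs', g1, g2, g3.toIsWeaklyRegular⟩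

/-- Any regular sequence extends to one of maximal length. -/
theorem exists_extend {n : ℕ} (t : ℕ) (as : List S) (hlen : as.length = t)
    {M : Type u} [AddCommGroup M] [Module S M] [Module.Finite S M] [Nontrivial M]
    (rs : List S) (hn : rs.length = n + t)
    (hrs : ∀ r ∈ rs, r ∈ maximalIdeal S) (hreg : IsWeaklyRegular M rs)
    (has : ∀ r ∈ as, r ∈ maximalIdeal S) (hreg' : IsWeaklyRegular M as) :
    ∃ bs : List S, bs.length = n ∧ (∀ a ∈ bs, a ∈ maximalIdeal S) ∧
      IsWeaklyRegular M (as ++ bs) := by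
  induction as generalizing t M rs with
  | nil => subst hlen; exact ⟨rs, hn, hrs, hreg⟩
  | cons a as ih =>
    obtain _ | t := t
    · simp at hlen
    rw [isWeaklyRegular_cons_iff] at hreg'
    obtain ⟨rs', h1, h2, h3⟩ := exists_regular_quot (n + t) rs hn hrs hreg a
      (has a (by simp)) hreg'.1
    have : Nontrivial (QuotSMulTop a M) := nontrivial_quotSMulTop_of_mem_maximalIdeal M
      (has a (by simp))
    obtain ⟨bs, g1, g2, g3⟩ := ih t (by simpa using hlen) rs' h1 h2 h3
      (fun r hr => has r (by simp [hr])) hreg'.2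
    exact ⟨bs, g1, g2, by rw [List.cons_append, isWeaklyRegular_cons_iff]; exact ⟨hreg'.1, g3⟩⟩

end Local

lemma exists_assP_bot_le [Nontrivial S] [IsNoetherianRing S] (P : Ideal S) [P.IsPrime] :
    ∃ Q, AssP Q S ∧ Q ≤ P := by
  obtain ⟨Q, h1, -, h2⟩ := exists_assP (1 : S) P (fun r hr => by
    have : r = 0 := by simpa using hr
    rw [this]; exact P.zero_mem)
  exact ⟨Q, h1, h2⟩

lemma height_add_one_le [IsNoetherianRing S] {Q₁ Q₂ : Ideal S} (h₁ : Q₁.IsPrime) (h₂ : Q₂.IsPrime)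
    (h : Q₁ < Q₂) : Q₁.height + 1 ≤ Q₂.height := by
  exact Ideal.height_add_one_le_of_lt_of_isPrime h

lemma height_minimal_ofList_le [IsNoetherianRing S] (l : List S) {P : Ideal S}
    (hP : P ∈ (Ideal.ofList l).minimalPrimes) : P.height ≤ l.length := by
  classical
  have h1 : Ideal.ofList l = Ideal.span (l.toFinset : Set S) := by
    simp [Ideal.ofList]
  rw [h1] at hP
  exact (Ideal.height_le_card_of_mem_minimalPrimes_span_finset hP).trans
    (by exact_mod_cast l.toFinset_card_le)

/-- `QuotSMulTop r S` is `S ⧸ (r)`. -/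
noncomputable def quotSMulTopSelf (r : S) : QuotSMulTop r S ≃ₗ[S] (S ⧸ Ideal.span {r}) :=
  Submodule.quotEquivOfEq _ _ (by
    rw [← Submodule.ideal_span_singleton_smul, smul_eq_mul, Ideal.mul_top])

lemma isWeaklyRegular_cons_self (r : S) (rs : List S) :
    IsWeaklyRegular S (r :: rs) ↔ IsSMulRegular S r ∧
      IsWeaklyRegular (S ⧸ Ideal.span {r}) (rs.map (Ideal.Quotient.mk (Ideal.span {r}))) := by
  rw [isWeaklyRegular_cons_iff, (quotSMulTopSelf r).isWeaklyRegular_congr]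
  refine and_congr_right fun _ => ?_
  exact (isWeaklyRegular_map_algebraMap_iff (S ⧸ Ideal.span {r}) (S ⧸ Ideal.span {r}) rs).symm

lemma isDomain_of_bot_prime (h : (⊥ : Ideal S).IsPrime) : IsDomain S :=
  (IsDomain.of_bot_isPrime S)

theorem isDomain_of_params (n : ℕ) (S : Type u) [CommRing S] [IsLocalRing S] [IsNoetherianRing S]
    (l : List S) (hl : l.length = n) (hspan : Ideal.ofList l = maximalIdeal S)
    (hn : (n : ℕ∞) ≤ (maximalIdeal S).height) : IsDomain S ∧ IsWeaklyRegular S l := by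
  induction n generalizing S with
  | zero =>
    rw [List.length_eq_zero_iff] at hl
    subst hl
    rw [Ideal.ofList_nil] at hspan
    exact ⟨isDomain_of_bot_prime (hspan ▸ inferInstance), IsWeaklyRegular.nil S S⟩
  | succ n ih =>
    have key : ∀ (x : S) (l : List S), l.length = n → Ideal.ofList (x :: l) = maximalIdeal S →
        (Ideal.span {x}).IsPrime ∧
          IsWeaklyRegular (S ⧸ Ideal.span {x}) (l.map (Ideal.Quotient.mk (Ideal.span {x}))) := by
      intro x l hl hsp
      have hx : x ∈ maximalIdeal S := hsp ▸ Ideal.subset_span (by simp)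
      have hle : Ideal.span {x} ≤ maximalIdeal S := (Ideal.span_singleton_le_iff_mem _).2 hx
      have hnt : Nontrivial (S ⧸ Ideal.span {x}) :=
        Ideal.Quotient.nontrivial_iff.2 (fun h => (maximalIdeal.isMaximal S).ne_top
          (top_le_iff.1 (h ▸ hle)))
      have : IsLocalRing (S ⧸ Ideal.span {x}) :=
        IsLocalRing.of_surjective' (Ideal.Quotient.mk (Ideal.span {x})) Ideal.Quotient.mk_surjective
      have hmap : (maximalIdeal S).map (Ideal.Quotient.mk (Ideal.span {x})) =
          maximalIdeal (S ⧸ Ideal.span {x}) :=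
        IsLocalRing.map_maximalIdeal_of_surjective _ Ideal.Quotient.mk_surjective
      have h1 : (n : ℕ∞) ≤ (maximalIdeal (S ⧸ Ideal.span {x})).height := by
        have := Ideal.height_le_height_add_one_of_mem hx
        rw [hmap] at this
        have h2 := hn.trans this
        rw [Nat.cast_add, Nat.cast_one] at h2
        exact (ENat.add_le_add_iff_right (by simp)).1 h2
      have h2 : Ideal.ofList (l.map (Ideal.Quotient.mk (Ideal.span {x}))) =
          maximalIdeal (S ⧸ Ideal.span {x}) := by
        rw [← hmap, ← hsp, Ideal.ofList_cons, Ideal.map_sup, ← Ideal.map_ofList,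
          Ideal.map_span _ {x}, Set.image_singleton]
        have : Ideal.Quotient.mk (Ideal.span {x}) x = 0 :=
          Ideal.Quotient.eq_zero_iff_mem.2 (Ideal.mem_span_singleton_self x)
        rw [this, Ideal.span_singleton_zero, bot_sup_eq]
      obtain ⟨g1, g2⟩ := ih (S ⧸ Ideal.span {x}) (l.map _) (by simpa using hl) h2 h1
      exact ⟨(Ideal.Quotient.isDomain_iff_prime _).1 g1, g2⟩
    have small : ∀ l : List S, l.length ≤ n → Ideal.ofList l ≠ maximalIdeal S := by
      intro l hl he
      have := height_minimal_ofList_le l (P := maximalIdeal S) (by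
        rw [he, Ideal.minimalPrimes_eq_subsingleton_self]; rfl)
      have h2 := hn.trans (this.trans (Nat.cast_le.2 hl))
      have := Nat.cast_le.1 h2
      omega
    have dom : ∀ (x : S) (l : List S), l.length = n → Ideal.ofList (x :: l) = maximalIdeal S →
        Ideal.span {x} ∉ minimalPrimes S → IsDomain S := by
      intro x l hl hsp hmin
      have hp := (key x l hl hsp).1
      obtain ⟨Q, hQ, hQx⟩ := Ideal.exists_minimalPrimes_le (bot_le : ⊥ ≤ Ideal.span {x})
      have hQp := hQ.1.1
      have hxQ : x ∉ Q := fun h => hmin (by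
        have : Q = Ideal.span {x} := le_antisymm hQx ((Ideal.span_singleton_le_iff_mem _).2 h)
        exact this ▸ hQ)
      have hx : x ∈ maximalIdeal S := hsp ▸ Ideal.subset_span (by simp)
      have : Q = ⊥ := by
        refine Submodule.eq_bot_of_le_smul_of_le_jacobson_bot (maximalIdeal S) Q
          (IsNoetherian.noetherian Q) (fun q hq => ?_) (IsLocalRing.maximalIdeal_le_jacobson _)
        obtain ⟨c, rfl⟩ := Ideal.mem_span_singleton'.1 (hQx hq)
        rw [mul_comm]
        exact Submodule.smul_mem_smul hx ((hQp.mem_or_mem hq).resolve_right hxQ)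
      exact isDomain_of_bot_prime (this ▸ hQp)
    have hdom : IsDomain S := by
      match l, hl with
      | [x], hl =>
        refine dom x [] (by simp at hl ⊢; omega) hspan fun hmin => ?_
        rw [Ideal.ofList_singleton] at hspan
        have := Ideal.height_eq_zero_iff.2 (hspan ▸ hmin)
        rw [this] at hn
        simp at hn
      | x :: y :: l, hl =>
        have hl' : l.length + 1 = n := by simpa using hl
        by_contra hnd
        have hgen : ∀ k : ℕ, Ideal.ofList ((x + y ^ (k + 1)) :: y :: l) = maximalIdeal S := by
          intro k
          rw [← hspan]
          simp only [Ideal.ofList_cons]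
          rw [← sup_assoc, ← sup_assoc]
          congr 1
          apply le_antisymm
          · rw [sup_le_iff, Ideal.span_singleton_le_iff_mem]
            refine ⟨Ideal.add_mem _ (Ideal.mem_sup_left (Ideal.mem_span_singleton_self x))
              (Ideal.pow_mem_of_mem _ (Ideal.mem_sup_right (Ideal.mem_span_singleton_self y)) _
                k.succ_pos), le_sup_right⟩
          · rw [sup_le_iff, Ideal.span_singleton_le_iff_mem]
            refine ⟨?_, le_sup_right⟩
            have : x = (x + y ^ (k + 1)) - y ^ (k + 1) := by ring
            have h2 : (x + y ^ (k + 1)) - y ^ (k + 1) ∈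
                Ideal.span {x + y ^ (k + 1)} ⊔ Ideal.span {y} :=
             Ideal.sub_mem _ (Ideal.mem_sup_left (Ideal.mem_span_singleton_self _))
              (Ideal.pow_mem_of_mem _ (Ideal.mem_sup_right (Ideal.mem_span_singleton_self y)) _
                k.succ_pos)
            rwa [← this] at h2
        have hmin : ∀ k : ℕ, Ideal.span {x + y ^ (k + 1)} ∈ minimalPrimes S := fun k => by
          by_contra h
          exact hnd (dom _ (y :: l) (by simpa using hl') (hgen k) h)
        have : Finite (minimalPrimes S) := minimalPrimes.finite_of_isNoetherianRing S
        obtain ⟨i, j, hij, he⟩ := Finite.exists_ne_map_eq_of_infinite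
          (fun k : ℕ => (⟨_, hmin k⟩ : minimalPrimes S))
        wlog hlt : i < j generalizing i j
        · exact this j i hij.symm he.symm (by omega)
        have he' : Ideal.span {x + y ^ (i + 1)} = Ideal.span {x + y ^ (j + 1)} :=
          congrArg Subtype.val he
        set p := Ideal.span {x + y ^ (i + 1)} with hp
        have hpp : p.IsPrime := (hmin i).1.1
        have h1 : y ^ (i + 1) * (1 - y ^ (j - i)) ∈ p := by
          have : y ^ (i + 1) * (1 - y ^ (j - i)) = (x + y ^ (i + 1)) - (x + y ^ (j + 1)) := by
            rw [mul_sub, ← pow_add, show i + 1 + (j - i) = j + 1 by omega]; ring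
          rw [this]
          refine Ideal.sub_mem _ (Ideal.mem_span_singleton_self _) ?_
          rw [he']; exact Ideal.mem_span_singleton_self _
        have hy : y ∈ maximalIdeal S := hspan ▸ Ideal.subset_span (by simp)
        have hu : IsUnit (1 - y ^ (j - i)) := by
          by_contra hu
          have h2 : 1 - y ^ (j - i) ∈ maximalIdeal S := hu
          have h3 : y ^ (j - i) ∈ maximalIdeal S := Ideal.pow_mem_of_mem _ hy _ (by omega)
          have := Ideal.add_mem _ h2 h3
          rw [sub_add_cancel] at this
          exact (Ideal.ne_top_iff_one _).1 (maximalIdeal.isMaximal S).ne_top this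
        have hyp : y ∈ p := hpp.mem_of_pow_mem _ ((Ideal.mul_unit_mem_iff_mem _ hu).1 h1)
        refine small ((x + y ^ (i + 1)) :: l) (by simp; omega) ?_
        rw [← hgen i, Ideal.ofList_cons, Ideal.ofList_cons, Ideal.ofList_cons, ← sup_assoc]
        congr 1
        exact (sup_eq_left.2 ((Ideal.span_singleton_le_iff_mem _).2 hyp)).symm
    refine ⟨hdom, ?_⟩
    match l, hl with
    | x :: l, hl =>
      have hl' : l.length = n := by simpa using hl
      rw [isWeaklyRegular_cons_self]
      refine ⟨?_, (key x l hl' hspan).2⟩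
      have hx : x ≠ 0 := by
        rintro rfl
        refine small l hl'.le ?_
        rw [← hspan, Ideal.ofList_cons, Ideal.span_singleton_zero, bot_sup_eq]
      exact fun a b h => mul_left_cancel₀ hx h

end CMTools

namespace CMTools
open RingTheory.Sequence Pointwise

variable {S : Type u} [CommRing S]

/-- A Noetherian local ring with a regular sequence of length `n ≥ dim S` in its maximal ideal. -/
def IsCM (S : Type u) [CommRing S] [IsLocalRing S] (n : ℕ) : Prop :=
  (maximalIdeal S).height ≤ n ∧ ∃ rs : List S, rs.length = n ∧ (∀ r ∈ rs, r ∈ maximalIdeal S) ∧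
    IsWeaklyRegular S rs

noncomputable def quotSelfEquiv (l : List S) :
    (S ⧸ (Ideal.ofList l • (⊤ : Submodule S S))) ≃ₗ[S] (S ⧸ Ideal.ofList l) :=
  Submodule.quotEquivOfEq _ _ (by rw [smul_eq_mul, Ideal.mul_top])

lemma isWeaklyRegular_append_self (as bs : List S) :
    IsWeaklyRegular S (as ++ bs) ↔ IsWeaklyRegular S as ∧ IsWeaklyRegular (S ⧸ Ideal.ofList as) bs := by
  rw [isWeaklyRegular_append_iff, (quotSelfEquiv as).isWeaklyRegular_congr]

lemma AssP.ofList_le {l : List S} {P : Ideal S} (h : AssP P (S ⧸ Ideal.ofList l)) :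
    Ideal.ofList l ≤ P := by
  obtain ⟨-, x, hx⟩ := h
  intro r hr
  rw [hx]
  obtain ⟨y, rfl⟩ := Ideal.Quotient.mk_surjective x
  rw [← Ideal.Quotient.mk_eq_mk, ← Submodule.Quotient.mk_smul, Submodule.Quotient.mk_eq_zero]
  exact Ideal.mul_mem_right _ _ hr

section Noeth
variable [IsNoetherianRing S]

lemma length_le_height [Nontrivial S] (as : List S) (P : Ideal S) [hP : P.IsPrime]
    (has : ∀ r ∈ as, r ∈ P) (hreg : IsWeaklyRegular S as) : (as.length : ℕ∞) ≤ P.height := by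
  obtain ⟨Q₀, h1, h2⟩ := exists_assP_bot_le P
  obtain ⟨Q', h3, -, -, h4, h5⟩ := assP_chain as P has h1 h2 hreg Ideal.height
    (fun Q₁ Q₂ a b _ c => height_add_one_le a b c)
  exact le_trans (le_trans (by simp) h5) (Ideal.height_mono h4)

variable [IsLocalRing S]

theorem height_eq_of_assP {n : ℕ} (hcm : IsCM S n) (as : List S)
    (hreg : IsWeaklyRegular S as) {P : Ideal S} (hP : AssP P (S ⧸ Ideal.ofList as)) :
    P.height = as.length := by
  have hPp := hP.1
  have hle : ∀ r ∈ as, r ∈ P := fun r hr => hP.ofList_le (Ideal.subset_span hr)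
  have hPm : P ≤ maximalIdeal S := IsLocalRing.le_maximalIdeal hPp.ne_top
  have h1 := length_le_height as P hle hreg
  obtain ⟨hht, rs, hlen, hrs, hrr⟩ := hcm
  have htn : as.length ≤ n := by
    exact_mod_cast h1.trans ((Ideal.height_mono hPm).trans hht)
  refine le_antisymm ?_ h1
  obtain ⟨bs, g1, g2, g3⟩ := exists_extend (n := n - as.length) as.length as rfl rs
    (by omega) hrs hrr (fun r hr => hPm (hle r hr)) hreg
  rw [isWeaklyRegular_append_self] at g3
  obtain ⟨Q', -, -, -, k1, k2⟩ := assP_chain bs (maximalIdeal S) g2 hP hPm g3.2 Ideal.height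
    (fun Q₁ Q₂ a b _ c => height_add_one_le a b c)
  have h2 : P.height + (n - as.length : ℕ) ≤ as.length + (n - as.length : ℕ) := by
    rw [← g1]
    refine k2.trans (((Ideal.height_mono k1).trans hht).trans ?_)
    rw [g1]; norm_cast; omega
  exact (ENat.add_le_add_iff_right (by simp)).1 h2

/-- Regular sequences in `P` extend inside `P` to length `height P`. -/
theorem exists_extend_in {n : ℕ} (hcm : IsCM S n) (P : Ideal S) [hP : P.IsPrime] (m : ℕ)
    (as : List S) (hm : P.height ≤ as.length + m)
    (has : ∀ r ∈ as, r ∈ P) (hreg : IsWeaklyRegular S as) :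
    ∃ bs : List S, (∀ r ∈ bs, r ∈ P) ∧ IsWeaklyRegular S (as ++ bs) ∧
      P.height = (as ++ bs).length ∧ AssP P (S ⧸ Ideal.ofList (as ++ bs)) := by
  induction m generalizing as with
  | zero =>
    refine ⟨[], by simp, by simpa using hreg, ?_, ?_⟩
    · rw [List.append_nil]
      exact le_antisymm (by simpa using hm) (length_le_height as P has hreg)
    · rw [List.append_nil]
      by_cases hex : ∃ r ∈ P, IsSMulRegular (S ⧸ Ideal.ofList as) r
      · exfalso
        obtain ⟨r, hr, hrr⟩ := hex
        have h1 := length_le_height (as ++ [r]) P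
          (by simp only [List.mem_append, List.mem_singleton]; rintro a (h | rfl); exacts [has a h, hr])
          ((isWeaklyRegular_append_self _ _).2 ⟨hreg, (isWeaklyRegular_singleton_iff _ _).2 hrr⟩)
        have := h1.trans hm
        rw [List.length_append] at this
        have := Nat.cast_le.1 (by simpa using this : ((as.length + 1 : ℕ) : ℕ∞) ≤ (as.length : ℕ))
        omega
      · push Not at hex
        have hfin := associatedPrimes.finite S (S ⧸ Ideal.ofList as)
        have hsub : (P : Set S) ⊆ ⋃ Q ∈ associatedPrimes S (S ⧸ Ideal.ofList as), (Q : Set S) := by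
          intro r hr
          obtain ⟨Q, h1, h2⟩ := exists_assP_of_not_regular (hex r hr)
          exact Set.mem_biUnion ((assP_iff Q).1 h1) h2
        obtain ⟨Q, h1, h2⟩ := (Ideal.subset_union_prime_finite hfin (f := id) ⊥ ⊥
          (fun Q hQ _ _ => hQ.isPrime)).1 hsub
        have h3 := (assP_iff Q).2 h1
        have h4 := height_eq_of_assP hcm as hreg h3
        have h5 : P = Q := by
          by_contra hne
          have hQp := h3.1
          have := height_add_one_le hP hQp (lt_of_le_of_ne h2 hne)
          rw [h4] at this
          have h6 := length_le_height as P has hreg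
          have h7 := (add_le_add_left h6 1).trans this
          have := Nat.cast_le.1 (by simpa using h7 : ((as.length + 1 : ℕ) : ℕ∞) ≤ (as.length : ℕ))
          omega
        exact h5 ▸ h3
  | succ m ih =>
    by_cases hex : ∃ r ∈ P, IsSMulRegular (S ⧸ Ideal.ofList as) r
    · obtain ⟨r, hr, hrr⟩ := hex
      obtain ⟨bs, h1, h2, h3, h4⟩ := ih (as ++ [r])
        (by rw [List.length_append]; refine hm.trans (le_of_eq ?_); rw [List.length_singleton]; push_cast; ring)
        (by simp only [List.mem_append, List.mem_singleton]; rintro a (h | rfl); exacts [has a h, hr])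
        ((isWeaklyRegular_append_self _ _).2 ⟨hreg, (isWeaklyRegular_singleton_iff _ _).2 hrr⟩)
      refine ⟨r :: bs, ?_, ?_⟩
      · simp only [List.mem_cons]; rintro a (rfl | h); exacts [hr, h1 a h]
      · have : as ++ r :: bs = as ++ [r] ++ bs := by simp
        rw [this]; exact ⟨h2, h3, h4⟩
    · push Not at hex
      have hfin := associatedPrimes.finite S (S ⧸ Ideal.ofList as)
      have hsub : (P : Set S) ⊆ ⋃ Q ∈ associatedPrimes S (S ⧸ Ideal.ofList as), (Q : Set S) := by
        intro r hr
        obtain ⟨Q, h1, h2⟩ := exists_assP_of_not_regular (hex r hr)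
        exact Set.mem_biUnion ((assP_iff Q).1 h1) h2
      obtain ⟨Q, h1, h2⟩ := (Ideal.subset_union_prime_finite hfin (f := id) ⊥ ⊥
        (fun Q hQ _ _ => hQ.isPrime)).1 hsub
      have h3 := (assP_iff Q).2 h1
      have h4 := height_eq_of_assP hcm as hreg h3
      exact ih as (((Ideal.height_mono h2).trans h4.le).trans (by simp)) has hreg

/-- Catenarity. -/
theorem exists_between {n : ℕ} (hcm : IsCM S n) {P₁ P : Ideal S} (h₁ : P₁.IsPrime)
    (hP : P.IsPrime) (hle : P₁ ≤ P) {d : ℕ} (hd : P₁.height ≤ d) (hd' : (d + 2 : ℕ) ≤ P.height) :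
    ∃ Q : Ideal S, Q.IsPrime ∧ P₁ < Q ∧ Q < P := by
  obtain ⟨bs, b1, b2, b3, b4⟩ := exists_extend_in hcm P₁ d [] (by simpa using hd) (by simp)
    (IsWeaklyRegular.nil S S)
  rw [List.nil_append] at b2 b3 b4
  have hPm : P ≤ maximalIdeal S := IsLocalRing.le_maximalIdeal hP.ne_top
  have hn : P.height ≤ bs.length + n := (Ideal.height_mono hPm).trans (hcm.1.trans (by simp))
  obtain ⟨cs, c1, c2, c3, c4⟩ := exists_extend_in hcm P n bs hn
    (fun r hr => hle (b1 r hr)) b2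
  rw [isWeaklyRegular_append_self] at c2
  match cs, c1, c2, c3 with
  | [], _, _, c3 =>
    rw [List.append_nil, ← b3] at c3
    rw [c3] at hd'
    have := Nat.cast_le.1 (hd'.trans hd)
    omega
  | [c], _, _, c3 =>
    rw [c3] at hd'
    rw [b3] at hd
    have h1 := Nat.cast_le.1 hd
    have h2 := Nat.cast_le.1 hd'
    rw [List.length_append, List.length_singleton] at h2
    omega
  | c :: c' :: cs, c1, c2, _ =>
    obtain ⟨-, c2⟩ := c2
    rw [isWeaklyRegular_cons_iff, isWeaklyRegular_cons_iff] at c2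
    obtain ⟨Q, q1, q2, q3, q4⟩ := assP_step b4 hle (c1 c (by simp)) c2.1
    refine ⟨Q, q1.1, lt_of_le_of_ne q2 ?_, lt_of_le_of_ne q4 ?_⟩
    · rintro rfl
      exact b4.not_regular q3 c2.1
    · rintro rfl
      exact q1.not_regular (c1 c' (by simp)) c2.2.1

/-- Systems of parameters on a maximal Cohen–Macaulay module are regular sequences. -/
theorem sop_regular (m : ℕ) (f : List S) (hf : f.length = m) (hfm : ∀ r ∈ f, r ∈ maximalIdeal S)
    {M : Type u} [AddCommGroup M] [Module S M] [Module.Finite S M] [Nontrivial M]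
    (rs : List S) (hrs : rs.length = m) (hrm : ∀ r ∈ rs, r ∈ maximalIdeal S)
    (hreg : IsWeaklyRegular M rs) (c : ℕ)
    (hc : maximalIdeal S ^ c ≤ Ideal.ofList f ⊔ Module.annihilator S M) :
    IsWeaklyRegular M f := by
  induction m generalizing f M rs with
  | zero =>
    rw [List.length_eq_zero_iff] at hf
    subst hf
    exact IsWeaklyRegular.nil S M
  | succ m ih =>
    match f, hf with
    | x :: f, hf =>
      have hx : IsSMulRegular M x := by
        by_contra hx
        obtain ⟨Q, hQ, hxQ⟩ := exists_assP_of_not_regular hx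
        have hQp := hQ.1
        have hQm : Q ≤ maximalIdeal S := IsLocalRing.le_maximalIdeal hQp.ne_top
        have hsurj := Ideal.Quotient.mk_surjective (I := Q)
        have hker : RingHom.ker (Ideal.Quotient.mk Q) = Q := Ideal.mk_ker
        obtain ⟨Q', -, q1, -, q2, q3⟩ := assP_chain rs (maximalIdeal S) hrm hQ hQm hreg
          (fun P => (P.map (Ideal.Quotient.mk Q)).height) (by
            intro Q₁ Q₂ h₁ h₂ h₃ h₄
            refine height_add_one_le (Ideal.map_isPrime_of_surjective hsurj (hker.le.trans h₃))
              (Ideal.map_isPrime_of_surjective hsurj (hker.le.trans (h₃.trans h₄.le)))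
              (lt_of_le_of_ne (Ideal.map_mono h₄.le) fun he => ?_)
            have := congrArg (Ideal.comap (Ideal.Quotient.mk Q)) he
            rw [Ideal.comap_map_of_surjective' _ hsurj, Ideal.comap_map_of_surjective' _ hsurj,
              hker, sup_eq_left.2 h₃, sup_eq_left.2 (h₃.trans h₄.le)] at this
            exact h₄.ne this)
        have h1 : ((m + 1 : ℕ) : ℕ∞) ≤ ((maximalIdeal S).map (Ideal.Quotient.mk Q)).height := by
          rw [← hrs]
          exact le_trans le_add_self (q3.trans (Ideal.height_mono (Ideal.map_mono q2)))
        have hpr : ((maximalIdeal S).map (Ideal.Quotient.mk Q)).IsPrime :=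
          Ideal.map_isPrime_of_surjective hsurj (hker.le.trans hQm)
        have h2 := height_minimal_ofList_le (f.map (Ideal.Quotient.mk Q))
          (P := (maximalIdeal S).map (Ideal.Quotient.mk Q)) (by
            refine ⟨⟨hpr, ?_⟩, fun P' ⟨hP', hfP'⟩ _ => ?_⟩
            · rw [← Ideal.map_ofList]
              refine Ideal.map_mono ?_
              rw [Ideal.ofList, Ideal.span_le]
              exact fun r hr => hfm r (by simp [show r ∈ f from hr])
            · rw [Ideal.map_le_iff_le_comap]
              have hP'' : (P'.comap (Ideal.Quotient.mk Q)).IsPrime := Ideal.comap_isPrime _ _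
              refine hP''.le_of_pow_le (n := c) (hc.trans ?_)
              have hQle : Q ≤ P'.comap (Ideal.Quotient.mk Q) := fun q hq => by
                rw [Ideal.mem_comap, Ideal.Quotient.eq_zero_iff_mem.2 hq]; exact P'.zero_mem
              refine sup_le ?_ (le_trans (fun r hr => ?_) hQle)
              · rw [Ideal.ofList_cons]
                refine sup_le ((Ideal.span_singleton_le_iff_mem _).2 (hQle hxQ)) ?_
                rw [← Ideal.map_le_iff_le_comap, Ideal.map_ofList]
                exact hfP'
              · obtain ⟨-, y, hy⟩ := hQ
                rw [hy]
                exact Module.mem_annihilator.1 hr y)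
        rw [List.length_map] at h2
        have h3 := Nat.cast_le.1 (h1.trans h2)
        rw [List.length_cons] at hf
        omega
      rw [isWeaklyRegular_cons_iff]
      refine ⟨hx, ?_⟩
      have hxm := hfm x (by simp)
      obtain ⟨rs', r1, r2, r3⟩ := exists_regular_quot m rs hrs hrm hreg x hxm hx
      have : Nontrivial (QuotSMulTop x M) := nontrivial_quotSMulTop_of_mem_maximalIdeal M hxm
      refine ih f (by simpa using hf) (fun r hr => hfm r (by simp [hr])) rs' r1 r2 r3 (hc.trans ?_)
      rw [Ideal.ofList_cons]
      refine sup_le (sup_le ?_ le_sup_left) (le_trans (fun r hr => ?_) le_sup_right)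
      · rw [Ideal.span_singleton_le_iff_mem]
        refine Ideal.mem_sup_right (Module.mem_annihilator.2 fun y => ?_)
        obtain ⟨y, rfl⟩ := Submodule.Quotient.mk_surjective _ y
        rw [← Submodule.Quotient.mk_smul, Submodule.Quotient.mk_eq_zero]
        exact Submodule.smul_mem_pointwise_smul _ _ _ trivial
      · refine Module.mem_annihilator.2 fun y => ?_
        obtain ⟨y, rfl⟩ := Submodule.Quotient.mk_surjective _ y
        rw [← Submodule.Quotient.mk_smul, Module.mem_annihilator.1 hr, Submodule.Quotient.mk_zero]

end Noeth

end CMTools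

namespace ExtTools
open CategoryTheory Abelian CMTools RingTheory.Sequence

variable {S : Type u} [CommRing S] {Y : Type u} [AddCommGroup Y] [Module S Y]

/-- All `Ext` into `Y` above degree `t` vanishes at `P`, uniformly. -/
def VanAt (P : Ideal S) (t : ℕ) (Y : Type u) [AddCommGroup Y] [Module S Y]
    (N : Type u) [AddCommGroup N] [Module S N] : Prop :=
  ∀ i, t < i → ∃ s ∉ P, ∀ e : EX S N Y i, s • e = 0

lemma VanAt.of_equiv {P : Ideal S} {t : ℕ} {N N' : Type u} [AddCommGroup N] [Module S N]
    [AddCommGroup N'] [Module S N'] (f : N ≃ₗ[S] N') (h : VanAt P t Y N) : VanAt P t Y N' := by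
  intro i hi
  obtain ⟨s, hs, h⟩ := h i hi
  refine ⟨s, hs, fun e => ?_⟩
  have : e = pre Y i f.symm.toLinearMap (pre Y i f.toLinearMap e) := by
    rw [← pre_comp]
    simp [pre_id]
  rw [this, ← map_smul, h, map_zero]

/-- Dévissage. -/
theorem vanAt_of_base [IsNoetherianRing S] (P : Ideal S) [hP : P.IsPrime] (t : ℕ)
    (hNak : ∀ (N : Type u) [AddCommGroup N] [Module S N] [Module.Finite S N] (i : ℕ) (y : S), t < i →
      y ∈ P → ∀ s ∉ P, (∀ e : EX S N Y i, y • e = 0 → s • e = 0) →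
      (∀ e : EX S N Y i, ∃ e', s • e = y • e') → ∃ s' ∉ P, ∀ e : EX S N Y i, s' • e = 0)
    (hbase : VanAt P t Y (S ⧸ P)) (N : Type u) [AddCommGroup N] [Module S N]
    [hN : Module.Finite S N] : VanAt P t Y N := by
  suffices H : ∀ Q : Ideal S, ∀ (N : Type u) [AddCommGroup N] [Module S N] [Module.Finite S N],
      Q ≤ Module.annihilator S N → VanAt P t Y N from H ⊥ N bot_le
  intro Q
  induction Q using IsNoetherian.induction with
  | _ Q ih =>
  intro N _ _ hN
  refine IsNoetherianRing.induction_on_isQuotientEquivQuotientPrime (M := N) S hN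
    (motive := fun N _ _ _ => Q ≤ Module.annihilator S N → VanAt P t Y N) ?_ ?_ ?_
  · intro N _ _ _ _ _ i _
    exact ⟨1, fun h => hP.ne_top ((Ideal.eq_top_iff_one _).2 h),
      fun e => smul_eq_zero_of_left i 1 (fun n => Subsingleton.elim _ _) e⟩
  · rintro N _ _ _ ⟨Q', hQ'⟩ f hQ
    have hann : Module.annihilator S N = Q' := by
      rw [f.annihilator_eq, Ideal.annihilator_quotient]
    rw [hann] at hQ
    refine VanAt.of_equiv f.symm ?_
    change VanAt P t Y (S ⧸ Q')
    obtain hlt | rfl := lt_or_eq_of_le hQ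
    · exact ih Q' hlt (S ⧸ Q') (by rw [Ideal.annihilator_quotient])
    by_cases hQP : Q ≤ P
    swap
    · obtain ⟨s, hs, hsP⟩ := SetLike.not_le_iff_exists.1 hQP
      refine fun i _ => ⟨s, hsP, fun e => smul_eq_zero_of_left i s (fun n => ?_) e⟩
      have h1 : s ∈ Module.annihilator S (S ⧸ Q) := by
        rw [Ideal.annihilator_quotient]; exact hs
      exact Module.mem_annihilator.1 h1 n
    obtain hlt | rfl := lt_or_eq_of_le hQP
    swap
    · exact hbase
    obtain ⟨y, hyP, hyQ⟩ := SetLike.exists_of_lt hlt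
    have hC : VanAt P t Y (S ⧸ (Q ⊔ Ideal.span {y})) := by
      refine ih (Q ⊔ Ideal.span {y}) (lt_of_le_of_ne le_sup_left fun he => hyQ ?_) _
        (by rw [Ideal.annihilator_quotient])
      rw [he]; exact Ideal.mem_sup_right (Ideal.mem_span_singleton_self y)
    set g : (S ⧸ Q) →ₗ[S] (S ⧸ (Q ⊔ Ideal.span {y})) := Submodule.factor le_sup_left
    have hg : Function.Surjective g := Submodule.factor_surjective le_sup_left
    set f : (S ⧸ Q) →ₗ[S] (S ⧸ Q) := y • LinearMap.id
    have hf : Function.Injective f := by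
      rw [← LinearMap.ker_eq_bot, LinearMap.ker_eq_bot']
      intro m hm
      obtain ⟨m, rfl⟩ := Ideal.Quotient.mk_surjective m
      have h1 : Ideal.Quotient.mk Q (y * m) = 0 := hm
      rw [Ideal.Quotient.eq_zero_iff_mem] at h1 ⊢
      exact (hQ'.mem_or_mem h1).resolve_left hyQ
    have hfg : Function.Exact f g := by
      intro m
      obtain ⟨m, rfl⟩ := Ideal.Quotient.mk_surjective m
      have h1 : g (Ideal.Quotient.mk Q m) = Ideal.Quotient.mk _ m := rfl
      rw [h1, Ideal.Quotient.eq_zero_iff_mem, Submodule.mem_sup]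
      constructor
      · rintro ⟨q, hq, z, hz, rfl⟩
        obtain ⟨c, rfl⟩ := Ideal.mem_span_singleton'.1 hz
        refine ⟨Ideal.Quotient.mk Q c, ?_⟩
        change Ideal.Quotient.mk Q (y * c) = _
        rw [map_add, Ideal.Quotient.eq_zero_iff_mem.2 hq, zero_add, mul_comm]
      · rintro ⟨c, hc⟩
        obtain ⟨c, rfl⟩ := Ideal.Quotient.mk_surjective c
        have h2 : Ideal.Quotient.mk Q (y * c) = Ideal.Quotient.mk Q m := hc
        rw [Ideal.Quotient.eq] at h2
        exact ⟨m - y * c, by simpa using Q.neg_mem h2, y * c,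
          Ideal.mem_span_singleton'.2 ⟨c, mul_comm _ _⟩, by ring⟩
    intro i hi
    obtain ⟨hex1, δ, hex2, hex3⟩ := contra_les hf hfg hg Y i
    obtain ⟨s₁, hs₁, h1⟩ := hC i hi
    obtain ⟨s₂, hs₂, h2⟩ := hC (i + 1) (by omega)
    have hfy : ∀ e : EX S (S ⧸ Q) Y i, pre Y i f e = y • e := fun e => by
      rw [pre_smul, pre_id]
    refine hNak (S ⧸ Q) i y hi hyP (s₁ * s₂)
      (fun h => (hP.mem_or_mem h).elim hs₁ hs₂) (fun e he => ?_) (fun e => ?_)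
    · obtain ⟨e', rfl⟩ := (hex1 e).1 ((hfy e).trans he)
      rw [mul_comm, mul_smul, ← map_smul, h1, map_zero, smul_zero]
    · have h3 : δ (s₂ • e) = 0 := by rw [map_smul, h2]
      obtain ⟨e', he'⟩ := (hex2 _).1 h3
      exact ⟨s₁ • e', by rw [mul_smul, ← he', hfy, smul_comm]⟩
  · intro N₁ _ _ _ N₂ _ _ _ N₃ _ _ _ f g hf hg hfg h1 h3 hQ i hi
    obtain ⟨s₁, hs₁, h1⟩ := h1 (hQ.trans (f.annihilator_le_of_injective hf)) i hi
    obtain ⟨s₃, hs₃, h3⟩ := h3 (hQ.trans (g.annihilator_le_of_surjective hg)) i hi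
    refine ⟨s₃ * s₁, fun h => (hP.mem_or_mem h).elim hs₃ hs₁, fun e => ?_⟩
    obtain ⟨e', he'⟩ := ((contra_les hf hfg hg Y i).1 (s₁ • e)).1 (by rw [map_smul, h1])
    rw [mul_smul, ← he', ← map_smul, h3, map_zero]

theorem vanAt_of_base_finite [IsNoetherianRing S] (P : Ideal S) [hP : P.IsPrime] (t : ℕ)
    [Module.Finite S Y] (hbase : VanAt P t Y (S ⧸ P)) (N : Type u) [AddCommGroup N] [Module S N]
    [hN : Module.Finite S N] : VanAt P t Y N := by
  refine vanAt_of_base P t ?_ hbase N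
  intro N _ _ _ i y _ hy s hs _ h
  have : Module.Finite S (EX S N Y i) := ModuleCat.finite_ext S _ _ i
  refine exists_notMem_smul_eq_zero P (Ideal.span {y})
    ((Ideal.span_singleton_le_iff_mem _).2 hy) s hs fun e => ?_
  obtain ⟨e', he'⟩ := h e
  rw [he']
  exact Submodule.smul_mem_smul (Ideal.mem_span_singleton_self y) trivial

lemma ext_ofList_eq_zero (l : List S) (hl : IsWeaklyRegular S l) (i : ℕ) (hi : l.length < i)
    (e : EX S (S ⧸ Ideal.ofList l) Y i) : e = 0 := by
  obtain ⟨d, x, rfl⟩ : ∃ (d : ℕ) (x : Fin d → S), l = List.ofFn x := ⟨_, l.get, (List.ofFn_get l).symm⟩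
  rw [List.length_ofFn] at hi
  have hI := Koszul.ofList_ofFn x
  revert e
  rw [hI]
  intro e
  obtain ⟨y, hy, rfl⟩ := cls_surj (Koszul.res x hl) i e
  have hemp : IsEmpty (KIdx d i) := ⟨fun T => by
    have := T.1.card_le_univ
    rw [T.2, Fintype.card_fin] at this
    omega⟩
  have : y = 0 := by
    have h1 : Subsingleton (KMod S d i) := inferInstance
    refine LinearMap.ext fun v => ?_
    have h2 : v = 0 := Subsingleton.elim (α := KMod S d i) v 0
    rw [h2, map_zero, map_zero]
  subst this
  exact cls_zero _ _ _

theorem vanAt_of_height [IsLocalRing S] [IsNoetherianRing S] {n : ℕ} (hcm : IsCM S n) (x : List S)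
    (hx : x.length = n) (hxm : Ideal.ofList x = maximalIdeal S) (hxr : IsWeaklyRegular S x)
    (P : Ideal S) [hP : P.IsPrime] (t : ℕ) (ht : P.height = t)
    (N : Type u) [AddCommGroup N] [Module S N] [Module.Finite S N] : VanAt P t S N := by
  have hone : ∀ P : Ideal S, P.IsPrime → (1 : S) ∉ P := fun P h h' =>
    h.ne_top ((Ideal.eq_top_iff_one _).2 h')
  have hm : ∀ (N : Type u) [AddCommGroup N] [Module S N] [Module.Finite S N],
      VanAt (maximalIdeal S) n S N := by
    intro N _ _ _
    refine vanAt_of_base_finite _ _ (fun i hi => ⟨1, hone _ inferInstance, ?_⟩) N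
    rw [← hxm]
    intro e
    rw [ext_ofList_eq_zero x hxr i (by omega) e, smul_zero]
  have hPm : P ≤ maximalIdeal S := IsLocalRing.le_maximalIdeal hP.ne_top
  have htn : t ≤ n := by
    have := (Ideal.height_mono hPm).trans hcm.1
    rw [ht] at this
    exact_mod_cast this
  obtain ⟨as, -, a2, a3, a4⟩ := exists_extend_in hcm P t [] (by simp [ht]) (by simp)
    (IsWeaklyRegular.nil S S)
  rw [List.nil_append] at a2 a3 a4
  have hlen : as.length = t := by rw [ht] at a3; exact_mod_cast a3.symm
  obtain ⟨-, x₀, hx₀⟩ := a4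
  let f : (S ⧸ P) →ₗ[S] (S ⧸ Ideal.ofList as) :=
    Submodule.liftQ P (LinearMap.toSpanSingleton S _ x₀) (fun r hr => (hx₀ r).1 hr)
  have hf : Function.Injective f := by
    rw [← LinearMap.ker_eq_bot, LinearMap.ker_eq_bot']
    intro m hm
    obtain ⟨m, rfl⟩ := Ideal.Quotient.mk_surjective m
    exact Ideal.Quotient.eq_zero_iff_mem.2 ((hx₀ m).2 hm)
  have hfg : Function.Exact f (LinearMap.range f).mkQ := LinearMap.exact_map_mkQ_range f
  suffices H : ∀ j, t ≤ j → j ≤ n → ∀ (N : Type u) [AddCommGroup N] [Module S N]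
      [Module.Finite S N], VanAt P j S N from H t le_rfl htn N
  intro j hj hjn
  induction hjn using Nat.decreasingInduction with
  | self =>
    intro N _ _ _ i hi
    obtain ⟨s, hs, h⟩ := hm N i hi
    exact ⟨s, fun h' => hs (hPm h'), h⟩
  | of_succ j hjn' ih =>
    intro N _ _ _
    have ih := ih (by omega)
    refine vanAt_of_base_finite P j (fun i hi => ?_) N
    obtain hi | rfl : j + 1 < i ∨ i = j + 1 := by omega
    · exact ih (S ⧸ P) i hi
    obtain ⟨-, δ, h2, -⟩ := contra_les hf hfg (Submodule.mkQ_surjective _) S (j + 1)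
    obtain ⟨s, hs, h⟩ := ih ((S ⧸ Ideal.ofList as) ⧸ LinearMap.range f) (j + 1 + 1) (by omega)
    refine ⟨s, hs, fun e => ?_⟩
    obtain ⟨e', he'⟩ := (h2 (s • e)).1 (by rw [map_smul, h])
    rw [← he', ext_ofList_eq_zero as a2 (j + 1) (by omega) e', map_zero]

end ExtTools

namespace ExtTools
open CategoryTheory Abelian CMTools RingTheory.Sequence Pointwise

variable {S : Type u} [CommRing S]

section
variable {Y : Type u} [AddCommGroup Y] [Module S Y]

lemma smul_exact (z : S) : Function.Exact (z • (LinearMap.id : Y →ₗ[S] Y))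
    (Submodule.mkQ (z • (⊤ : Submodule S Y)) : Y →ₗ[S] QuotSMulTop z Y) := by
  intro y
  rw [Submodule.mkQ_apply, Submodule.Quotient.mk_eq_zero, Submodule.mem_smul_pointwise_iff_exists]
  simp

lemma post_smul_id (N : Type u) [AddCommGroup N] [Module S N] (i : ℕ) (z : S) (e : EX S N Y i) :
    post N i (z • (LinearMap.id : Y →ₗ[S] Y)) e = z • e := by
  rw [post_smul, post_id]

end

theorem ext_eq_zero_of_lt (zs : List S) {Y : Type u} [AddCommGroup Y] [Module S Y]
    (hreg : IsWeaklyRegular Y zs) (N : Type u) [AddCommGroup N] [Module S N]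
    (hN : ∀ z ∈ zs, ∀ n : N, z • n = 0) (i : ℕ) (hi : i < zs.length) (e : EX S N Y i) : e = 0 := by
  induction zs generalizing Y i with
  | nil => simp at hi
  | cons z zs ih =>
    rw [isWeaklyRegular_cons_iff] at hreg
    have hinj : Function.Injective (z • (LinearMap.id : Y →ₗ[S] Y)) := hreg.1
    have hz : ∀ n : N, z • n = 0 := hN z (by simp)
    obtain _ | i := i
    · obtain ⟨f, rfl⟩ := mk0_surj e
      have : f = 0 := by
        refine LinearMap.ext fun n => hinj ?_
        change z • f n = z • (0 : Y)
        rw [← map_smul, hz, map_zero, smul_zero]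
      rw [this, ModuleCat.ofHom_zero, Ext.mk₀_zero]
    · obtain ⟨-, δ, -, h2, -⟩ := co_les hinj (smul_exact z) (Submodule.mkQ_surjective _) i
      have h0 : post N (i + 1) (z • (LinearMap.id : Y →ₗ[S] Y)) e = 0 := by
        rw [post_smul_id]; exact smul_eq_zero_of_left _ z hz e
      obtain ⟨e', he'⟩ := (h2 (ModuleCat.of S N) e).1 h0
      rw [← he', ih hreg.2 (fun w hw => hN w (by simp [hw])) i (by simpa using hi) e', map_zero]

/-- Lifting of homomorphisms modulo a regular sequence. -/
theorem exists_hom_of_ext (zs : List S) {Y : Type u} [AddCommGroup Y] [Module S Y]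
    (hreg : IsWeaklyRegular Y zs) {Z : Type u} [AddCommGroup Z] [Module S Z] (π : Y →ₗ[S] Z)
    (hπ : Function.Surjective π)
    (hker : LinearMap.ker π = Ideal.ofList zs • (⊤ : Submodule S Y))
    {N' N : Type u} [AddCommGroup N] [Module S N] [AddCommGroup N'] [Module S N']
    (f : N' →ₗ[S] N) (hN : ∀ z ∈ zs, ∀ n : N, z • n = 0) (hN' : ∀ z ∈ zs, ∀ n : N', z • n = 0)
    (s : S) (h : ∀ e' : EX S N' Y zs.length, ∃ e : EX S N Y zs.length, s • e' = pre Y _ f e)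
    (φ : N' →ₗ[S] Z) : ∃ ψ : N →ₗ[S] Z, s • φ = ψ ∘ₗ f := by
  induction zs generalizing Y with
  | nil =>
    rw [Ideal.ofList_nil, Submodule.bot_smul] at hker
    let π' := LinearEquiv.ofBijective π ⟨LinearMap.ker_eq_bot.1 hker, hπ⟩
    obtain ⟨e, he⟩ := h (Ext.mk₀ (ModuleCat.ofHom (π'.symm.toLinearMap ∘ₗ φ)))
    obtain ⟨ψ, rfl⟩ := mk0_surj e
    refine ⟨π ∘ₗ ψ, ?_⟩
    have h1 : s • (π'.symm.toLinearMap ∘ₗ φ) = ψ ∘ₗ f := by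
      apply mk0_inj
      rw [← smul_mk0, ← pre_mk0 ψ f]
      exact he
    rw [LinearMap.comp_assoc, ← h1]
    ext n
    change s • φ n = π (s • π'.symm (φ n))
    rw [map_smul]
    congr 1
    exact (π'.apply_symm_apply _).symm
  | cons z zs ih =>
    rw [isWeaklyRegular_cons_iff] at hreg
    have hinj : Function.Injective (z • (LinearMap.id : Y →ₗ[S] Y)) := hreg.1
    have hle : z • (⊤ : Submodule S Y) ≤ LinearMap.ker π := by
      rw [hker, Ideal.ofList_cons, Submodule.sup_smul, Submodule.ideal_span_singleton_smul]
      exact le_sup_left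
    refine ih hreg.2 (Submodule.liftQ _ π hle) ?_ ?_ (fun w hw => hN w (by simp [hw]))
      (fun w hw => hN' w (by simp [hw])) ?_
    · intro w
      obtain ⟨y, rfl⟩ := hπ w
      exact ⟨Submodule.Quotient.mk y, rfl⟩
    · rw [Submodule.ker_liftQ, hker, Ideal.ofList_cons, Submodule.sup_smul,
        Submodule.ideal_span_singleton_smul, Submodule.map_sup, Submodule.mkQ_map_self, bot_sup_eq,
        Submodule.map_smul'', Submodule.map_top, Submodule.range_mkQ]
    · intro e'
      obtain ⟨h0, δ, h1, h2, h3⟩ := co_les hinj (smul_exact z) (Submodule.mkQ_surjective _) zs.length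
      obtain ⟨e, he⟩ := h (δ (ModuleCat.of S N') e')
      have hze : post N (zs.length + 1) (z • (LinearMap.id : Y →ₗ[S] Y)) e = 0 := by
        rw [post_smul_id]; exact smul_eq_zero_of_left _ z (hN z (by simp)) e
      obtain ⟨e₂, rfl⟩ := (h2 (ModuleCat.of S N) e).1 hze
      refine ⟨e₂, ?_⟩
      have h4 : δ (ModuleCat.of S N') (s • e' - pre _ zs.length f e₂) = 0 := by
        rw [map_sub, map_smul, sub_eq_zero]
        refine he.trans ?_
        exact (h3 (ModuleCat.of S N) (ModuleCat.of S N') f e₂).symm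
      obtain ⟨e₃, h5⟩ := (h1 (ModuleCat.of S N') _).1 h4
      have h6 : e₃ = 0 := ext_eq_zero_of_lt (z :: zs) ((isWeaklyRegular_cons_iff _ _ _).2 hreg) N' hN'
        zs.length (by simp) e₃
      rw [h6, map_zero] at h5
      exact sub_eq_zero.1 h5.symm

end ExtTools

namespace ExtTools
open CategoryTheory Abelian CMTools RingTheory.Sequence Pointwise

variable {S : Type u} [CommRing S] [IsNoetherianRing S]

omit [IsNoetherianRing S] in
lemma ofList_smul_quot {z : List S} (r : S) (hr : r ∈ z) (n : S ⧸ Ideal.ofList z) : r • n = 0 := by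
  obtain ⟨n, rfl⟩ := Ideal.Quotient.mk_surjective n
  exact Ideal.Quotient.eq_zero_iff_mem.2 (Ideal.mul_mem_right _ _ (Ideal.subset_span hr))

lemma exists_embedding (z : List S) (I J : Ideal S)
    (hJ : ∀ j, j ∈ J ↔ ∀ a ∈ I, j * a ∈ Ideal.ofList z) :
    ∃ (m : ℕ) (u : Fin m → S) (f : (S ⧸ J) →ₗ[S] (Fin m → S ⧸ Ideal.ofList z)),
      Ideal.span (Set.range u) = I ∧ Function.Injective f ∧
      ∀ r i, f (Ideal.Quotient.mk J r) i = Ideal.Quotient.mk _ (r * u i) := by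
  obtain ⟨m, u, hu⟩ := Submodule.fg_iff_exists_fin_generating_family.1 (IsNoetherian.noetherian I)
  let f : (S ⧸ J) →ₗ[S] (Fin m → S ⧸ Ideal.ofList z) :=
    Submodule.liftQ J (LinearMap.pi fun i => (Submodule.mkQ (Ideal.ofList z)).comp
      (LinearMap.mulRight S (u i))) (fun j hj => by
        rw [LinearMap.mem_ker]
        funext i
        exact Ideal.Quotient.eq_zero_iff_mem.2
          ((hJ j).1 hj (u i) (hu ▸ Submodule.subset_span (Set.mem_range_self i))))
  refine ⟨m, u, f, hu, ?_, fun r i => rfl⟩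
  rw [← LinearMap.ker_eq_bot, LinearMap.ker_eq_bot']
  intro r hr
  obtain ⟨r, rfl⟩ := Ideal.Quotient.mk_surjective r
  rw [Ideal.Quotient.eq_zero_iff_mem, hJ]
  intro a ha
  rw [← hu] at ha
  have h1 : I ≤ I := le_rfl
  induction ha using Submodule.span_induction with
  | mem a ha =>
    obtain ⟨i, rfl⟩ := ha
    exact Ideal.Quotient.eq_zero_iff_mem.1 (congrFun hr i)
  | zero => rw [mul_zero]; exact Ideal.zero_mem _
  | add a b _ _ h h' => rw [mul_add]; exact Ideal.add_mem _ h h'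
  | smul c a _ h => rw [smul_eq_mul, mul_left_comm]; exact Ideal.mul_mem_left _ _ h

/-- Double annihilation, locally at primes of height at most the length of `z`. -/
theorem exists_mul_mem (z : List S) (hz : IsWeaklyRegular S z) (I J : Ideal S)
    (hI : Ideal.ofList z ≤ I) (hJ : ∀ j, j ∈ J ↔ ∀ a ∈ I, j * a ∈ Ideal.ofList z)
    (P : Ideal S) (t : ℕ) (ht : t ≤ z.length)
    (hV : ∀ (N : Type u) [AddCommGroup N] [Module S N] [Module.Finite S N], VanAt P t S N)
    (v : S) (hv : ∀ j ∈ J, v * j ∈ Ideal.ofList z) : ∃ s ∉ P, s * v ∈ I := by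
  obtain ⟨m, u, f, hu, hf, hfu⟩ := exists_embedding z I J hJ
  have hfg : Function.Exact f (LinearMap.range f).mkQ := LinearMap.exact_map_mkQ_range f
  obtain ⟨-, δ, h2, -⟩ := contra_les hf hfg (Submodule.mkQ_surjective _) S z.length
  obtain ⟨s, hs, h⟩ := hV ((Fin m → S ⧸ Ideal.ofList z) ⧸ LinearMap.range f) (z.length + 1)
    (by omega)
  have hmem : ∀ i, u i ∈ I := fun i => hu ▸ Submodule.subset_span (Set.mem_range_self i)
  let φ : (S ⧸ J) →ₗ[S] (S ⧸ Ideal.ofList z) := Submodule.liftQ J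
    ((Submodule.mkQ (Ideal.ofList z)).comp (LinearMap.mulLeft S v))
    (fun j hj => Ideal.Quotient.eq_zero_iff_mem.2 (hv j hj))
  obtain ⟨ψ, hψ⟩ := exists_hom_of_ext z hz (Submodule.mkQ (Ideal.ofList z))
    (Submodule.mkQ_surjective _) (by rw [Submodule.ker_mkQ, smul_eq_mul, Ideal.mul_top]) f
    (fun r hr n => by funext i; exact ofList_smul_quot r hr (n i))
    (fun r hr n => by
      obtain ⟨n, rfl⟩ := Ideal.Quotient.mk_surjective n
      exact Ideal.Quotient.eq_zero_iff_mem.2 (Ideal.mul_mem_right _ _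
        ((hJ r).2 fun a _ => Ideal.mul_mem_right _ _ (Ideal.subset_span hr)))) s
    (fun e' => by
      obtain ⟨e, he⟩ := (h2 (s • e')).1 (by rw [map_smul, h])
      exact ⟨e, he.symm⟩) φ
  refine ⟨s, hs, ?_⟩
  have h1 := LinearMap.congr_fun hψ (Ideal.Quotient.mk J 1)
  have h3 : (s • φ) (Ideal.Quotient.mk J 1) = Ideal.Quotient.mk _ (s * v) := by
    change s • Ideal.Quotient.mk _ (v * 1) = _
    rw [mul_one]; rfl
  rw [h3] at h1
  have h4 : f (Ideal.Quotient.mk J 1) = ∑ i, u i • Pi.single i (1 : S ⧸ Ideal.ofList z) := by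
    funext k
    rw [hfu, one_mul, Finset.sum_apply, Finset.sum_eq_single k]
    · rw [Pi.smul_apply, Pi.single_eq_same]
      change _ = Ideal.Quotient.mk _ (u k * 1)
      rw [mul_one]
    · intro i _ hik
      rw [Pi.smul_apply, Pi.single_eq_of_ne hik.symm, smul_zero]
    · simp
  rw [LinearMap.comp_apply, h4, map_sum] at h1
  choose c hc using fun i => Ideal.Quotient.mk_surjective (ψ (Pi.single i 1))
  have h5 : Ideal.Quotient.mk (Ideal.ofList z) (s * v) =
      Ideal.Quotient.mk _ (∑ i, u i * c i) := by
    rw [h1, map_sum]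
    refine Finset.sum_congr rfl fun i _ => ?_
    rw [map_smul, ← hc]; rfl
  rw [Ideal.Quotient.eq] at h5
  have h6 := I.add_mem (hI h5) (I.sum_mem (t := Finset.univ) (f := fun i => u i * c i)
    fun i _ => I.mul_mem_right _ (hmem i))
  rwa [sub_add_cancel] at h6

/-- Homomorphisms on `J` are multiplications, locally at primes of height at most `length z + 1`. -/
theorem exists_smul_eq_mul (z : List S) (hz : IsWeaklyRegular S z) (I J : Ideal S)
    (hJ : ∀ j, j ∈ J ↔ ∀ a ∈ I, j * a ∈ Ideal.ofList z)
    (P : Ideal S) (t : ℕ) (ht : t ≤ z.length + 1)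
    (hV : ∀ (N : Type u) [AddCommGroup N] [Module S N] [Module.Finite S N], VanAt P t S N)
    (φ : (J ⧸ Submodule.comap J.subtype (Ideal.ofList z)) →ₗ[S] (S ⧸ Ideal.ofList z)) :
    ∃ s ∉ P, ∃ a : S, ∀ j : J, s • φ (Submodule.Quotient.mk j) = Ideal.Quotient.mk _ (a * j.1) := by
  obtain ⟨m, u, f, hu, hf, hfu⟩ := exists_embedding z I J hJ
  have hzJ : Ideal.ofList z ≤ J := fun r hr => (hJ r).2 fun a _ => Ideal.mul_mem_right _ _ hr
  have hfg : Function.Exact f (LinearMap.range f).mkQ := LinearMap.exact_map_mkQ_range f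
  obtain ⟨-, δ, h2, -⟩ := contra_les hf hfg (Submodule.mkQ_surjective _) S (z.length + 1)
  obtain ⟨s, hs, h⟩ := hV ((Fin m → S ⧸ Ideal.ofList z) ⧸ LinearMap.range f) (z.length + 1 + 1)
    (by omega)
  have h3 : ∀ e : EX S (S ⧸ J) S (z.length + 1), s • e = 0 := by
    intro e
    obtain ⟨e', he'⟩ := (h2 (s • e)).1 (by rw [map_smul, h])
    rw [← he', eq_zero_pi _ _ (ext_ofList_eq_zero z hz (z.length + 1) (by omega)) e', map_zero]
  let ι : (J ⧸ Submodule.comap J.subtype (Ideal.ofList z)) →ₗ[S] (S ⧸ Ideal.ofList z) :=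
    Submodule.mapQ _ _ J.subtype le_rfl
  let g : (S ⧸ Ideal.ofList z) →ₗ[S] (S ⧸ J) := Submodule.factor hzJ
  have hι : Function.Injective ι := by
    rw [← LinearMap.ker_eq_bot, LinearMap.ker_eq_bot']
    intro j hj
    obtain ⟨j, rfl⟩ := Submodule.Quotient.mk_surjective _ j
    rw [Submodule.Quotient.mk_eq_zero]
    exact Ideal.Quotient.eq_zero_iff_mem.1 hj
  have hιg : Function.Exact ι g := by
    intro r
    obtain ⟨r, rfl⟩ := Ideal.Quotient.mk_surjective r
    constructor
    · intro hr
      have hr' : r ∈ J := Ideal.Quotient.eq_zero_iff_mem.1 hr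
      exact ⟨Submodule.Quotient.mk ⟨r, hr'⟩, rfl⟩
    · rintro ⟨j, hj⟩
      obtain ⟨j, rfl⟩ := Submodule.Quotient.mk_surjective _ j
      rw [← hj]
      exact Ideal.Quotient.eq_zero_iff_mem.2 j.2
  obtain ⟨-, δ', k2, -⟩ := contra_les hι hιg (Submodule.factor_surjective hzJ) S z.length
  obtain ⟨ψ, hψ⟩ := exists_hom_of_ext z hz (Submodule.mkQ (Ideal.ofList z))
    (Submodule.mkQ_surjective _) (by rw [Submodule.ker_mkQ, smul_eq_mul, Ideal.mul_top]) ι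
    (fun r hr n => ofList_smul_quot r hr n)
    (fun r hr n => hι (by rw [map_smul, map_zero]; exact ofList_smul_quot r hr _)) s
    (fun e' => by
      obtain ⟨e, he⟩ := (k2 (s • e')).1 (by rw [map_smul, h3])
      exact ⟨e, he.symm⟩) φ
  obtain ⟨a, ha⟩ := Ideal.Quotient.mk_surjective (ψ 1)
  refine ⟨s, hs, a, fun j => ?_⟩
  have h1 := LinearMap.congr_fun hψ (Submodule.Quotient.mk j)
  refine h1.trans ?_
  have h4 : ι (Submodule.Quotient.mk j) = j.1 • (1 : S ⧸ Ideal.ofList z) := by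
    change Ideal.Quotient.mk _ j.1 = Ideal.Quotient.mk _ (j.1 * 1)
    rw [mul_one]
  rw [LinearMap.comp_apply, h4, map_smul, ← ha, mul_comm]
  rfl

end ExtTools

namespace CMTools
open RingTheory.Sequence Pointwise

/-- Regularity of a pair, elementwise. -/
def RegPair {L : Type u} [CommRing L] (r₁ r₂ : L) : Prop :=
  (∀ x, r₁ * x = 0 → x = 0) ∧ ∀ x y, r₂ * x = r₁ * y → ∃ w, x = r₁ * w

lemma RegPair.pow {L : Type u} [CommRing L] {r₁ r₂ : L} (h : RegPair r₁ r₂) (a b : ℕ) :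
    RegPair (r₁ ^ a) (r₂ ^ b) := by
  obtain ⟨h1, h2⟩ := h
  have p1 : ∀ a x, r₁ ^ a * x = 0 → x = 0 := by
    intro a
    induction a with
    | zero => intro x hx; simpa using hx
    | succ a ih => intro x hx; exact h1 _ (ih _ (by rw [← hx]; ring))
  have p2 : ∀ a x y, r₂ * x = r₁ ^ a * y → ∃ w, x = r₁ ^ a * w := by
    intro a
    induction a with
    | zero => intro x y _; exact ⟨x, by simp⟩
    | succ a ih =>
      intro x y hx
      obtain ⟨w, rfl⟩ := h2 x (r₁ ^ a * y) (by rw [hx]; ring)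
      obtain ⟨v, rfl⟩ := ih w y (by
        have := h1 (r₂ * w - r₁ ^ a * y) (by linear_combination hx)
        linear_combination this)
      exact ⟨v, by ring⟩
  refine ⟨p1 a, ?_⟩
  induction b with
  | zero => intro x y hx; exact ⟨y, by simpa using hx⟩
  | succ b ih =>
    intro x y hx
    obtain ⟨w, hw⟩ := ih (r₂ * x) y (by rw [← hx]; ring)
    exact p2 a x w hw

/-- Hartshorne's connectedness lemma. -/
lemma RegPair.connected {L : Type u} [CommRing L] [IsLocalRing L] {r₁ r₂ : L} (h : RegPair r₁ r₂)
    (b₁ b₂ : Ideal L) (hb : ∀ x ∈ b₁, ∀ y ∈ b₂, x * y = 0) (c₁ : ∃ c, r₁ ^ c ∈ b₁ ⊔ b₂)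
    (c₂ : ∃ c, r₂ ^ c ∈ b₁ ⊔ b₂) : (∀ x ∈ b₁, x = 0) ∨ ∀ x ∈ b₂, x = 0 := by
  obtain ⟨c₁, h1⟩ := c₁
  obtain ⟨c₂, h2⟩ := c₂
  obtain ⟨p1, p2⟩ := h.pow c₁ c₂
  obtain ⟨α₁, hα₁, α₂, hα₂, hα⟩ := Submodule.mem_sup.1 h1
  obtain ⟨β₁, hβ₁, β₂, hβ₂, hβ⟩ := Submodule.mem_sup.1 h2
  have e1 := hb _ hα₁ _ hβ₂
  have e2 := hb _ hβ₁ _ hα₂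
  have e3 := hb _ hα₁ _ hα₂
  obtain ⟨e, he⟩ := p2 α₁ β₁ (by rw [← hα, ← hβ]; linear_combination e1 - e2)
  have h3 : e * (1 - e) = 0 := p1 _ (p1 _ (by
    rw [← hα] at he ⊢
    have : (α₁ + α₂) * e * (α₁ + α₂ - (α₁ + α₂) * e) = 0 := by rw [← he]; linear_combination e3
    linear_combination this))
  rcases IsLocalRing.isUnit_or_isUnit_one_sub_self e with hu | hu
  · right
    have h4 : (1 - e) = 0 := (hu.mul_right_eq_zero).1 h3
    have h5 : α₁ = r₁ ^ c₁ := by rw [he]; linear_combination (-r₁ ^ c₁) * h4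
    intro y hy
    exact p1 y (by rw [← h5]; exact hb _ hα₁ _ hy)
  · left
    have h4 : e = 0 := (hu.mul_left_eq_zero).1 h3
    have h5 : α₂ = r₁ ^ c₁ := by rw [← hα, he, h4, mul_zero, zero_add]
    intro x hx
    exact p1 x (by rw [← h5, mul_comm]; exact hb _ hx _ hα₂)

variable {S : Type u} [CommRing S]

/-- The map from `S` to the localization of `S ⧸ I` at a prime over `I`, elementwise. -/
structure LocMap (I P : Ideal S) (L : Type u) [CommRing L] where
  f : S →+* L
  unit : ∀ s ∉ P, IsUnit (f s)
  frac : ∀ ρ, ∃ a, ∃ s ∉ P, ρ * f s = f a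
  zero : ∀ x, f x = 0 ↔ ∃ s ∉ P, s * x ∈ I
  isMax : ∀ a, IsUnit (f a) → a ∉ P

lemma exists_locMap {I : Ideal S} (hS : SerreS (S ⧸ I) 2) (P : Ideal S) (hP : P.IsPrime)
    (hI : I ≤ P) : ∃ (L : Type u) (_ : CommRing L) (_ : IsLocalRing L) (φ : LocMap I P L),
      ((∃ Q : Ideal S, Q.IsPrime ∧ I ≤ Q ∧ Q < P) → ∃ r ∈ P, ∀ x, φ.f r * x = 0 → x = 0) ∧
      ((∃ Q₀ Q₁ : Ideal S, Q₀.IsPrime ∧ Q₁.IsPrime ∧ I ≤ Q₀ ∧ Q₀ < Q₁ ∧ Q₁ < P) →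
        ∃ r₁ ∈ P, ∃ r₂ ∈ P, RegPair (φ.f r₁) (φ.f r₂)) := by
  have hmap : ∀ Q : Ideal S, Q.IsPrime → I ≤ Q → (Q.map (Ideal.Quotient.mk I)).IsPrime ∧
      ∀ a, Ideal.Quotient.mk I a ∈ Q.map (Ideal.Quotient.mk I) ↔ a ∈ Q := by
    intro Q hQ hIQ
    refine ⟨Ideal.map_isPrime_of_surjective Ideal.Quotient.mk_surjective (by
      rwa [Ideal.mk_ker]), fun a => ?_⟩
    rw [← Ideal.mem_comap, Ideal.comap_map_of_surjective _ Ideal.Quotient.mk_surjective,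
      ← RingHom.ker_eq_comap_bot, Ideal.mk_ker, sup_eq_left.2 hIQ]
  have hlt : ∀ Q Q' : Ideal S, Q.IsPrime → Q'.IsPrime → I ≤ Q → Q < Q' →
      Q.map (Ideal.Quotient.mk I) < Q'.map (Ideal.Quotient.mk I) := by
    intro Q Q' hQ hQ' hIQ hlt
    refine lt_of_le_of_ne (Ideal.map_mono hlt.le) fun h => hlt.ne ?_
    ext a
    rw [← (hmap Q hQ hIQ).2, ← (hmap Q' hQ' (hIQ.trans hlt.le)).2, h]
  set P' := P.map (Ideal.Quotient.mk I) with hP'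
  have hp' : P'.IsPrime := (hmap P hP hI).1
  have hmem := (hmap P hP hI).2
  let L := Localization.AtPrime P'
  let f : S →+* L := (algebraMap (S ⧸ I) L).comp (Ideal.Quotient.mk I)
  have hunit : ∀ s ∉ P, IsUnit (f s) := fun s hs =>
    IsLocalization.map_units L (⟨Ideal.Quotient.mk I s, fun h => hs ((hmem s).1 h)⟩ : P'.primeCompl)
  have hfrac : ∀ ρ, ∃ a, ∃ s ∉ P, ρ * f s = f a := by
    intro ρ
    obtain ⟨⟨a, s⟩, h⟩ := IsLocalization.surj P'.primeCompl ρ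
    obtain ⟨a, rfl⟩ := Ideal.Quotient.mk_surjective a
    obtain ⟨s, hs⟩ := s
    obtain ⟨s, rfl⟩ := Ideal.Quotient.mk_surjective s
    exact ⟨a, s, fun h' => hs ((hmem s).2 h'), h⟩
  have hzero : ∀ x, f x = 0 ↔ ∃ s ∉ P, s * x ∈ I := by
    intro x
    change algebraMap (S ⧸ I) L (Ideal.Quotient.mk I x) = 0 ↔ _
    rw [IsLocalization.map_eq_zero_iff P'.primeCompl]
    constructor
    · rintro ⟨⟨s, hs⟩, h⟩
      obtain ⟨s, rfl⟩ := Ideal.Quotient.mk_surjective s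
      exact ⟨s, fun h' => hs ((hmem s).2 h'), Ideal.Quotient.eq_zero_iff_mem.1 h⟩
    · rintro ⟨s, hs, h⟩
      exact ⟨⟨Ideal.Quotient.mk I s, fun h => hs ((hmem s).1 h)⟩,
        Ideal.Quotient.eq_zero_iff_mem.2 h⟩
  have hmax : ∀ a, IsUnit (f a) → a ∉ P := fun a ha h =>
    (IsLocalization.AtPrime.to_map_mem_maximal_iff L P' (Ideal.Quotient.mk I a)).2 ((hmem a).2 h) ha
  let φ : LocMap I P L := ⟨f, hunit, hfrac, hzero, hmax⟩
  have hnum : ∀ ρ ∈ maximalIdeal L, ∃ a ∈ P, ∃ w, ρ * w = f a ∧ IsUnit w := by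
    intro ρ hρ
    obtain ⟨a, s, hs, h⟩ := hfrac ρ
    refine ⟨a, ?_, f s, h, hunit s hs⟩
    rw [← hmem, ← IsLocalization.AtPrime.to_map_mem_maximal_iff L P']
    change f a ∈ _
    rw [← h]
    exact Ideal.mul_mem_right _ _ hρ
  have hdim : ringKrullDim L = P'.height := IsLocalization.AtPrime.ringKrullDim_eq_height P' L
  refine ⟨L, inferInstance, inferInstance, φ, ?_, ?_⟩
  · rintro ⟨Q, hQ, hIQ, hQP⟩
    obtain ⟨rs, hlen, hrs, hreg⟩ := hS P' hp' 1 (by norm_num) (by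
      change _ ≤ ringKrullDim L
      rw [hdim]
      have i1 := (hmap Q hQ hIQ).1
      have := Ideal.height_add_one_le_of_lt_of_isPrime (I := Q.map (Ideal.Quotient.mk I)) (J := P')
        (hlt Q P hQ hP hIQ hQP)
      exact_mod_cast le_trans le_add_self this)
    obtain ⟨ρ, rfl⟩ := List.length_eq_one_iff.1 hlen
    obtain ⟨a, ha, w, hw, hwu⟩ := hnum ρ (hrs ρ (by simp))
    refine ⟨a, ha, fun x hx => ?_⟩
    have h1 := ((isWeaklyRegular_cons_iff (M := L) ρ []).1 hreg).1
    change f a * x = 0 at hx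
    refine h1 ?_
    change ρ * x = ρ * 0
    rw [← hw, mul_right_comm] at hx
    rw [mul_zero]
    exact hwu.mul_left_eq_zero.1 hx
  · rintro ⟨Q₀, Q₁, hQ₀, hQ₁, hIQ, h01, h1P⟩
    obtain ⟨rs, hlen, hrs, hreg⟩ := hS P' hp' 2 (by norm_num) (by
      change _ ≤ ringKrullDim L
      rw [hdim]
      have i1 := (hmap Q₁ hQ₁ (hIQ.trans h01.le)).1
      have i0 := (hmap Q₀ hQ₀ hIQ).1
      have a1 := Ideal.height_add_one_le_of_lt_of_isPrime (I := Q₁.map (Ideal.Quotient.mk I))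
        (J := P') (hlt Q₁ P hQ₁ hP (hIQ.trans h01.le) h1P)
      have a2 := Ideal.height_add_one_le_of_lt_of_isPrime (I := Q₀.map (Ideal.Quotient.mk I))
        (J := Q₁.map (Ideal.Quotient.mk I)) (hlt Q₀ Q₁ hQ₀ hQ₁ hIQ h01)
      have a3 : (2 : ℕ∞) ≤ P'.height := by
        refine le_trans ?_ a1
        have : (1 : ℕ∞) ≤ (Q₁.map (Ideal.Quotient.mk I)).height := le_trans le_add_self a2
        calc (2 : ℕ∞) = 1 + 1 := by norm_num
          _ ≤ _ := by gcongr
      exact WithBot.coe_le_coe.2 a3)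
    obtain ⟨ρ₁, ρ₂, rfl⟩ := List.length_eq_two.1 hlen
    obtain ⟨a₁, ha₁, w₁, hw₁, hwu₁⟩ := hnum ρ₁ (hrs _ (by simp))
    obtain ⟨a₂, ha₂, w₂, hw₂, hwu₂⟩ := hnum ρ₂ (hrs _ (by simp))
    obtain ⟨h1, h2⟩ := (isWeaklyRegular_cons_self ρ₁ [ρ₂]).1 hreg
    have h3 := ((isWeaklyRegular_cons_self _ []).1 h2).1
    refine ⟨a₁, ha₁, a₂, ha₂, fun x hx => ?_, fun x y hx => ?_⟩
    · change f a₁ * x = 0 at hx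
      refine h1 ?_
      change ρ₁ * x = ρ₁ * 0
      rw [← hw₁, mul_right_comm] at hx
      rw [mul_zero]
      exact hwu₁.mul_left_eq_zero.1 hx
    · change f a₂ * x = f a₁ * y at hx
      obtain ⟨v, hv⟩ := hwu₁.exists_right_inv
      obtain ⟨v₂, hv₂⟩ := hwu₂.exists_right_inv
      have h4 : Ideal.Quotient.mk (Ideal.span {ρ₁}) x = 0 := by
        refine h3 ?_
        change Ideal.Quotient.mk _ ρ₂ * Ideal.Quotient.mk _ x = Ideal.Quotient.mk _ ρ₂ * 0
        rw [mul_zero, ← map_mul, Ideal.Quotient.eq_zero_iff_mem, Ideal.mem_span_singleton']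
        refine ⟨w₁ * y * v₂, ?_⟩
        rw [← hw₁, ← hw₂] at hx
        linear_combination (-v₂) * hx + ρ₂ * x * hv₂
      rw [Ideal.Quotient.eq_zero_iff_mem, Ideal.mem_span_singleton'] at h4
      obtain ⟨w, hw⟩ := h4
      refine ⟨v * w, ?_⟩
      change x = f a₁ * _
      rw [← hw₁, ← hw]
      linear_combination (-w * ρ₁) * hv

end CMTools

namespace CMTools
open RingTheory.Sequence Pointwise

variable {S : Type u} [CommRing S]

lemma LocMap.exists_pow_mem {I P K : Ideal S} {L : Type u} [CommRing L] (φ : LocMap I P L)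
    (hP : P ∈ K.minimalPrimes) {r : S} (hr : r ∈ P) : ∃ c, φ.f r ^ c ∈ K.map φ.f := by
  change φ.f r ∈ (K.map φ.f).radical
  rw [Ideal.radical_eq_sInf, Submodule.mem_sInf]
  rintro Q ⟨hKQ, hQ⟩
  have h1 : Ideal.comap φ.f Q ≤ P := by
    intro s hs
    by_contra hsP
    exact hQ.ne_top (Ideal.eq_top_of_isUnit_mem _ hs (φ.unit s hsP))
  exact hP.2 ⟨hQ.comap _, Ideal.map_le_iff_le_comap.1 hKQ⟩ h1 hr

lemma sInf_le_prime {s : Set (Ideal S)} (hs : s.Finite) {P : Ideal S} (hP : P.IsPrime)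
    (h : sInf s ≤ P) : ∃ Q ∈ s, Q ≤ P := by
  have : sInf s = hs.toFinset.inf id := by
    rw [Finset.inf_id_eq_sInf, hs.coe_toFinset]
  rw [this, hP.inf_le'] at h
  obtain ⟨Q, hQ, hle⟩ := h
  exact ⟨Q, hs.mem_toFinset.1 hQ, hle⟩

/-- Unmixedness under `S₂`. -/
theorem height_eq_of_minimal [IsLocalRing S] [IsNoetherianRing S] {n : ℕ} (hcm : IsCM S n)
    {I : Ideal S} (hS : SerreS (S ⧸ I) 2) {d : ℕ}
    (h₁ : ∃ P : Ideal S, P.IsPrime ∧ I ≤ P ∧ P.height ≤ d)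
    (h₂ : ∀ P : Ideal S, P.IsPrime → I ≤ P → d ≤ P.height) {P : Ideal S}
    (hP : P ∈ I.minimalPrimes) : P.height = d := by
  classical
  by_contra hne
  set A := {P ∈ I.minimalPrimes | P.height = d} with hA
  set B := {P ∈ I.minimalPrimes | P.height ≠ d} with hB
  have hfin := Ideal.finite_minimalPrimes_of_isNoetherianRing S I
  have hAf : A.Finite := hfin.subset fun _ h => h.1
  have hBf : B.Finite := hfin.subset fun _ h => h.1
  have hPB : P ∈ B := ⟨hP, hne⟩
  obtain ⟨P₀, hP₀, hIP₀, hh⟩ := h₁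
  obtain ⟨P₁, hP₁, hP₁₀⟩ := Ideal.exists_minimalPrimes_le hIP₀
  have hP₁A : P₁ ∈ A := ⟨hP₁, le_antisymm ((Ideal.height_mono hP₁₀).trans hh)
    (h₂ P₁ hP₁.1.1 hP₁.1.2)⟩
  have hle1 : sInf A ≤ maximalIdeal S :=
    (sInf_le hP₁A).trans (IsLocalRing.le_maximalIdeal hP₁.1.1.ne_top)
  have hle2 : sInf B ≤ maximalIdeal S :=
    (sInf_le hPB).trans (IsLocalRing.le_maximalIdeal hP.1.1.ne_top)
  obtain ⟨Q, hQ, -⟩ := Ideal.exists_minimalPrimes_le (sup_le hle1 hle2)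
  obtain ⟨Q₁, hQ₁, hQ₁Q⟩ := sInf_le_prime hAf hQ.1.1 (le_sup_left.trans hQ.1.2)
  obtain ⟨Q₂, hQ₂, hQ₂Q⟩ := sInf_le_prime hBf hQ.1.1 (le_sup_right.trans hQ.1.2)
  have hAB : ∀ X ∈ A, ∀ Y ∈ B, ¬ X ≤ Y := by
    intro X hX Y hY hle
    have := hY.1.2 hX.1.1 hle
    exact hY.2 ((le_antisymm hle this) ▸ hX.2)
  have hBA : ∀ X ∈ A, ∀ Y ∈ B, ¬ Y ≤ X := by
    intro X hX Y hY hle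
    have := hX.1.2 hY.1.1 hle
    exact hY.2 ((le_antisymm this hle) ▸ hX.2)
  have hlt2 : Q₂ < Q := lt_of_le_of_ne hQ₂Q fun h => hAB Q₁ hQ₁ Q₂ hQ₂ (h ▸ hQ₁Q)
  have hht : ((d + 2 : ℕ) : ℕ∞) ≤ Q.height := by
    have h3 : (d : ℕ∞) + 1 ≤ Q₂.height :=
      Order.add_one_le_of_lt (lt_of_le_of_ne (h₂ Q₂ hQ₂.1.1.1 hQ₂.1.1.2) (Ne.symm hQ₂.2))
    have h4 := height_add_one_le hQ₂.1.1.1 hQ.1.1 hlt2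
    calc ((d + 2 : ℕ) : ℕ∞) = (d : ℕ∞) + 1 + 1 := by push_cast; ring
      _ ≤ Q₂.height + 1 := by gcongr
      _ ≤ _ := h4
  obtain ⟨Q₃, hQ₃, h13, h3Q⟩ := exists_between hcm hQ₁.1.1.1 hQ.1.1 hQ₁Q hQ₁.2.le hht
  have hIQ : I ≤ Q := hQ₁.1.1.2.trans hQ₁Q
  obtain ⟨L, _, _, φ, -, hφ⟩ := exists_locMap hS Q hQ.1.1 hIQ
  obtain ⟨r₁, hr₁, r₂, hr₂, hreg⟩ := hφ ⟨Q₁, Q₃, hQ₁.1.1.1, hQ₃, hQ₁.1.1.2, h13, h3Q⟩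
  have hrad : sInf A * sInf B ≤ I.radical := by
    rw [← Ideal.sInf_minimalPrimes]
    refine le_sInf fun X hX => ?_
    by_cases h : X.height = d
    · exact Ideal.mul_le_left.trans (sInf_le ⟨hX, h⟩)
    · exact Ideal.mul_le_right.trans (sInf_le ⟨hX, h⟩)
  obtain ⟨N, hN⟩ := Ideal.exists_pow_le_of_le_radical_of_fg hrad (IsNoetherian.noetherian _)
  rw [mul_pow] at hN
  have hpow : ∀ r ∈ Q, ∃ c, φ.f r ^ c ∈ (sInf A ^ N).map φ.f ⊔ (sInf B ^ N).map φ.f := by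
    intro r hr
    obtain ⟨c, hc⟩ := φ.exists_pow_mem hQ hr
    refine ⟨c * (N + N), ?_⟩
    rw [pow_mul, ← Ideal.map_sup]
    refine Ideal.map_mono Ideal.sup_pow_add_le_pow_sup_pow ?_
    rw [Ideal.map_pow]
    exact Ideal.pow_mem_pow hc _
  have hmul : ∀ x ∈ (sInf A ^ N).map φ.f, ∀ y ∈ (sInf B ^ N).map φ.f, x * y = 0 := by
    intro x hx y hy
    have h5 := Ideal.mul_mem_mul hx hy
    rw [← Ideal.map_mul] at h5
    have h6 := Ideal.map_mono (f := φ.f) hN h5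
    have h7 : I.map φ.f ≤ ⊥ := by
      rw [Ideal.map_le_iff_le_comap]
      intro a ha
      rw [Ideal.mem_comap, Ideal.mem_bot, φ.zero]
      exact ⟨1, fun h => hQ.1.1.ne_top ((Ideal.eq_top_iff_one _).2 h), by simpa using ha⟩
    exact h7 h6
  have key : ∀ K : Ideal S, (∀ x ∈ (K ^ N).map φ.f, x = 0) → ∀ X : Ideal S, X.IsPrime → I ≤ X →
      X ≤ Q → K ≤ X := by
    intro K hK X hX hIX hXQ
    have : K ^ N ≤ X := by
      intro a ha
      obtain ⟨s, hs, h8⟩ := (φ.zero a).1 (hK _ (Ideal.mem_map_of_mem _ ha))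
      exact (hX.mem_or_mem (hIX h8)).resolve_left fun h => hs (hXQ h)
    exact hX.le_of_pow_le this
  rcases hreg.connected _ _ hmul (hpow r₁ hr₁) (hpow r₂ hr₂) with h | h
  · obtain ⟨X, hX, hle⟩ := sInf_le_prime hAf hQ₂.1.1.1
      (key _ h Q₂ hQ₂.1.1.1 hQ₂.1.1.2 hQ₂Q)
    exact hAB X hX Q₂ hQ₂ hle
  · obtain ⟨X, hX, hle⟩ := sInf_le_prime hBf hQ₁.1.1.1
      (key _ h Q₁ hQ₁.1.1.1 hQ₁.1.1.2 hQ₁Q)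
    exact hBA Q₁ hQ₁ X hX hle

end CMTools

namespace ExtTools
open CMTools RingTheory.Sequence Pointwise

variable {S : Type u} [CommRing S] [IsLocalRing S] [IsNoetherianRing S]

omit [IsLocalRing S] [IsNoetherianRing S] in
lemma assP_minimal {I : Ideal S} (hS : SerreS (S ⧸ I) 2) {Q : Ideal S} (hQ : AssP Q (S ⧸ I)) :
    Q ∈ I.minimalPrimes := by
  obtain ⟨hQp, y, hy⟩ := hQ
  obtain ⟨y, rfl⟩ := Ideal.Quotient.mk_surjective y
  replace hy : ∀ r, r ∈ Q ↔ r * y ∈ I := fun r => (hy r).trans Ideal.Quotient.eq_zero_iff_mem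
  have hIQ : I ≤ Q := fun i hi => (hy i).2 (I.mul_mem_right _ hi)
  obtain ⟨Q₀, hQ₀, hle⟩ := Ideal.exists_minimalPrimes_le hIQ
  rcases hle.eq_or_lt with rfl | hlt
  · exact hQ₀
  obtain ⟨L, _, _, φ, hφ, -⟩ := exists_locMap hS Q hQp hIQ
  obtain ⟨r, hr, hreg⟩ := hφ ⟨Q₀, hQ₀.1.1, hQ₀.1.2, hlt⟩
  have h1 : φ.f y = 0 := hreg _ (by
    rw [← map_mul, φ.zero]
    exact ⟨1, fun h => hQp.ne_top ((Ideal.eq_top_iff_one _).2 h), by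
      rw [one_mul]; exact (hy r).1 hr⟩)
  obtain ⟨s, hs, h2⟩ := (φ.zero y).1 h1
  exact absurd ((hy s).2 h2) hs

theorem mem_of_mul_le {n : ℕ} (hcm : IsCM S n)
    (hV : ∀ (P : Ideal S) [P.IsPrime] (t : ℕ), P.height = t →
      ∀ (N : Type u) [AddCommGroup N] [Module S N] [Module.Finite S N], VanAt P t S N)
    {I J : Ideal S} (hS : SerreS (S ⧸ I) 2) (z : List S) (hz : IsWeaklyRegular S z)
    (hI : Ideal.ofList z ≤ I)
    (h₁ : ∃ P : Ideal S, P.IsPrime ∧ I ≤ P ∧ P.height ≤ z.length)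
    (h₂ : ∀ P : Ideal S, P.IsPrime → I ≤ P → z.length ≤ P.height)
    (hJ : ∀ j, j ∈ J ↔ ∀ a ∈ I, j * a ∈ Ideal.ofList z) (v : S)
    (hv : ∀ j ∈ J, v * j ∈ Ideal.ofList z) : v ∈ I := by
  by_contra hvI
  obtain ⟨Q, hQ, hvQ, -⟩ := exists_assP (Ideal.Quotient.mk I v) (maximalIdeal S) (fun r hr => by
    by_contra h
    have hu : IsUnit r := by simpa using h
    have h3 : r * v ∈ I := Ideal.Quotient.eq_zero_iff_mem.1 hr
    exact hvI ((Ideal.unit_mul_mem_iff_mem I hu).1 h3))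
  have hmin := assP_minimal hS hQ
  have hht := height_eq_of_minimal hcm hS h₁ h₂ hmin
  have := hQ.1
  obtain ⟨s, hs, h⟩ := exists_mul_mem z hz I J hI hJ Q z.length le_rfl (hV Q _ hht) v hv
  exact hs (hvQ s (Ideal.Quotient.eq_zero_iff_mem.2 h))

theorem exists_eq_mul {n : ℕ} (hcm : IsCM S n)
    (hV : ∀ (P : Ideal S) [P.IsPrime] (t : ℕ), P.height = t →
      ∀ (N : Type u) [AddCommGroup N] [Module S N] [Module.Finite S N], VanAt P t S N)
    {I J : Ideal S} (hS : SerreS (S ⧸ I) 2) (z : List S) (hz : IsWeaklyRegular S z)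
    (hI : Ideal.ofList z ≤ I)
    (h₁ : ∃ P : Ideal S, P.IsPrime ∧ I ≤ P ∧ P.height ≤ z.length)
    (h₂ : ∀ P : Ideal S, P.IsPrime → I ≤ P → z.length ≤ P.height)
    (hJ : ∀ j, j ∈ J ↔ ∀ a ∈ I, j * a ∈ Ideal.ofList z)
    (f : J →ₗ[S] S ⧸ Ideal.ofList z) (hf : ∀ j : J, j.1 ∈ Ideal.ofList z → f j = 0) :
    ∃ a, ∀ j : J, f j = Ideal.Quotient.mk (Ideal.ofList z) (a * j.1) := by
  let ι : ((J ⧸ Submodule.comap J.subtype (Ideal.ofList z)) →ₗ[S] (S ⧸ Ideal.ofList z)) := Submodule.mapQ _ _ J.subtype le_rfl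
  let F : ((J ⧸ Submodule.comap J.subtype (Ideal.ofList z)) →ₗ[S] (S ⧸ Ideal.ofList z)) := Submodule.liftQ _ f hf
  have hιm : ∀ a (j : J), (a • ι) (Submodule.Quotient.mk j) = Ideal.Quotient.mk _ (a * j.1) :=
    fun a j => rfl
  have hIH : ∀ i ∈ I, ∀ g : ((J ⧸ Submodule.comap J.subtype (Ideal.ofList z)) →ₗ[S] (S ⧸ Ideal.ofList z)), i • g = 0 := by
    intro i hi g
    refine LinearMap.ext fun m => ?_
    obtain ⟨j, rfl⟩ := Submodule.Quotient.mk_surjective _ m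
    rw [LinearMap.smul_apply, ← map_smul, ← Submodule.Quotient.mk_smul,
      (Submodule.Quotient.mk_eq_zero _).2, map_zero]
    · rfl
    · change i * j.1 ∈ Ideal.ofList z
      rw [mul_comm]
      exact (hJ _).1 j.2 i hi
  suffices hF : F ∈ Submodule.span S {ι} by
    obtain ⟨a, ha⟩ := Submodule.mem_span_singleton.1 hF
    refine ⟨a, fun j => ?_⟩
    rw [← hιm, ha]
    rfl
  by_contra hF
  obtain ⟨Q, ⟨hQ, g, hg⟩, -, -⟩ := exists_assP (M := ((J ⧸ Submodule.comap J.subtype (Ideal.ofList z)) →ₗ[S] (S ⧸ Ideal.ofList z)) ⧸ Submodule.span S {ι})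
    (Submodule.Quotient.mk F) (maximalIdeal S) (fun r hr => by
      by_contra h
      have hu : IsUnit r := by simpa using h
      rw [← Submodule.Quotient.mk_smul, Submodule.Quotient.mk_eq_zero] at hr
      exact hF ((Submodule.smul_mem_iff_of_isUnit _ hu).1 hr))
  obtain ⟨g, rfl⟩ := Submodule.Quotient.mk_surjective _ g
  replace hg : ∀ r : S, r ∈ Q ↔ ∃ a : S, a • ι = r • g := by
    intro r
    rw [hg, ← Submodule.Quotient.mk_smul, Submodule.Quotient.mk_eq_zero,
      Submodule.mem_span_singleton]
  have hIQ : I ≤ Q := fun i hi => (hg i).2 ⟨0, by rw [zero_smul, hIH i hi]⟩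
  obtain ⟨t, ht⟩ := ENat.ne_top_iff_exists.1 (Ideal.height_ne_top hQ.ne_top)
  have hht : z.length + 2 ≤ t := by
    by_contra hlt
    obtain ⟨s, hs, a, ha⟩ := exists_smul_eq_mul z hz I J hJ Q t (by omega) (hV Q t ht.symm) g
    refine hs ((hg s).2 ⟨a, ?_⟩)
    refine LinearMap.ext fun m => ?_
    obtain ⟨j, rfl⟩ := Submodule.Quotient.mk_surjective _ m
    rw [hιm, ← ha]; rfl
  obtain ⟨Q₀, hQ₀, hQ₀Q⟩ := Ideal.exists_minimalPrimes_le hIQ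
  have hmin : ∀ P ∈ I.minimalPrimes, P.height = z.length := fun P hP =>
    height_eq_of_minimal hcm hS h₁ h₂ hP
  obtain ⟨Q₁, hQ₁, h01, h1Q⟩ := exists_between hcm hQ₀.1.1 hQ hQ₀Q (hmin Q₀ hQ₀).le
    (by rw [← ht]; exact_mod_cast hht)
  obtain ⟨L, _, _, φ, -, hφ⟩ := exists_locMap hS Q hQ hIQ
  obtain ⟨r₁, hr₁, r₂, hr₂, hreg1, hreg2⟩ := hφ ⟨Q₀, Q₁, hQ₀.1.1, hQ₁, hQ₀.1.2, h01, h1Q⟩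
  have h1Q' : (1 : S) ∉ Q := fun h => hQ.ne_top ((Ideal.eq_top_iff_one _).2 h)
  obtain ⟨a₁, ha₁⟩ := (hg r₁).1 hr₁
  obtain ⟨a₂, ha₂⟩ := (hg r₂).1 hr₂
  have hmem : r₂ * a₁ - r₁ * a₂ ∈ I := by
    refine mem_of_mul_le hcm hV hS z hz hI h₁ h₂ hJ _ fun j hj => ?_
    have h0 : (r₂ * a₁ - r₁ * a₂) • ι = 0 := by
      linear_combination (norm := module) r₂ • ha₁ - r₁ • ha₂
    rw [← Ideal.Quotient.eq_zero_iff_mem, ← hιm _ ⟨j, hj⟩, h0]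
    rfl
  obtain ⟨w, hw⟩ := hreg2 (φ.f a₁) (φ.f a₂) (by
    rw [← sub_eq_zero, ← map_mul, ← map_mul, ← map_sub, φ.zero]
    exact ⟨1, h1Q', by rwa [one_mul]⟩)
  obtain ⟨b, s, hs, hb⟩ := φ.frac w
  obtain ⟨s', hs', hb'⟩ := (φ.zero (s * a₁ - r₁ * b)).1 (by
    rw [map_sub, map_mul, map_mul, hw, ← hb]; ring)
  let h : ((J ⧸ Submodule.comap J.subtype (Ideal.ofList z)) →ₗ[S] (S ⧸ Ideal.ofList z)) := (s' * s) • g - (s' * b) • ι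
  have hr₁h : r₁ • h = 0 := by
    have : r₁ • h = (s' * (s * a₁ - r₁ * b)) • ι := by
      simp only [h]
      linear_combination (norm := module) (-(s' * s)) • ha₁
    rw [this, hIH _ hb']
  have hss : s' * s ∉ Q := fun h => (hQ.mem_or_mem h).elim hs' hs
  by_cases hex : ∃ σ ∉ Q, ∀ m : (J ⧸ Submodule.comap J.subtype (Ideal.ofList z)), σ • m ∈ LinearMap.ker h
  · obtain ⟨σ, hσ, hker⟩ := hex
    have h0 : σ • h = 0 := by
      refine LinearMap.ext fun m => ?_
      rw [LinearMap.smul_apply, ← map_smul]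
      exact hker m
    refine (fun h => (hQ.mem_or_mem h).elim hσ hss : σ * (s' * s) ∉ Q) ((hg _).2 ⟨σ * (s' * b), ?_⟩)
    simp only [h] at h0
    linear_combination (norm := module) (-1 : S) • h0
  · have hex' : ∃ m : (J ⧸ Submodule.comap J.subtype (Ideal.ofList z)), ∀ σ : S, σ • h m = 0 → σ ∈ Q := by
      by_contra hcon
      push Not at hcon
      refine hex (exists_notMem_of_forall Q (LinearMap.ker h) fun m => ?_)
      obtain ⟨σ, h1, h2⟩ := hcon m
      exact ⟨σ, h2, by rw [LinearMap.mem_ker, map_smul, h1]⟩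
    obtain ⟨m, hm⟩ := hex'
    obtain ⟨Q', hQ', hmQ', hQ'Q⟩ := exists_assP (h m) Q hm
    have hr₁Q' : r₁ ∈ Q' := hmQ' r₁ (by rw [← LinearMap.smul_apply, hr₁h]; rfl)
    have hIQ' : I ≤ Q' := fun i hi => hmQ' i (by rw [← LinearMap.smul_apply, hIH i hi]; rfl)
    have hhQ' : Q'.height = z.length := height_eq_of_assP hcm z hz hQ'
    have := hQ'.1
    obtain ⟨Q₂, ⟨hQ₂, y, hy⟩, hIQ₂, hle⟩ := exists_assP (M := S ⧸ I) (Ideal.Quotient.mk I 1) Q'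
      (fun r hr => hIQ' (by
        rw [← Ideal.Quotient.eq_zero_iff_mem]
        simpa [Algebra.smul_def] using hr))
    have hIQ₂' : I ≤ Q₂ := fun i hi => hIQ₂ i (by
      rw [Algebra.smul_def, map_one, mul_one]; exact Ideal.Quotient.eq_zero_iff_mem.2 hi)
    have heq : Q₂ = Q' := by
      by_contra hne
      have h3 := height_add_one_le hQ₂ hQ'.1 (lt_of_le_of_ne hle hne)
      rw [hhQ'] at h3
      have h4 := (add_le_add_left (h₂ Q₂ hQ₂ hIQ₂') 1).trans h3
      norm_cast at h4
      omega
    subst heq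
    obtain ⟨y, rfl⟩ := Ideal.Quotient.mk_surjective y
    replace hy : ∀ r, r ∈ Q₂ ↔ r * y ∈ I := fun r => (hy r).trans Ideal.Quotient.eq_zero_iff_mem
    have h1 : φ.f y = 0 := hreg1 _ (by
      rw [← map_mul, φ.zero]
      exact ⟨1, h1Q', by rw [one_mul]; exact (hy r₁).1 hr₁Q'⟩)
    obtain ⟨σ, hσ, h2⟩ := (φ.zero y).1 h1
    exact hσ (hQ'Q ((hy σ).2 h2))

end ExtTools

namespace ExtTools
open CategoryTheory Abelian CMTools RingTheory.Sequence Pointwise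

section Chi

variable {S : Type u} [CommRing S] {X : Type u} [AddCommGroup X] [Module S X] {a b c : ℕ}

/-- The map on powers of `X` induced by a matrix over `S`. -/
def powMap (X : Type u) [AddCommGroup X] [Module S X] (φ : (Fin b → S) →ₗ[S] (Fin a → S)) :
    (Fin b → X) →ₗ[S] (Fin a → X) :=
  LinearMap.pi fun i => ∑ j, φ (Pi.single j 1) i • LinearMap.proj j

lemma powMap_apply (φ : (Fin b → S) →ₗ[S] (Fin a → S)) (ξ : Fin b → X) (i : Fin a) :
    powMap X φ ξ i = ∑ j, φ (Pi.single j 1) i • ξ j := by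
  simp [powMap]

lemma sum_smul_single (v : Fin b → S) : v = ∑ j, v j • (Pi.single j (1 : S) : Fin b → S) := by
  funext i
  simp [Finset.sum_apply, Pi.single_apply]

/-- The character of `X ^ b` corresponding to a map from `S ^ b` to the characters of `X`. -/
def chi (g : (Fin b → S) →ₗ[S] CharacterModule X) : CharacterModule (Fin b → X) :=
  AddMonoidHom.mk' (fun ξ => ∑ j, g (Pi.single j 1) (ξ j)) (fun ξ η => by
    simp [Finset.sum_add_distrib])

lemma chi_apply (g : (Fin b → S) →ₗ[S] CharacterModule X) (ξ : Fin b → X) :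
    chi g ξ = ∑ j, g (Pi.single j 1) (ξ j) := rfl

lemma charSum_apply {ι : Type*} (s : Finset ι) (f : ι → CharacterModule X) (x : X) :
    (∑ i ∈ s, f i) x = ∑ i ∈ s, f i x := by
  classical
  induction s using Finset.induction_on with
  | empty => rfl
  | insert i s hi ih => rw [Finset.sum_insert hi, Finset.sum_insert hi, ← ih]; rfl

lemma chi_ev (g : (Fin b → S) →ₗ[S] CharacterModule X) (v : Fin b → S) (x : X) :
    g v x = chi g (fun j => v j • x) := by
  conv_lhs => rw [sum_smul_single v]
  rw [map_sum, charSum_apply, chi_apply]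
  refine Finset.sum_congr rfl fun j _ => ?_
  rw [map_smul, CharacterModule.smul_apply]

lemma chi_comp (g : (Fin b → S) →ₗ[S] CharacterModule X) (φ : (Fin c → S) →ₗ[S] (Fin b → S))
    (θ : Fin c → X) : chi g (powMap X φ θ) = chi (g.comp φ) θ := by
  rw [chi_apply, chi_apply]
  simp only [powMap_apply, map_sum, LinearMap.comp_apply]
  rw [Finset.sum_comm]
  refine Finset.sum_congr rfl fun k _ => ?_
  rw [chi_ev, chi_apply]

lemma chi_surj (χ : CharacterModule (Fin b → X)) :
    ∃ g : (Fin b → S) →ₗ[S] CharacterModule X, chi g = χ := by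
  classical
  let g : (Fin b → S) →ₗ[S] CharacterModule X :=
    { toFun := fun v => AddMonoidHom.mk' (fun x => χ (fun j => v j • x)) (fun x y => by
        rw [← map_add]; congr 1; funext j; simp)
      map_add' := fun v w => by
        ext x
        change χ _ = χ _ + χ _
        rw [← map_add]; congr 1; funext j; simp [add_smul]
      map_smul' := fun r v => by
        ext x
        change χ _ = χ _
        congr 1; funext j
        rw [Pi.smul_apply, smul_eq_mul, RingHom.id_apply, mul_comm, mul_smul]; rfl }
  refine ⟨g, ?_⟩
  ext ξ
  rw [chi_apply]
  change ∑ j, χ _ = _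
  rw [← map_sum]
  congr 1
  funext i
  simp [Finset.sum_apply, Pi.single_apply, ite_smul]

lemma chi_smul (r : S) (g : (Fin b → S) →ₗ[S] CharacterModule X) (ξ : Fin b → X) :
    chi (r • g) ξ = chi g (r • ξ) := rfl

/-- A character vanishing on the kernel of a map extends along it. -/
lemma exists_character_extend {M M' : Type u} [AddCommGroup M] [Module S M] [AddCommGroup M']
    [Module S M'] (f : M →ₗ[S] M') (χ : CharacterModule M) (h : ∀ m, f m = 0 → χ m = 0) :
    ∃ χ' : CharacterModule M', ∀ m, χ' (f m) = χ m := by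
  let χ₁ : CharacterModule (M ⧸ LinearMap.ker f) :=
    QuotientAddGroup.lift (LinearMap.ker f).toAddSubgroup χ (fun m hm => h m hm)
  have hinj : Function.Injective ((LinearMap.ker f).liftQ f le_rfl) := by
    rw [← LinearMap.ker_eq_bot]
    exact Submodule.ker_liftQ_eq_bot _ _ _ le_rfl
  obtain ⟨χ', hχ'⟩ := CharacterModule.dual_surjective_of_injective _ hinj χ₁
  refine ⟨χ', fun m => ?_⟩
  exact DFunLike.congr_fun hχ' (Submodule.Quotient.mk m)

/-- A character separating a point from a submodule. -/
lemma exists_character_ne {M : Type u} [AddCommGroup M] [Module S M] (B : Submodule S M) (m : M)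
    (h : m ∉ B) : ∃ χ : CharacterModule M, (∀ b ∈ B, χ b = 0) ∧ χ m ≠ 0 := by
  obtain ⟨χ, hχ⟩ := CharacterModule.exists_character_apply_ne_zero_of_ne_zero
    (a := (Submodule.Quotient.mk m : M ⧸ B)) (by rwa [Ne, Submodule.Quotient.mk_eq_zero])
  refine ⟨CharacterModule.dual B.mkQ χ, fun b hb => ?_, hχ⟩
  change χ (Submodule.Quotient.mk b) = 0
  rw [(Submodule.Quotient.mk_eq_zero B).2 hb, map_zero]

/-- Nakayama's lemma for the homology of matrix complexes on `X`. -/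
def NakProp (X : Type u) [AddCommGroup X] [Module S X] (y : S) : Prop :=
  ∀ (a b c : ℕ) (φ : (Fin b → S) →ₗ[S] (Fin a → S)) (α : (Fin c → S) →ₗ[S] (Fin b → S)),
    (∀ ζ, powMap X φ ζ = 0 → ∃ η θ, powMap X φ η = 0 ∧ ζ = y • η + powMap X α θ) →
    ∀ ζ, powMap X φ ζ = 0 → ∃ θ, ζ = powMap X α θ

theorem ext_one_eq_zero [IsNoetherianRing S] {y : S} (hX : NakProp X y)
    (N : Type u) [AddCommGroup N] [Module S N] [Module.Finite S N]
    (h : ∀ e : EX S N (CharacterModule X) 1, y • e = 0 → e = 0)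
    (e : EX S N (CharacterModule X) 1) : e = 0 := by
  obtain ⟨a, p, hp⟩ := Module.Finite.exists_fin' S N
  obtain ⟨b, q, hq⟩ := Module.Finite.exists_fin' S (LinearMap.ker p)
  obtain ⟨c, r, hr⟩ := Module.Finite.exists_fin' S (LinearMap.ker q)
  let ι := (LinearMap.ker p).subtype
  let φ := ι.comp q
  let α := (LinearMap.ker q).subtype.comp r
  have hex : Function.Exact ι p := by
    rw [LinearMap.exact_iff]; simp [ι]
  have hι : Function.Injective ι := Submodule.subtype_injective _
  obtain ⟨-, δ, h1, h2⟩ := contra_les hι hex hp (CharacterModule X) 0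
  have hδ : ∀ e, ∃ e', δ e' = e := fun e => (h2 e).1 (eq_zero_of_projective 0 _)
  let cl (f : LinearMap.ker p →ₗ[S] CharacterModule X) : EX S (LinearMap.ker p) (CharacterModule X) 0 :=
    Ext.mk₀ (ModuleCat.ofHom f)
  have hqα : q.comp α = 0 := by
    ext1
    exact LinearMap.ext fun v => (r _).2
  have c0 : ∀ (f : LinearMap.ker p →ₗ[S] CharacterModule X) θ, chi (f.comp q) (powMap X α θ) = 0 := by
    intro f θ
    rw [chi_comp, LinearMap.comp_assoc, hqα, LinearMap.comp_zero, chi_apply]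
    exact Finset.sum_eq_zero fun _ _ => rfl
  have c1 : ∀ f : LinearMap.ker p →ₗ[S] CharacterModule X, δ (cl f) = 0 →
      ∀ ζ, powMap X φ ζ = 0 → chi (f.comp q) ζ = 0 := by
    intro f hf ζ hζ
    obtain ⟨g, hg⟩ := (h1 _).1 hf
    obtain ⟨g, rfl⟩ := mk0_surj g
    rw [pre_mk0] at hg
    have h3 := mk0_inj hg
    rw [← h3, LinearMap.comp_assoc, ← chi_comp, hζ, map_zero]
  have c2 : ∀ f : LinearMap.ker p →ₗ[S] CharacterModule X,
      (∀ ζ, powMap X φ ζ = 0 → chi (f.comp q) ζ = 0) → δ (cl f) = 0 := by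
    intro f hf
    obtain ⟨γ, hγ⟩ := exists_character_extend (powMap X φ) (chi (f.comp q)) hf
    obtain ⟨g, rfl⟩ := chi_surj (S := S) γ
    refine (h1 _).2 ⟨Ext.mk₀ (ModuleCat.ofHom g), ?_⟩
    rw [pre_mk0]
    congr 2
    ext k x
    obtain ⟨v, rfl⟩ := hq k
    have h3 : g (φ v) x = f (q v) x := by
      change (g.comp φ) v x = (f.comp q) v x
      rw [chi_ev, chi_ev, ← hγ, chi_comp]
    exact h3
  have hZ : ∀ ζ, powMap X φ ζ = 0 → ∃ θ, ζ = powMap X α θ := by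
    refine hX a b c φ α fun ζ hζ => ?_
    by_contra hno
    let B : Submodule S (Fin b → X) :=
      (LinearMap.ker (powMap X φ)).map (LinearMap.lsmul S _ y) ⊔ LinearMap.range (powMap X α)
    have hζB : ζ ∉ B := by
      intro hmem
      obtain ⟨_, ⟨η, hη, rfl⟩, _, ⟨θ, rfl⟩, hsum⟩ := Submodule.mem_sup.1 hmem
      exact hno ⟨η, θ, hη, hsum.symm⟩
    obtain ⟨χ, hχB, hχ⟩ := exists_character_ne B ζ hζB
    obtain ⟨g, rfl⟩ := chi_surj (S := S) χ
    have hker : LinearMap.ker q ≤ LinearMap.ker g := by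
      intro v hv
      obtain ⟨w, hw⟩ := hr ⟨v, hv⟩
      have hw' : α w = v := congrArg Subtype.val hw
      rw [LinearMap.mem_ker]
      ext x
      rw [← hw']
      change (g.comp α) w x = 0
      rw [chi_ev, ← chi_comp]
      exact hχB _ (Submodule.mem_sup_right ⟨_, rfl⟩)
    obtain ⟨f, hf⟩ : ∃ f : LinearMap.ker p →ₗ[S] CharacterModule X, f.comp q = g := by
      refine ⟨((LinearMap.ker q).liftQ g hker).comp (q.quotKerEquivOfSurjective hq).symm.toLinearMap, ?_⟩
      ext1
      refine LinearMap.ext fun v => ?_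
      simp only [LinearMap.comp_apply, LinearEquiv.coe_coe]
      have : (q.quotKerEquivOfSurjective hq).symm (q (LinearMap.single S (fun _ => S) ‹_› v)) =
          Submodule.Quotient.mk (LinearMap.single S (fun _ => S) ‹_› v) := by
        rw [LinearEquiv.symm_apply_eq]; rfl
      rw [this]; rfl
    have h5 : δ (cl f) = 0 := by
      refine h _ ?_
      rw [← map_smul]
      change δ (y • Ext.mk₀ (ModuleCat.ofHom f)) = 0
      rw [smul_mk0]
      refine c2 (y • f) fun η hη => ?_
      rw [LinearMap.smul_comp, chi_smul, hf]
      exact hχB _ (Submodule.mem_sup_left ⟨η, hη, rfl⟩)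
    exact hχ (hf ▸ c1 f h5 ζ hζ)
  obtain ⟨e', rfl⟩ := hδ e
  obtain ⟨f, rfl⟩ := mk0_surj e'
  refine c2 f fun ζ hζ => ?_
  obtain ⟨θ, rfl⟩ := hZ ζ hζ
  exact c0 f θ

theorem ext_succ_eq_zero [IsNoetherianRing S] {y : S} (hX : NakProp X y) (i : ℕ)
    (N : Type u) [AddCommGroup N] [Module S N] [Module.Finite S N]
    (h : ∀ e : EX S N (CharacterModule X) (i + 1), y • e = 0 → e = 0)
    (e : EX S N (CharacterModule X) (i + 1)) : e = 0 := by
  induction i generalizing N with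
  | zero => exact ext_one_eq_zero hX N h e
  | succ i ih =>
    obtain ⟨a, p, hp⟩ := Module.Finite.exists_fin' S N
    have hex : Function.Exact (LinearMap.ker p).subtype p := by
      rw [LinearMap.exact_iff]; simp
    obtain ⟨-, δ, h1, h2⟩ := contra_les (Submodule.subtype_injective _) hex hp
      (CharacterModule X) (i + 1)
    have hinj : ∀ e, δ e = 0 → e = 0 := fun e he => by
      obtain ⟨e', rfl⟩ := (h1 e).1 he
      rw [eq_zero_of_projective i e', map_zero]
    obtain ⟨e', rfl⟩ := (h2 e).1 (eq_zero_of_projective _ _)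
    rw [ih (LinearMap.ker p) (fun e he => hinj e (h _ (by rw [← map_smul, he, map_zero]))) e',
      map_zero]

end Chi

section Vanishing

variable {S : Type u} [CommRing S]

/-- A regular sequence on `X` of length `r` kills `Ext` of the residue field into the
characters of `X` in degrees above `n - r`. -/
theorem ext_residue_eq_zero (x : List S) (hx : IsWeaklyRegular S x) (w : List S)
    (hw : ∀ r ∈ w, r ∈ Ideal.ofList x) (X : Type u) [AddCommGroup X] [Module S X]
    (hX : IsWeaklyRegular X w) (i : ℕ) (hi : x.length < i + w.length)
    (e : EX S (S ⧸ Ideal.ofList x) (CharacterModule X) i) : e = 0 := by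
  induction w generalizing X i with
  | nil => exact ext_ofList_eq_zero x hx i (by simpa using hi) e
  | cons r w ih =>
    obtain ⟨h1, h2⟩ := (isWeaklyRegular_cons_iff X r w).1 hX
    let m : X →ₗ[S] X := LinearMap.lsmul S X r
    let π : X →ₗ[S] QuotSMulTop r X := Submodule.mkQ _
    have hπ : Function.Surjective π := Submodule.mkQ_surjective _
    have hex : Function.Exact (CharacterModule.dual π) (CharacterModule.dual m) := by
      intro χ
      constructor
      · intro hχ
        obtain ⟨χ', h⟩ := exists_character_extend π χ (fun x hx => by
          obtain ⟨x', -, rfl⟩ := (Submodule.mem_smul_pointwise_iff_exists _ _ _).1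
            ((Submodule.Quotient.mk_eq_zero _).1 hx)
          exact DFunLike.congr_fun hχ x')
        exact ⟨χ', CharacterModule.ext _ h⟩
      · rintro ⟨χ, rfl⟩
        refine CharacterModule.ext _ fun x => ?_
        change χ (Submodule.Quotient.mk (r • x)) = 0
        rw [(Submodule.Quotient.mk_eq_zero _).2, map_zero]
        exact Submodule.smul_mem_pointwise_smul _ _ _ trivial
    obtain ⟨-, δ, d1, d2, -⟩ := co_les (CharacterModule.dual_injective_of_surjective π hπ) hex
      (CharacterModule.dual_surjective_of_injective m h1) i
    have hz : ∀ e' : EX S (S ⧸ Ideal.ofList x) (CharacterModule X) i,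
        post (S ⧸ Ideal.ofList x) i (CharacterModule.dual m) e' = 0 := by
      intro e'
      have : CharacterModule.dual m = r • (LinearMap.id : CharacterModule X →ₗ[S] CharacterModule X) := rfl
      rw [this, post_smul, post_id]
      exact smul_eq_zero_of_left i r (fun n => by
        obtain ⟨n, rfl⟩ := Ideal.Quotient.mk_surjective n
        exact Ideal.Quotient.eq_zero_iff_mem.2
          (Ideal.mul_mem_right _ _ (hw r (by simp)))) e'
    have h4 := ih (fun s hs => hw s (by simp [hs])) _ h2 (i + 1)
      (by simp only [List.length_cons] at hi; omega) (δ (ModuleCat.of S _) e)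
    obtain ⟨e', rfl⟩ := (d1 (ModuleCat.of S _) e).1 h4
    exact hz e'

theorem ext_character_eq_zero [IsLocalRing S] [IsNoetherianRing S] (x : List S)
    (hx : IsWeaklyRegular S x) (hxm : Ideal.ofList x = maximalIdeal S) (w : List S)
    (hw : ∀ r ∈ w, r ∈ maximalIdeal S) (X : Type u) [AddCommGroup X] [Module S X]
    (hX : IsWeaklyRegular X w) (hN : ∀ y ∈ maximalIdeal S, NakProp X y) (i : ℕ)
    (hi : x.length < i + 1 + w.length) (N : Type u) [AddCommGroup N] [Module S N]
    [Module.Finite S N] (e : EX S N (CharacterModule X) (i + 1)) : e = 0 := by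
  have hu : ∀ s ∉ maximalIdeal S, IsUnit s := fun s hs => by simpa using hs
  have hone : (1 : S) ∉ maximalIdeal S := fun h =>
    (Ideal.IsPrime.ne_top inferInstance) ((Ideal.eq_top_iff_one _).2 h)
  have key := vanAt_of_base (Y := CharacterModule X) (maximalIdeal S) (x.length - w.length)
    (fun N _ _ _ j y hj hy s hs h1 _ => by
      obtain ⟨j, rfl⟩ : ∃ k, j = k + 1 := ⟨j - 1, by omega⟩
      refine ⟨1, hone, fun e => ?_⟩
      rw [ext_succ_eq_zero (hN y hy) j N (fun e he => ?_) e, smul_zero]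
      exact (hu s hs).smul_eq_zero.1 (h1 e he))
    (by
      intro j hj
      refine ⟨1, hone, fun e => ?_⟩
      revert e
      rw [← hxm]
      intro e
      rw [ext_residue_eq_zero x hx w (by rwa [hxm]) X hX j (by omega) e, smul_zero]) N
  obtain ⟨s, hs, h⟩ := key (i + 1) (by omega)
  exact (hu s hs).smul_eq_zero.1 (h e)

end Vanishing

end ExtTools

namespace ExtTools
open CategoryTheory Abelian CMTools RingTheory.Sequence Pointwise

/-- A presentation of an `S`-algebra `X` as an ultraproduct-like quotient of a product of
rings, along a filter; `φ` lifts the structure map. -/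
structure GermPres {S : Type u} [CommRing S] (X : Type u) [CommRing X] [Algebra S X]
    {ι : Type u} (l : Filter ι) (T : ι → Type u) [∀ C, CommRing (T C)] where
  π : (∀ C, T C) →+* X
  surj : Function.Surjective π
  eq_zero : ∀ f, π f = 0 ↔ ∀ᶠ C in l, f C = 0
  φ : S → ∀ C, T C
  φ_eq : ∀ s, π (φ s) = algebraMap S X s

namespace GermPres

variable {S : Type u} [CommRing S] {X : Type u} [CommRing X] [Algebra S X]
    {ι : Type u} {l : Filter ι} {T : ι → Type u} [∀ C, CommRing (T C)]
    (G : GermPres (S := S) X l T)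

include G

lemma eq_iff (f g : ∀ C, T C) : G.π f = G.π g ↔ ∀ᶠ C in l, f C = g C := by
  rw [← sub_eq_zero, ← map_sub, G.eq_zero]
  simp only [Pi.sub_apply, sub_eq_zero]

lemma smul_eq (s : S) (f : ∀ C, T C) : s • G.π f = G.π (G.φ s * f) := by
  rw [map_mul, G.φ_eq, Algebra.smul_def]

lemma nakProp [∀ C, IsLocalRing (T C)] [∀ C, IsNoetherianRing (T C)] (y : S)
    (hy : ∀ᶠ C in l, G.φ y C ∈ maximalIdeal (T C)) : NakProp X y := by
  classical
  intro a b c φ α h ζ hζ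
  let D (C : ι) : (Fin b → T C) →ₗ[T C] (Fin a → T C) :=
    LinearMap.pi fun i => ∑ j, G.φ (φ (Pi.single j 1) i) C • LinearMap.proj j
  let A (C : ι) : (Fin c → T C) →ₗ[T C] (Fin b → T C) :=
    LinearMap.pi fun i => ∑ j, G.φ (α (Pi.single j 1) i) C • LinearMap.proj j
  have hD : ∀ (z : Fin b → ∀ C, T C) (i),
      powMap X φ (fun j => G.π (z j)) i = G.π (fun C => D C (fun j => z j C) i) := by
    intro z i
    rw [powMap_apply]
    simp only [G.smul_eq]
    rw [← map_sum]
    congr 1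
    funext C
    simp [D, Finset.sum_apply]
  have hA : ∀ (z : Fin c → ∀ C, T C) (i),
      powMap X α (fun j => G.π (z j)) i = G.π (fun C => A C (fun j => z j C) i) := by
    intro z i
    rw [powMap_apply]
    simp only [G.smul_eq]
    rw [← map_sum]
    congr 1
    funext C
    simp [A, Finset.sum_apply]
  choose lift hlift using G.surj
  have hD0 : ∀ z : Fin b → ∀ C, T C, powMap X φ (fun j => G.π (z j)) = 0 →
      ∀ᶠ C in l, D C (fun j => z j C) = 0 := by
    intro z hz
    have : ∀ i, ∀ᶠ C in l, D C (fun j => z j C) i = 0 := fun i => by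
      rw [← G.eq_zero, ← hD, hz]; rfl
    filter_upwards [Filter.eventually_all.2 this] with C hC
    exact funext hC
  obtain ⟨z, hz⟩ : ∃ z : Fin b → ∀ C, T C, (fun j => G.π (z j)) = ζ :=
    ⟨fun j => lift (ζ j), funext fun j => hlift _⟩
  subst hz
  have hz0 := hD0 z hζ
  by_contra hno
  have hfreq : ∃ᶠ C in l, (fun j => z j C) ∉ LinearMap.range (A C) := by
    intro hev
    simp only [not_not] at hev
    have : ∀ C, ∃ θ : Fin c → T C, (fun j => z j C) ∈ LinearMap.range (A C) →
        A C θ = fun j => z j C := fun C => by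
      by_cases hC : (fun j => z j C) ∈ LinearMap.range (A C)
      · obtain ⟨θ, hθ⟩ := hC
        exact ⟨θ, fun _ => hθ⟩
      · exact ⟨0, fun h => absurd h hC⟩
    choose θ hθ using this
    refine hno ⟨fun k => G.π (fun C => θ C k), ?_⟩
    funext i
    rw [hA, G.eq_iff]
    filter_upwards [hev] with C hC
    exact (congrFun (hθ C hC) i).symm
  have hpick : ∀ C, ∃ v : Fin b → T C, D C v = 0 ∧
      (D C (fun j => z j C) = 0 → (fun j => z j C) ∉ LinearMap.range (A C) →
        G.φ y C ∈ maximalIdeal (T C) →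
        ∀ η θ, D C η = 0 → v ≠ G.φ y C • η + A C θ) := by
    intro C
    by_cases hC : D C (fun j => z j C) = 0 ∧ (fun j => z j C) ∉ LinearMap.range (A C) ∧
        G.φ y C ∈ maximalIdeal (T C)
    · by_contra hv
      push Not at hv
      refine hC.2.1 ?_
      refine Submodule.le_of_le_smul_of_le_jacobson_bot (I := Ideal.span {G.φ y C})
        (N' := LinearMap.ker (D C)) (IsNoetherian.noetherian _) ?_ ?_ hC.1
      · rw [IsLocalRing.jacobson_eq_maximalIdeal ⊥ bot_ne_top, Ideal.span_le]
        simpa using hC.2.2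
      · intro v hvk
        obtain ⟨-, -, -, η, θ, hη, rfl⟩ := hv v hvk
        rw [add_comm]
        exact Submodule.add_mem_sup ⟨θ, rfl⟩
          (Submodule.smul_mem_smul (Ideal.mem_span_singleton_self _) hη)
    · exact ⟨0, map_zero _, fun h1 h2 h3 => absurd ⟨h1, h2, h3⟩ hC⟩
  choose v hv0 hv using hpick
  obtain ⟨η, θ, hη, hsum⟩ := h (fun j => G.π (fun C => v C j)) (by
    funext i
    rw [hD]
    change _ = (0 : X)
    rw [G.eq_zero]
    exact Filter.Eventually.of_forall fun C => by
      change D C (v C) i = 0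
      rw [hv0]; rfl)
  obtain ⟨e, he⟩ : ∃ e : Fin b → ∀ C, T C, (fun j => G.π (e j)) = η :=
    ⟨fun j => lift (η j), funext fun j => hlift _⟩
  obtain ⟨t, ht⟩ : ∃ e : Fin c → ∀ C, T C, (fun j => G.π (e j)) = θ :=
    ⟨fun j => lift (θ j), funext fun j => hlift _⟩
  subst he
  subst ht
  have h1 := hD0 e hη
  have h2 : ∀ᶠ C in l, v C = G.φ y C • (fun j => e j C) + A C (fun j => t j C) := by
    have : ∀ j, ∀ᶠ C in l, v C j = G.φ y C * e j C + A C (fun j => t j C) j := fun j => by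
      have := congrFun hsum j
      rw [Pi.add_apply, Pi.smul_apply, hA, G.smul_eq, ← map_add, G.eq_iff] at this
      exact this
    filter_upwards [Filter.eventually_all.2 this] with C hC
    exact funext hC
  obtain ⟨C, hC, h3, h4, h5, h6⟩ := (hfreq.and_eventually
    (h1.and (h2.and (hz0.and hy)))).exists
  exact hv C h5 hC h6 _ _ h3 h4

lemma eventually_sum_mul (w : List S) (i : ℕ) (f : ∀ C, T C) :
    G.π f ∈ Ideal.ofList (w.take i) • (⊤ : Submodule S X) ↔
      ∀ᶠ C in l, f C ∈ Ideal.ofList ((w.take i).map fun s => G.φ s C) := by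
  classical
  generalize w.take i = w
  induction w generalizing f with
  | nil => simp [G.eq_zero]
  | cons s w ih =>
    constructor
    · intro h
      rw [Ideal.ofList_cons, Submodule.sup_smul, Submodule.mem_sup] at h
      obtain ⟨u, hu, v, hv, huv⟩ := h
      rw [Submodule.ideal_span_singleton_smul] at hu
      obtain ⟨u, -, rfl⟩ := (Submodule.mem_smul_pointwise_iff_exists _ _ _).1 hu
      obtain ⟨u, rfl⟩ := G.surj u
      obtain ⟨v, rfl⟩ := G.surj v
      rw [G.smul_eq, ← map_add, G.eq_iff] at huv
      filter_upwards [huv, (ih v).1 hv] with C h1 h2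
      rw [List.map_cons, Ideal.ofList_cons, ← h1]
      exact Submodule.add_mem_sup (Ideal.mul_mem_right _ _ (Ideal.mem_span_singleton_self _)) h2
    · intro h
      have : ∀ C, ∃ u v : T C, f C ∈ Ideal.ofList ((s :: w).map fun s => G.φ s C) →
          (f C = G.φ s C * u + v ∧ v ∈ Ideal.ofList (w.map fun s => G.φ s C)) := fun C => by
        by_cases hC : f C ∈ Ideal.ofList ((s :: w).map fun s => G.φ s C)
        · have hC' := hC
          rw [List.map_cons, Ideal.ofList_cons] at hC
          obtain ⟨u, hu, v, hv, huv⟩ := Submodule.mem_sup.1 hC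
          obtain ⟨u, rfl⟩ := Ideal.mem_span_singleton.1 hu
          exact ⟨u, v, fun _ => ⟨huv.symm, hv⟩⟩
        · exact ⟨0, 0, fun h => absurd h hC⟩
      choose u v huv using this
      have h1 : G.π f = s • G.π u + G.π v := by
        rw [G.smul_eq, ← map_add, G.eq_iff]
        filter_upwards [h] with C hC
        exact (huv C hC).1
      rw [h1, Ideal.ofList_cons, Submodule.sup_smul]
      refine Submodule.add_mem_sup (Submodule.smul_mem_smul
        (Ideal.mem_span_singleton_self _) trivial) ((ih v).2 ?_)
      filter_upwards [h] with C hC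
      exact (huv C hC).2

lemma isWeaklyRegular (w : List S)
    (hw : ∀ᶠ C in l, IsWeaklyRegular (T C) (w.map fun s => G.φ s C)) :
    IsWeaklyRegular X w := by
  refine ⟨fun i hi => ?_⟩
  rw [isSMulRegular_quotient_iff_mem_of_smul_mem]
  intro x hx
  obtain ⟨f, rfl⟩ := G.surj x
  rw [G.smul_eq, G.eventually_sum_mul] at hx
  rw [G.eventually_sum_mul]
  filter_upwards [hx, hw] with C h1 h2
  have h3 := h2.regular_mod_prev i (by simpa using hi)
  rw [isSMulRegular_quotient_iff_mem_of_smul_mem, ← List.map_take, smul_eq_mul,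
    Ideal.mul_top] at h3
  exact h3 _ (by simpa using h1)

lemma notMem_smul_top [IsLocalRing S] (x : List S) (hxm : Ideal.ofList x = maximalIdeal S)
    (f : ∀ C, T C) (hf : ∃ᶠ C in l, f C ∉ Ideal.ofList (x.map fun s => G.φ s C)) :
    G.π f ∉ maximalIdeal S • (⊤ : Submodule S X) := by
  intro h
  rw [← hxm, ← List.take_length (l := x), G.eventually_sum_mul, List.take_length] at h
  exact hf (h.mono fun _ h => not_not.2 h)

end GermPres

/-- The module used to detect the top component of a comparison map: it has an element
`ξ ∉ 𝔪 X` killed by `J`, and small flat dimension. -/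
def HasTestModule (S : Type u) [CommRing S] [IsLocalRing S] (J : Ideal S) (t : ℕ) : Prop :=
  ∃ (X : Type u) (_ : AddCommGroup X) (_ : Module S X) (ξ : X), (∀ j ∈ J, j • ξ = 0) ∧
    ξ ∉ maximalIdeal S • (⊤ : Submodule S X) ∧
    ∀ N : ModuleCat.{u} S, Module.Finite S N → ∀ e : EX S N (CharacterModule X) (t + 1), e = 0

theorem hasTestModule_of_germ {S : Type u} [CommRing S] [IsLocalRing S] [IsNoetherianRing S]
    (x : List S) (hx : IsWeaklyRegular S x) (hxm : Ideal.ofList x = maximalIdeal S)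
    (J : Ideal S) {ι : Type u} (l : Filter ι) (T : ι → Type u) [∀ C, CommRing (T C)]
    [∀ C, IsLocalRing (T C)] [∀ C, IsNoetherianRing (T C)] (φ : S → ∀ C, T C)
    (hadd : ∀ a b, ∀ᶠ C in l, φ (a + b) C = φ a C + φ b C)
    (hmul : ∀ a b, ∀ᶠ C in l, φ (a * b) C = φ a C * φ b C)
    (hone : ∀ᶠ C in l, φ 1 C = 1) (hloc : ∀ y ∈ maximalIdeal S, ∀ᶠ C in l, φ y C ∈ maximalIdeal (T C))
    (w : List S) (hw : ∀ r ∈ w, r ∈ maximalIdeal S)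
    (hwr : ∀ᶠ C in l, IsWeaklyRegular (T C) (w.map fun s => φ s C))
    (f : ∀ C, T C) (hf : ∃ᶠ C in l, f C ∉ Ideal.ofList (x.map fun s => φ s C))
    (hJ : ∀ j ∈ J, ∀ᶠ C in l, φ j C * f C = 0) (t : ℕ) (ht : x.length < t + 1 + w.length) :
    HasTestModule S J t := by
  let 𝔑 : Ideal (∀ C, T C) :=
    { carrier := {f | ∀ᶠ C in l, f C = 0}
      add_mem' := fun {a b} ha hb => by
        filter_upwards [ha, hb] with C h1 h2
        simp [h1, h2]
      zero_mem' := Filter.Eventually.of_forall fun _ => rfl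
      smul_mem' := fun c a ha => by
        filter_upwards [ha] with C h1
        simp [h1] }
  let X := (∀ C, T C) ⧸ 𝔑
  let π : (∀ C, T C) →+* X := Ideal.Quotient.mk 𝔑
  have hπ0 : ∀ f, π f = 0 ↔ ∀ᶠ C in l, f C = 0 := fun f => Ideal.Quotient.eq_zero_iff_mem
  have hπ : ∀ f g, (∀ᶠ C in l, f C = g C) → π f = π g := fun f g h => by
    rw [← sub_eq_zero, ← map_sub, hπ0]
    simpa only [Pi.sub_apply, sub_eq_zero] using h
  have h1 : π (φ 1) = 1 := by rw [← map_one π]; exact hπ _ _ hone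
  have ha : ∀ a b, π (φ (a + b)) = π (φ a) + π (φ b) := fun a b => by
    rw [← map_add]; exact hπ _ _ (hadd a b)
  let Φ : S →+* X :=
    { toFun := fun s => π (φ s)
      map_one' := h1
      map_mul' := fun a b => by rw [← map_mul]; exact hπ _ _ (hmul a b)
      map_zero' := by simpa using ha 0 0
      map_add' := ha }
  let _ : Algebra S X := Φ.toAlgebra
  let G : GermPres (S := S) X l T := ⟨π, Ideal.Quotient.mk_surjective, hπ0, φ, fun _ => rfl⟩
  refine ⟨X, inferInstance, inferInstance, π f, fun j hj => ?_,
    G.notMem_smul_top x hxm f hf, fun N hN e => ?_⟩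
  · rw [G.smul_eq j f, G.eq_zero]
    exact hJ j hj
  · exact ext_character_eq_zero x hx hxm w hw X (G.isWeaklyRegular w hwr)
      (fun y hy => G.nakProp y (hloc y hy)) t ht N e

end ExtTools

namespace ExtTools
open CategoryTheory Abelian CMTools RingTheory.Sequence Pointwise

variable {S : Type u} [CommRing S] [IsLocalRing S] [IsNoetherianRing S]

/-- A minimal prime over `Q + (p)` has height at most one more than `Q` in a Cohen-Macaulay
local ring. -/
lemma height_le_succ_of_minimal {n : ℕ} (hcm : IsCM S n) {Q Q' : Ideal S} [hQ : Q.IsPrime] (p : S)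
    (hQ' : Q' ∈ (Q ⊔ Ideal.span {p}).minimalPrimes) {d : ℕ} (hd : Q.height ≤ d) :
    Q'.height ≤ (d + 1 : ℕ) := by
  have hQ'p : Q'.IsPrime := hQ'.1.1
  have hle : Q ≤ Q' := le_sup_left.trans hQ'.1.2
  have hp : p ∈ Q' := hQ'.1.2 (Ideal.mem_sup_right (Ideal.mem_span_singleton_self p))
  by_contra hlt
  have hge : (d + 2 : ℕ) ≤ Q'.height := by
    have := Order.add_one_le_of_lt (not_le.1 hlt)
    exact_mod_cast this
  obtain ⟨Q₁, h₁, hlt₁, hlt₂⟩ := exists_between hcm hQ hQ'p hle hd hge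
  let f := Ideal.Quotient.mk Q
  have hpr : ∀ A : Ideal S, A.IsPrime → Q ≤ A → (A.map f).IsPrime := fun A hA hQA => by
    have := hA
    exact Ideal.isPrime_map_quotientMk_of_isPrime hQA
  have hcom : ∀ A : Ideal S, Q ≤ A → (A.map f).comap f = A := fun A hQA => by
    rw [Ideal.comap_map_of_surjective f Ideal.Quotient.mk_surjective, ← RingHom.ker_eq_comap_bot,
      Ideal.mk_ker, sup_eq_left.2 hQA]
  have hlt : ∀ A B : Ideal S, Q ≤ A → A < B → A.map f < B.map f := fun A B hA hAB => by
    refine lt_of_le_not_ge (Ideal.map_mono hAB.le) fun h => hAB.not_ge ?_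
    have := Ideal.comap_mono (f := f) h
    rwa [hcom A hA, hcom B (hA.trans hAB.le)] at this
  have hmin : Q'.map f ∈ (Ideal.span {f p}).minimalPrimes := by
    refine ⟨⟨hpr Q' hQ'p hle, ?_⟩, fun A hA hAQ => ?_⟩
    · rw [Ideal.span_singleton_le_iff_mem]
      exact Ideal.mem_map_of_mem f hp
    · have hAp := hA.1
      rw [Ideal.map_le_iff_le_comap]
      refine hQ'.2 ⟨Ideal.comap_isPrime f A, sup_le ?_ ?_⟩ ?_
      · intro q hq
        rw [Ideal.mem_comap, Ideal.Quotient.eq_zero_iff_mem.2 hq]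
        exact A.zero_mem
      · rw [Ideal.span_singleton_le_iff_mem]
        exact hA.2 (Ideal.mem_span_singleton_self _)
      · have := Ideal.comap_mono (f := f) hAQ
        rwa [hcom Q' hle] at this
  have h1 := Ideal.height_le_one_of_isPrincipal_of_mem_minimalPrimes _ _ hmin
  have h2 := height_add_one_le (hpr Q hQ le_rfl) (hpr Q₁ h₁ hlt₁.le) (hlt _ _ le_rfl hlt₁)
  have h3 := height_add_one_le (hpr Q₁ h₁ hlt₁.le) (hpr Q' hQ'p hle) (hlt _ _ hlt₁.le hlt₂)
  have h4 : (1 : ℕ∞) + 1 ≤ 1 := calc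
    (1 : ℕ∞) + 1 ≤ (Q.map f).height + 1 + 1 := by gcongr; exact le_add_self
    _ ≤ (Q₁.map f).height + 1 := by gcongr
    _ ≤ 1 := h3.trans h1
  norm_num at h4

/-- Frobenius gives a test module modulo a regular sequence containing the prime `p`. -/
theorem hasTestModule_of_frobenius {n : ℕ} (hcm : IsCM S n) (hn : (n : ℕ∞) ≤ (maximalIdeal S).height)
    (x : List S) (hxn : x.length = n) (hx : IsWeaklyRegular S x)
    (hxm : Ideal.ofList x = maximalIdeal S) (J : Ideal S) (p : ℕ) (hp : p.Prime)
    (as : List S) (has : ∀ r ∈ as, r ∈ maximalIdeal S) (hasr : IsWeaklyRegular S as)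
    (hpa : (p : S) ∈ Ideal.ofList as) (u : S) (hu : u ∉ Ideal.ofList as)
    (huJ : ∀ j ∈ J, u * j ∈ Ideal.ofList as) (t : ℕ) (ht : as.length < t + 1) :
    HasTestModule S J t := by
  have hale : Ideal.ofList as ≤ maximalIdeal S := Ideal.span_le.2 has
  have hnt : Ideal.ofList as ≠ ⊤ := fun h =>
    Ideal.IsPrime.ne_top (inferInstance : (maximalIdeal S).IsPrime) (top_le_iff.1 (h ▸ hale))
  let T := S ⧸ Ideal.ofList as
  have : Nontrivial T := Ideal.Quotient.nontrivial_iff.2 hnt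
  have : IsLocalRing T := IsLocalRing.of_surjective' (Ideal.Quotient.mk _) Ideal.Quotient.mk_surjective
  have hmT : ∀ y ∈ maximalIdeal S, Ideal.Quotient.mk (Ideal.ofList as) y ∈ maximalIdeal T := by
    intro y hy
    rw [mem_maximalIdeal, mem_nonunits_iff]
    intro hun
    obtain ⟨v, hv⟩ := hun.exists_right_inv
    obtain ⟨v, rfl⟩ := Ideal.Quotient.mk_surjective v
    rw [← map_mul, ← map_one (Ideal.Quotient.mk (Ideal.ofList as)), Ideal.Quotient.eq] at hv
    have : (1 : S) ∈ maximalIdeal S := by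
      have := (maximalIdeal S).sub_mem (Ideal.mul_mem_right v _ hy) (hale hv)
      simpa only [sub_sub_cancel] using this
    exact Ideal.IsPrime.ne_top (inferInstance : (maximalIdeal S).IsPrime) ((Ideal.eq_top_iff_one _).2 this)
  have hFp : Fact p.Prime := ⟨hp⟩
  have hpT : (p : T) = 0 := by
    have : (p : T) = Ideal.Quotient.mk _ (p : S) := by simp
    rw [this]
    exact Ideal.Quotient.eq_zero_iff_mem.2 hpa
  have hchar : CharP T p := (CharP.charP_iff_prime_eq_zero hp).2 hpT
  obtain ⟨e, he⟩ : ∃ e, u ∉ Ideal.ofList as ⊔ maximalIdeal S ^ e := by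
    by_contra hall
    push Not at hall
    have hH : IsHausdorff (maximalIdeal S) T := IsHausdorff.of_isLocalRing _ _
      (Ideal.IsPrime.ne_top inferInstance)
    refine hu (Ideal.Quotient.eq_zero_iff_mem.1 (hH.haus _ fun k => ?_))
    rw [SModEq.zero]
    obtain ⟨a, ha, b, hb, hab⟩ := Submodule.mem_sup.1 (hall k)
    have : Ideal.Quotient.mk (Ideal.ofList as) u = b • (1 : T) := by
      rw [← hab, map_add, Ideal.Quotient.eq_zero_iff_mem.2 ha, zero_add]
      rw [Algebra.smul_def, mul_one]; rfl
    rw [this]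
    exact Submodule.smul_mem_smul hb trivial
  let q := p ^ e
  have hq0 : q ≠ 0 := pow_ne_zero _ hp.ne_zero
  have hqe : e ≤ q := (Nat.lt_pow_self hp.one_lt).le
  have hCn : (maximalIdeal S).height ≤ (as.length + n : ℕ) :=
    hcm.1.trans (by exact_mod_cast Nat.le_add_left _ _)
  obtain ⟨w, hw, hwr, hwh, hwA⟩ := exists_extend_in hcm (maximalIdeal S) n as
    (by exact_mod_cast hCn) has hasr
  have hlen : as.length + w.length = n := by
    have h1 : (as ++ w).length ≤ n := by exact_mod_cast hwh ▸ hcm.1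
    have h2 : n ≤ (as ++ w).length := by exact_mod_cast hwh ▸ hn
    rw [List.length_append] at h1 h2
    omega
  obtain ⟨hw1, hw2⟩ := (isWeaklyRegular_append_self as w).1 hwr
  obtain ⟨c, hc⟩ : ∃ c, maximalIdeal S ^ c ≤
      Ideal.ofList (w.map (· ^ q)) ⊔ Ideal.ofList as := by
    refine Ideal.exists_pow_le_of_le_radical_of_fg ?_ (IsNoetherian.noetherian _)
    rw [Ideal.radical_eq_sInf]
    refine le_sInf fun P ⟨hP, hPp⟩ => ?_
    have hPas : Ideal.ofList (as ++ w) ≤ P := by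
      rw [Ideal.ofList_append]
      refine sup_le (le_sup_right.trans hP) (Ideal.span_le.2 fun r hr => hPp.mem_of_pow_mem q ?_)
      exact hP (Ideal.mem_sup_left (Ideal.subset_span (List.mem_map.2 ⟨r, hr, rfl⟩)))
    have h3 : ((as ++ w).length : ℕ∞) ≤ P.height :=
      length_le_height (as ++ w) P (fun r hr => hPas (Ideal.subset_span hr)) hwr
    rw [← hwh] at h3
    by_contra hlt
    have hPlt : P < maximalIdeal S := lt_of_le_of_ne (le_maximalIdeal hPp.ne_top)
      fun h => hlt h.ge
    have h4 := height_add_one_le hPp inferInstance hPlt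
    have h5 : (maximalIdeal S).height ≠ ⊤ := by
      rw [hwh]; exact ENat.natCast_ne_top _
    have h6 := h3.trans ((self_le_add_right _ _).trans h4)
    have h7 := h4.trans h3
    exact absurd ((ENat.add_one_le_iff (fun h => h5 (top_le_iff.1 (h ▸ (self_le_add_right _ _).trans h4)))).1 h7)
      (lt_irrefl _)
  have hwq : IsWeaklyRegular T (w.map (· ^ q)) := by
    refine sop_regular w.length _ (by simp) ?_ w rfl hw hw2 c (hc.trans ?_)
    · intro r hr
      obtain ⟨s, hs, rfl⟩ := List.mem_map.1 hr
      exact Ideal.pow_mem_of_mem _ (hw s hs) _ (Nat.pos_of_ne_zero hq0)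
    · refine sup_le_sup_left (fun a ha => Module.mem_annihilator.2 fun m => ?_) _
      obtain ⟨m, rfl⟩ := Ideal.Quotient.mk_surjective m
      exact Ideal.Quotient.eq_zero_iff_mem.2 (Ideal.mul_mem_right _ _ ha)
  refine hasTestModule_of_germ x hx hxm J (ι := PUnit) ⊤ (fun _ => T)
    (fun s _ => Ideal.Quotient.mk _ s ^ q) ?_ ?_ ?_ ?_ w hw ?_ (fun _ => Ideal.Quotient.mk _ u) ?_ ?_ t ?_
  · exact fun a b => Filter.Eventually.of_forall fun _ => by
      rw [map_add, add_pow_char_pow]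
  · exact fun a b => Filter.Eventually.of_forall fun _ => by rw [map_mul, mul_pow]
  · exact Filter.Eventually.of_forall fun _ => by rw [map_one, one_pow]
  · exact fun y hy => Filter.Eventually.of_forall fun _ =>
      Ideal.pow_mem_of_mem _ (hmT y hy) _ (Nat.pos_of_ne_zero hq0)
  · refine Filter.Eventually.of_forall fun _ => ?_
    have := (isWeaklyRegular_map_algebraMap_iff T T (w.map (· ^ q))).2 hwq
    rw [List.map_map] at this
    have h3 : (fun s => Ideal.Quotient.mk (Ideal.ofList as) s ^ q) =
        ⇑(algebraMap S T) ∘ fun x => x ^ q :=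
      funext fun s => (map_pow (Ideal.Quotient.mk (Ideal.ofList as)) s q).symm
    rw [h3]
    exact this
  · refine Filter.Frequently.of_forall fun _ hmem => he ?_
    have h1 : Ideal.ofList (x.map fun s => Ideal.Quotient.mk (Ideal.ofList as) s ^ q) ≤
        (maximalIdeal S ^ e).map (Ideal.Quotient.mk (Ideal.ofList as)) := by
      refine Ideal.span_le.2 fun r hr => ?_
      obtain ⟨s, hs, rfl⟩ := List.mem_map.1 hr
      rw [← map_pow]
      exact Ideal.mem_map_of_mem _ (Ideal.pow_le_pow_right hqe
        (Ideal.pow_mem_pow (hxm ▸ Ideal.subset_span hs) q))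
    have h2 := Ideal.mem_comap.2 (h1 hmem)
    rw [Ideal.comap_map_of_surjective _ Ideal.Quotient.mk_surjective, ← RingHom.ker_eq_comap_bot,
      Ideal.mk_ker, sup_comm] at h2
    exact h2
  · refine fun j hj => Filter.Eventually.of_forall fun _ => ?_
    rw [← map_pow, ← map_mul]
    refine Ideal.Quotient.eq_zero_iff_mem.2 ?_
    obtain ⟨k, hk⟩ := Nat.exists_eq_succ_of_ne_zero hq0
    rw [hk, pow_succ, mul_assoc, mul_comm j u]
    exact Ideal.mul_mem_left _ _ (huJ j hj)
  · omega

/-- Test modules exist in residue characteristic `p`. -/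
theorem hasTestModule_of_prime [IsDomain S] {n : ℕ} (hcm : IsCM S n)
    (hn : (n : ℕ∞) ≤ (maximalIdeal S).height) (x : List S) (hxn : x.length = n)
    (hx : IsWeaklyRegular S x) (hxm : Ideal.ofList x = maximalIdeal S) (J : Ideal S) (p : ℕ)
    (hp : p.Prime) (hpm : (p : S) ∈ maximalIdeal S) (z : List S)
    (hz : ∀ r ∈ z, r ∈ maximalIdeal S) (hzr : IsWeaklyRegular S z) (u : S)
    (hu : u ∉ Ideal.ofList z) (huJ : ∀ j ∈ J, u * j ∈ Ideal.ofList z) :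
    HasTestModule S J (z.length + 1) := by
  by_cases hp0 : (p : S) = 0
  · exact hasTestModule_of_frobenius hcm hn x hxn hx hxm J p hp z hz hzr (hp0 ▸ Ideal.zero_mem _)
      u hu huJ _ (by omega)
  have hu' : ∀ r : S, r • (Ideal.Quotient.mk (Ideal.ofList z) u) = 0 → r * u ∈ Ideal.ofList z :=
    fun r hr => Ideal.Quotient.eq_zero_iff_mem.1 hr
  obtain ⟨Q, hQ, hQu, -⟩ := exists_assP (Ideal.Quotient.mk (Ideal.ofList z) u) (maximalIdeal S)
    (fun r hr => by
      by_contra hrm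
      have hun : IsUnit r := by simpa using hrm
      exact hu ((Ideal.unit_mul_mem_iff_mem _ hun).1 (hu' r hr)))
  have hJQ : J ≤ Q := fun j hj => hQu j (Ideal.Quotient.eq_zero_iff_mem.2
    (by
      change j * u ∈ _
      rw [mul_comm]; exact huJ j hj))
  have hQp := hQ.1
  have hQh := height_eq_of_assP hcm z hzr hQ
  have hle : Q ⊔ Ideal.span {(p : S)} ≤ maximalIdeal S :=
    sup_le (le_maximalIdeal hQp.ne_top) ((Ideal.span_singleton_le_iff_mem _).2 hpm)
  obtain ⟨Q', hQ', -⟩ := Ideal.exists_minimalPrimes_le hle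
  have hQ'p : Q'.IsPrime := hQ'.1.1
  have hh := height_le_succ_of_minimal hcm (p : S) hQ' hQh.le
  have hpQ : (p : S) ∈ Q' := hQ'.1.2 (Ideal.mem_sup_right (Ideal.mem_span_singleton_self _))
  obtain ⟨bs, hbs, hbr, hbh, hbA⟩ := exists_extend_in hcm Q' (z.length + 1) [(p : S)]
    (hh.trans (by exact_mod_cast Nat.le_add_left _ _)) (by simpa using hpQ)
    ((isWeaklyRegular_cons_iff _ _ _).2 ⟨fun a b hab => mul_left_cancel₀ hp0 hab, .nil _ _⟩)
  obtain ⟨v, hv⟩ := hbA.2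
  obtain ⟨v, rfl⟩ := Ideal.Quotient.mk_surjective v
  refine hasTestModule_of_frobenius hcm hn x hxn hx hxm J p hp ([(p : S)] ++ bs) ?_ hbr ?_ v ?_ ?_ _ ?_
  · intro r hr
    refine le_maximalIdeal hQ'p.ne_top ?_
    rcases List.mem_append.1 hr with h | h
    · simp only [List.mem_singleton] at h
      exact h ▸ hpQ
    · exact hbs r h
  · exact Ideal.subset_span (by simp)
  · intro hmem
    refine hQ'p.ne_top ((Ideal.eq_top_iff_one _).2 ((hv 1).2 ?_))
    rw [one_smul]
    exact Ideal.Quotient.eq_zero_iff_mem.2 hmem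
  · intro j hj
    rw [mul_comm]
    exact Ideal.Quotient.eq_zero_iff_mem.1 ((hv j).1 (hQ'.1.2 (Ideal.mem_sup_left (hJQ hj))))
  · have : ([(p : S)] ++ bs).length ≤ z.length + 1 := by exact_mod_cast hbh ▸ hh
    omega

end ExtTools

namespace ExtTools
open CategoryTheory Abelian CMTools RingTheory.Sequence Pointwise

variable {S : Type u} [CommRing S] [IsLocalRing S] [IsNoetherianRing S]

/-- Powers of a system of parameters that is a regular sequence have the monomial property. -/
theorem mem_of_prod_pow_smul_mem (k : ℕ) (x : List S) (hxm : ∀ r ∈ x, r ∈ maximalIdeal S)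
    {M : Type u} [AddCommGroup M] [Module S M] [Module.Finite S M] [Nontrivial M]
    (hx : IsWeaklyRegular M x) (hle : maximalIdeal S ≤ Ideal.ofList x ⊔ Module.annihilator S M)
    (m : M) (h : (x.map (· ^ k)).prod • m ∈ Ideal.ofList (x.map (· ^ (k + 1))) • (⊤ : Submodule S M)) :
    m ∈ Ideal.ofList x • (⊤ : Submodule S M) := by
  induction x generalizing M with
  | nil => simpa using h
  | cons r x ih =>
    have hr : r ∈ maximalIdeal S := hxm r (by simp)
    obtain ⟨h1, h2⟩ := (isWeaklyRegular_cons_iff M r x).1 hx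
    obtain ⟨c, hc⟩ : ∃ c, maximalIdeal S ^ c ≤
        Ideal.ofList (x.map (· ^ (k + 1)) ++ [r]) ⊔ Module.annihilator S M := by
      refine Ideal.exists_pow_le_of_le_radical_of_fg (hle.trans ?_) (IsNoetherian.noetherian _)
      refine sup_le ?_ (le_sup_right.trans Ideal.le_radical)
      refine Ideal.span_le.2 fun s hs => ?_
      have hs' : s = r ∨ s ∈ x := by simpa using hs
      rcases hs' with rfl | hs
      · exact Ideal.le_radical (Ideal.mem_sup_left (Ideal.subset_span (by simp)))
      · exact ⟨k + 1, Ideal.mem_sup_left (Ideal.subset_span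
          (List.mem_append_left _ (List.mem_map.2 ⟨s, hs, rfl⟩)))⟩
    have h3 : IsWeaklyRegular M (x.map (· ^ (k + 1)) ++ [r]) := by
      refine sop_regular (r :: x).length _ (by simp) ?_ (r :: x) rfl hxm hx c hc
      intro s hs
      rcases List.mem_append.1 hs with hs | hs
      · obtain ⟨v, hv, rfl⟩ := List.mem_map.1 hs
        exact Ideal.pow_mem_of_mem _ (hxm v (List.mem_cons_of_mem _ hv)) _ (Nat.succ_pos _)
      · simp only [List.mem_singleton] at hs
        exact hs ▸ hr
    rw [isWeaklyRegular_append_iff, isWeaklyRegular_singleton_iff] at h3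
    have h4 := h3.2.pow k
    rw [List.map_cons, List.map_cons, List.prod_cons, Ideal.ofList_cons, Submodule.sup_smul,
      Submodule.mem_sup] at h
    obtain ⟨a, ha, b, hb, hab⟩ := h
    rw [Submodule.ideal_span_singleton_smul] at ha
    obtain ⟨a, -, rfl⟩ := (Submodule.mem_smul_pointwise_iff_exists _ _ _).1 ha
    have h5 : (x.map (· ^ k)).prod • m - r • a ∈
        Ideal.ofList (x.map (· ^ (k + 1))) • (⊤ : Submodule S M) := by
      rw [isSMulRegular_quotient_iff_mem_of_smul_mem] at h4
      refine h4 _ ?_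
      have : r ^ k • ((x.map (· ^ k)).prod • m - r • a) = b := by
        rw [smul_sub, ← mul_smul, ← mul_smul, ← pow_succ, ← hab]
        exact add_sub_cancel_left _ _
      rw [this]
      exact hb
    let π : M →ₗ[S] QuotSMulTop r M := Submodule.mkQ (r • (⊤ : Submodule S M))
    have hπr : ∀ a, π (r • a) = 0 := fun a =>
      (Submodule.Quotient.mk_eq_zero (r • (⊤ : Submodule S M))).2
        (Submodule.smul_mem_pointwise_smul a r ⊤ trivial)
    have hnt : Nontrivial (QuotSMulTop r M) := by
      refine (Submodule.Quotient.nontrivial_iff (p := r • (⊤ : Submodule S M))).2 fun htop => ?_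
      have h6 : r • (⊤ : Submodule S M) ≤ maximalIdeal S • (⊤ : Submodule S M) := by
        rw [← Submodule.ideal_span_singleton_smul]
        exact Submodule.smul_mono_left ((Ideal.span_singleton_le_iff_mem _).2 hr)
      rw [htop] at h6
      exact (smul_top_lt (S := S) (M := M)).ne (top_le_iff.1 h6)
    have h6 := ih (fun s hs => hxm s (by simp [hs])) h2 (hle.trans ?_) (π m) ?_
    · have h7 : Submodule.map π (Ideal.ofList x • (⊤ : Submodule S M)) =
          Ideal.ofList x • (⊤ : Submodule S (QuotSMulTop r M)) := by
        rw [Submodule.map_smul'', Submodule.map_top, Submodule.range_mkQ]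
      rw [← h7] at h6
      obtain ⟨m', hm', hmm⟩ := h6
      have h8 : m - m' ∈ r • (⊤ : Submodule S M) := by
        rw [← Submodule.Quotient.mk_eq_zero, Submodule.Quotient.mk_sub, sub_eq_zero]
        exact hmm.symm
      rw [Ideal.ofList_cons, Submodule.sup_smul, Submodule.ideal_span_singleton_smul]
      have := Submodule.add_mem_sup h8 hm'
      rwa [sub_add_cancel] at this
    · rw [Ideal.ofList_cons, sup_comm (Ideal.span {r}), sup_assoc]
      refine sup_le_sup_left (sup_le ((Ideal.span_singleton_le_iff_mem _).2 ?_) ?_) _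
      · refine Module.mem_annihilator.2 fun v => ?_
        obtain ⟨v, rfl⟩ := Submodule.mkQ_surjective _ v
        exact hπr v
      · intro s hs
        refine Module.mem_annihilator.2 fun v => ?_
        obtain ⟨v, rfl⟩ := Submodule.mkQ_surjective _ v
        rw [← map_smul, Module.mem_annihilator.1 hs, map_zero]
    · have h7 : Submodule.map π (Ideal.ofList (x.map (· ^ (k + 1))) • (⊤ : Submodule S M)) =
          Ideal.ofList (x.map (· ^ (k + 1))) • (⊤ : Submodule S (QuotSMulTop r M)) := by
        rw [Submodule.map_smul'', Submodule.map_top, Submodule.range_mkQ]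
      rw [← h7]
      refine ⟨_, h5, ?_⟩
      rw [map_sub, hπr, sub_zero, map_smul]

lemma exists_lift_quotient {S : Type u} [CommRing S] {M : Type u} [AddCommGroup M] [Module S M]
    (I : Ideal S) (y : M) (h : ∀ a ∈ I, a • y = 0) :
    ∃ f : (S ⧸ I) →ₗ[S] M, ∀ a : S, f (Ideal.Quotient.mk I a) = a • y :=
  ⟨I.liftQ (LinearMap.toSpanSingleton S M y) fun a ha => h a ha, fun _ => rfl⟩

lemma mul_prod_pow_mem {S : Type u} [CommRing S] (k : ℕ) (x : List S) (a : S)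
    (ha : a ∈ Ideal.ofList x) :
    a * (x.map (· ^ k)).prod ∈ Ideal.ofList (x.map (· ^ (k + 1))) := by
  refine Submodule.span_induction (p := fun a _ => a * (x.map (· ^ k)).prod ∈
    Ideal.ofList (x.map (· ^ (k + 1)))) ?_ ?_ ?_ ?_ ha
  · intro b hb
    have hb' : b ∈ x := hb
    obtain ⟨l₁, l₂, rfl⟩ := List.append_of_mem hb'
    have : b * ((l₁ ++ b :: l₂).map (· ^ k)).prod =
        b ^ (k + 1) * ((l₁.map (· ^ k)).prod * (l₂.map (· ^ k)).prod) := by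
      rw [List.map_append, List.map_cons, List.prod_append, List.prod_cons]; ring
    rw [this]
    exact Ideal.mul_mem_right _ _ (Ideal.subset_span (List.mem_map.2 ⟨b, hb, rfl⟩))
  · rw [zero_mul]; exact Ideal.zero_mem _
  · intro a b _ _ h1 h2
    rw [add_mul]; exact Ideal.add_mem _ h1 h2
  · intro a b _ h1
    rw [smul_eq_mul, mul_assoc]; exact Ideal.mul_mem_left _ _ h1

/-- A certificate of non-membership coming from self-injectivity of an Artinian quotient. -/
theorem exists_certificate {n : ℕ} (hcm : IsCM S n) (hn : (n : ℕ∞) ≤ (maximalIdeal S).height)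
    (x : List S) (hxn : x.length = n) (hx : IsWeaklyRegular S x)
    (hxm : Ideal.ofList x = maximalIdeal S) (k : ℕ) (A : Ideal S)
    (hA : Ideal.ofList (x.map (· ^ (k + 1))) ≤ A) (u : S) (hu : u ∉ A) :
    ∃ s : S, (∀ a ∈ A, s * a ∈ Ideal.ofList (x.map (· ^ (k + 1)))) ∧
      ∃ r, s * (r * u) - (x.map (· ^ k)).prod ∈ Ideal.ofList (x.map (· ^ (k + 1))) := by
  have hxmem : ∀ r ∈ x, r ∈ maximalIdeal S := fun r hr => hxm ▸ Ideal.subset_span hr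
  have hrad : maximalIdeal S ≤ (Ideal.ofList (x.map (· ^ (k + 1)))).radical := by
    rw [← hxm]
    exact Ideal.span_le.2 fun r hr => ⟨k + 1, Ideal.subset_span (List.mem_map.2 ⟨r, hr, rfl⟩)⟩
  obtain ⟨c, hc⟩ := Ideal.exists_pow_le_of_le_radical_of_fg hrad (IsNoetherian.noetherian _)
  have hpow : IsWeaklyRegular S (x.map (· ^ (k + 1))) := by
    refine sop_regular n _ (by simpa using hxn) ?_ x hxn hxmem hx c (hc.trans le_sup_left)
    intro r hr
    obtain ⟨s, hs, rfl⟩ := List.mem_map.1 hr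
    exact Ideal.pow_mem_of_mem _ (hxmem s hs) _ (Nat.succ_pos _)
  -- a multiple of `u` in the socle
  let W := Submodule.span S {(Ideal.Quotient.mk A u : S ⧸ A)}
  let v : W := ⟨Ideal.Quotient.mk A u, Submodule.mem_span_singleton_self _⟩
  obtain ⟨Q, hQ, -⟩ := exists_assP v (maximalIdeal S) (fun r hr => by
    by_contra hrm
    have hun : IsUnit r := by simpa using hrm
    have : r * u ∈ A := Ideal.Quotient.eq_zero_iff_mem.1 (congrArg Subtype.val hr)
    exact hu ((Ideal.unit_mul_mem_iff_mem _ hun).1 this))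
  obtain ⟨hQp, y', hy'⟩ := hQ
  obtain ⟨r, hr⟩ := Submodule.mem_span_singleton.1 y'.2
  have hy : ∀ a : S, a ∈ Q ↔ a * (r * u) ∈ A := fun a => by
    rw [hy', ← Ideal.Quotient.eq_zero_iff_mem (I := A), ← Subtype.coe_inj]
    change a • (y' : S ⧸ A) = 0 ↔ _
    rw [← hr]
    rfl
  clear hy' hr y' v W
  have hQm : Q = maximalIdeal S := by
    refine le_antisymm (le_maximalIdeal hQp.ne_top) (hrad.trans (hQp.radical_le_iff.2 ?_))
    exact fun a ha => (hy a).2 (Ideal.mul_mem_right _ _ (hA ha))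
  subst hQm
  obtain ⟨f, hf1⟩ := exists_lift_quotient (maximalIdeal S) (Ideal.Quotient.mk A (r * u))
    (fun a ha => Ideal.Quotient.eq_zero_iff_mem.2 ((hy a).1 ha))
  have hf : Function.Injective f := by
    rw [injective_iff_map_eq_zero]
    intro a ha
    obtain ⟨a, rfl⟩ := Ideal.Quotient.mk_surjective a
    rw [hf1] at ha
    exact Ideal.Quotient.eq_zero_iff_mem.2 ((hy a).2 (Ideal.Quotient.eq_zero_iff_mem.1 ha))
  have hmp := mul_prod_pow_mem k x
  rw [hxm] at hmp
  have hht : (maximalIdeal S).height = n := le_antisymm hcm.1 hn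
  obtain ⟨zs, hzs⟩ : ∃ zs, zs = x.map (· ^ (k + 1)) := ⟨_, rfl⟩
  have hzn : zs.length = n := by rw [hzs, List.length_map, hxn]
  have hzm : ∀ z ∈ zs, z ∈ maximalIdeal S := by
    intro z hz
    rw [hzs] at hz
    obtain ⟨s, hs, rfl⟩ := List.mem_map.1 hz
    exact Ideal.pow_mem_of_mem _ (hxmem s hs) _ (Nat.succ_pos _)
  rw [← hzs] at hA hpow hmp ⊢
  clear hzs
  obtain ⟨φ, hφ⟩ := exists_lift_quotient (maximalIdeal S)
    (Ideal.Quotient.mk (Ideal.ofList zs) (x.map (· ^ k)).prod)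
    (fun a ha => Ideal.Quotient.eq_zero_iff_mem.2 (hmp a ha))
  have hext : ∀ e' : EX S (S ⧸ maximalIdeal S) S zs.length,
      ∃ e : EX S (S ⧸ A) S zs.length, (1 : S) • e' = pre S _ f e := by
    intro e'
    obtain ⟨h1, δ, h2, h3⟩ := contra_les hf (LinearMap.exact_map_mkQ_range f)
      (Submodule.mkQ_surjective _) S zs.length
    obtain ⟨s, hs, h4⟩ := vanAt_of_height hcm x hxn hxm hx (maximalIdeal S) n hht
      ((S ⧸ A) ⧸ LinearMap.range f) (zs.length + 1) (by omega)
    have hun : IsUnit s := by simpa using hs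
    obtain ⟨e, he⟩ := (h2 e').1 (hun.smul_eq_zero.1 (h4 _))
    exact ⟨e, by rw [one_smul, he]⟩
  obtain ⟨ψ, hψ⟩ := exists_hom_of_ext zs hpow (Submodule.mkQ (Ideal.ofList zs))
    (Submodule.mkQ_surjective _) (by rw [Submodule.ker_mkQ, smul_eq_mul, Ideal.mul_top]) f
    (fun z hz w => by
      obtain ⟨w, rfl⟩ := Ideal.Quotient.mk_surjective w
      exact Ideal.Quotient.eq_zero_iff_mem.2 (Ideal.mul_mem_right _ _ (hA (Ideal.subset_span hz))))
    (fun z hz w => by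
      obtain ⟨w, rfl⟩ := Ideal.Quotient.mk_surjective w
      exact Ideal.Quotient.eq_zero_iff_mem.2 (Ideal.mul_mem_right _ _ (hzm z hz))) 1 hext φ
  obtain ⟨s, hs⟩ := Ideal.Quotient.mk_surjective (ψ 1)
  have hψs : ∀ a : S, ψ (Ideal.Quotient.mk A a) = Ideal.Quotient.mk _ (s * a) := fun a => by
    have h1 : (Ideal.Quotient.mk A a : S ⧸ A) = a • (1 : S ⧸ A) := by
      rw [Algebra.smul_def, mul_one]; rfl
    rw [h1, map_smul, ← hs, mul_comm]; rfl
  refine ⟨s, fun a ha => ?_, r, ?_⟩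
  · refine Ideal.Quotient.eq_zero_iff_mem.1 ?_
    rw [← hψs, Ideal.Quotient.eq_zero_iff_mem.2 ha, map_zero]
  · rw [← Ideal.Quotient.eq, ← hψs]
    have h1 := LinearMap.congr_fun hψ (Ideal.Quotient.mk _ 1)
    rw [LinearMap.smul_apply, one_smul, LinearMap.comp_apply, hf1, hφ, one_smul, one_smul] at h1
    exact h1.symm

end ExtTools

namespace ExtTools
open CategoryTheory Abelian CMTools RingTheory.Sequence Pointwise

section Germs

variable {S : Type u} [CommRing S] {ι : Type u} (l : Filter ι) {T : ι → Type u}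
  [∀ C, CommRing (T C)] (g : ∀ C, S → T C)

/-- A family of maps that is eventually a ring homomorphism along a filter, on each pair. -/
structure EventuallyHom : Prop where
  add : ∀ a b, ∀ᶠ C in l, g C (a + b) = g C a + g C b
  mul : ∀ a b, ∀ᶠ C in l, g C (a * b) = g C a * g C b
  one : ∀ᶠ C in l, g C 1 = 1

namespace EventuallyHom

variable {l g} (H : EventuallyHom l g)
include H

lemma zero : ∀ᶠ C in l, g C 0 = 0 := by
  filter_upwards [H.add 0 0] with C hC
  rw [add_zero] at hC
  simpa using hC

lemma sub (a b : S) : ∀ᶠ C in l, g C (a - b) = g C a - g C b := by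
  filter_upwards [H.add (a - b) b] with C hC
  rw [sub_add_cancel] at hC
  rw [hC, add_sub_cancel_right]

lemma pow (a : S) (m : ℕ) : ∀ᶠ C in l, g C (a ^ m) = g C a ^ m := by
  induction m with
  | zero => simpa using H.one
  | succ m ih =>
    filter_upwards [ih, H.mul (a ^ m) a] with C h1 h2
    rw [pow_succ, pow_succ, h2, h1]

lemma list_pow (x : List S) (m : ℕ) :
    ∀ᶠ C in l, (x.map (· ^ m)).map (g C) = (x.map (g C)).map (· ^ m) := by
  induction x with
  | nil => simp
  | cons a x ih =>
    filter_upwards [ih, H.pow a m] with C h1 h2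
    simp only [List.map_cons]
    rw [h2, h1]

lemma list_prod (x : List S) : ∀ᶠ C in l, g C x.prod = (x.map (g C)).prod := by
  induction x with
  | nil => simpa using H.one
  | cons a x ih =>
    filter_upwards [ih, H.mul a x.prod] with C h1 h2
    rw [List.prod_cons, List.map_cons, List.prod_cons, h2, h1]

lemma mem_ofList (x : List S) (v : S) (hv : v ∈ Ideal.ofList x) :
    ∀ᶠ C in l, g C v ∈ Ideal.ofList (x.map (g C)) := by
  refine Submodule.span_induction (p := fun v _ => ∀ᶠ C in l, g C v ∈ Ideal.ofList (x.map (g C)))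
    ?_ ?_ ?_ ?_ hv
  · intro b hb
    exact Filter.Eventually.of_forall fun C => Ideal.subset_span (List.mem_map.2 ⟨b, hb, rfl⟩)
  · filter_upwards [H.zero] with C hC
    rw [hC]; exact Ideal.zero_mem _
  · intro a b _ _ h1 h2
    filter_upwards [h1, h2, H.add a b] with C h1 h2 h3
    rw [h3]; exact Ideal.add_mem _ h1 h2
  · intro a b _ h1
    filter_upwards [h1, H.mul a b] with C h1 h3
    rw [smul_eq_mul, h3]; exact Ideal.mul_mem_left _ _ h1

lemma ofList_le (x y : List S) (h : Ideal.ofList x ≤ Ideal.ofList y) :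
    ∀ᶠ C in l, Ideal.ofList (x.map (g C)) ≤ Ideal.ofList (y.map (g C)) := by
  have : ∀ᶠ C in l, ∀ a ∈ x, g C a ∈ Ideal.ofList (y.map (g C)) := by
    have := (Filter.eventually_all_finite (List.finite_toSet x)
      (p := fun a C => g C a ∈ Ideal.ofList (y.map (g C))) (l := l)).2 fun a ha =>
        H.mem_ofList y a (h (Ideal.subset_span ha))
    exact this
  filter_upwards [this] with C hC
  refine Ideal.span_le.2 fun r hr => ?_
  obtain ⟨s, hs, rfl⟩ := List.mem_map.1 hr
  exact hC s hs

end EventuallyHom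

end Germs

variable {S : Type u} [CommRing S] [IsLocalRing S] [IsNoetherianRing S]

lemma exists_notMem_sup_pow (A : Ideal S) (u : S) (hu : u ∉ A) :
    ∃ e, u ∉ A ⊔ maximalIdeal S ^ e := by
  by_contra hall
  push Not at hall
  have hH : IsHausdorff (maximalIdeal S) (S ⧸ A) := IsHausdorff.of_isLocalRing _ _
    (Ideal.IsPrime.ne_top inferInstance)
  refine hu (Ideal.Quotient.eq_zero_iff_mem.1 (hH.haus _ fun k => ?_))
  rw [SModEq.zero]
  obtain ⟨a, ha, b, hb, hab⟩ := Submodule.mem_sup.1 (hall k)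
  have : Ideal.Quotient.mk A u = b • (1 : S ⧸ A) := by
    rw [← hab, map_add, Ideal.Quotient.eq_zero_iff_mem.2 ha, zero_add]
    rw [Algebra.smul_def, mul_one]; rfl
  rw [this]
  exact Submodule.smul_mem_smul hb trivial

lemma exists_parameters {n : ℕ} (hcm : IsCM S n) (hn : (n : ℕ∞) ≤ (maximalIdeal S).height)
    (as : List S) (has : ∀ r ∈ as, r ∈ maximalIdeal S) (hasr : IsWeaklyRegular S as) :
    ∃ w : List S, (∀ r ∈ w, r ∈ maximalIdeal S) ∧ as.length + w.length = n ∧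
      maximalIdeal S ≤ (Ideal.ofList (as ++ w)).radical := by
  have hCn : (maximalIdeal S).height ≤ (as.length + n : ℕ) :=
    hcm.1.trans (by exact_mod_cast Nat.le_add_left _ _)
  obtain ⟨w, hw, hwr, hwh, hwA⟩ := exists_extend_in hcm (maximalIdeal S) n as
    (by exact_mod_cast hCn) has hasr
  refine ⟨w, hw, ?_, ?_⟩
  · have h1 : (as ++ w).length ≤ n := by exact_mod_cast hwh ▸ hcm.1
    have h2 : n ≤ (as ++ w).length := by exact_mod_cast hwh ▸ hn
    rw [List.length_append] at h1 h2
    omega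
  rw [Ideal.radical_eq_sInf]
  refine le_sInf fun P ⟨hP, hPp⟩ => ?_
  have h3 : ((as ++ w).length : ℕ∞) ≤ P.height :=
    length_le_height (as ++ w) P (fun r hr => hP (Ideal.subset_span hr)) hwr
  rw [← hwh] at h3
  by_contra hlt
  have hPlt : P < maximalIdeal S := lt_of_le_of_ne (le_maximalIdeal hPp.ne_top)
    fun h => hlt h.ge
  have h4 := height_add_one_le hPp inferInstance hPlt
  have h5 : (maximalIdeal S).height ≠ ⊤ := by
    rw [hwh]; exact ENat.natCast_ne_top _
  have h7 := h4.trans h3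
  exact absurd ((ENat.add_one_le_iff
    (fun h => h5 (top_le_iff.1 (h ▸ (self_le_add_right _ _).trans h4)))).1 h7) (lt_irrefl _)

/-- Approximate homomorphisms, on finite sets, to regular local rings of positive
characteristic, preserving a system of parameters. -/
def HasModels (S : Type u) [CommRing S] (x : List S) : Prop :=
  ∀ E : Finset S, ∃ (p : ℕ) (T : Type u) (_ : CommRing T) (_ : IsLocalRing T)
    (_ : IsNoetherianRing T) (g : S → T), p.Prime ∧ CharP T p ∧ g 1 = 1 ∧
    (∀ a ∈ E, ∀ b ∈ E, g (a + b) = g a + g b ∧ g (a * b) = g a * g b) ∧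
    IsWeaklyRegular T (x.map g) ∧ Ideal.ofList (x.map g) = maximalIdeal T

end ExtTools

namespace ExtTools
open CategoryTheory Abelian CMTools RingTheory.Sequence Pointwise

lemma isWeaklyRegular_pow_quotient {T : Type u} [CommRing T] [IsLocalRing T] [IsNoetherianRing T]
    (x z w : List T) (hx : IsWeaklyRegular T x) (hxm : ∀ r ∈ x, r ∈ maximalIdeal T)
    (hz : ∀ r ∈ z, r ∈ maximalIdeal T) (hw : ∀ r ∈ w, r ∈ maximalIdeal T)
    (hlen : z.length + w.length = x.length)
    (hrad : maximalIdeal T ≤ (Ideal.ofList (z ++ w)).radical) (q : ℕ) (hq : q ≠ 0)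
    (A : Ideal T) (hA : A = Ideal.ofList z) :
    IsWeaklyRegular (T ⧸ A) ((w.map (· ^ q)).map (Ideal.Quotient.mk A)) := by
  subst hA
  obtain ⟨c, hc⟩ : ∃ c, maximalIdeal T ^ c ≤ Ideal.ofList (z ++ w.map (· ^ q)) := by
    refine Ideal.exists_pow_le_of_le_radical_of_fg (hrad.trans ?_) (IsNoetherian.noetherian _)
    rw [Ideal.radical_le_radical_iff, Ideal.ofList_append]
    refine sup_le ?_ (Ideal.span_le.2 fun r hr => ⟨q, ?_⟩)
    · rw [Ideal.ofList_append]
      exact le_sup_left.trans Ideal.le_radical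
    · rw [Ideal.ofList_append]
      exact Ideal.mem_sup_right (Ideal.subset_span (List.mem_map.2 ⟨r, hr, rfl⟩))
  have h1 : IsWeaklyRegular T (z ++ w.map (· ^ q)) := by
    refine sop_regular x.length _ (by simpa using hlen) ?_ x rfl hxm hx c (hc.trans le_sup_left)
    intro r hr
    rcases List.mem_append.1 hr with h | h
    · exact hz r h
    · obtain ⟨s, hs, rfl⟩ := List.mem_map.1 h
      exact Ideal.pow_mem_of_mem _ (hw s hs) _ (Nat.pos_of_ne_zero hq)
  have h2 := ((isWeaklyRegular_append_self _ _).1 h1).2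
  exact (isWeaklyRegular_map_algebraMap_iff (T ⧸ Ideal.ofList z) (T ⧸ Ideal.ofList z)
    (w.map (· ^ q))).2 h2

lemma notMem_of_certificate {T : Type u} [CommRing T] [IsLocalRing T] [IsNoetherianRing T]
    (x z : List T) (hx : IsWeaklyRegular T x) (hxm : Ideal.ofList x = maximalIdeal T) (k q : ℕ)
    (hq : k + 1 ≤ q) (s r v : T)
    (hs : ∀ a ∈ z, s * a ∈ Ideal.ofList (x.map (· ^ (k + 1))))
    (hr : s * (r * v) - (x.map (· ^ k)).prod ∈ Ideal.ofList (x.map (· ^ (k + 1))))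
    (A : Ideal T) (hA : A = Ideal.ofList z) :
    Ideal.Quotient.mk A v ∉ Ideal.ofList ((x.map (· ^ q)).map (Ideal.Quotient.mk A)) := by
  subst hA
  intro hmem
  rw [← Ideal.map_ofList] at hmem
  have h2 := Ideal.mem_comap.2 hmem
  rw [Ideal.comap_map_of_surjective _ Ideal.Quotient.mk_surjective, ← RingHom.ker_eq_comap_bot,
    Ideal.mk_ker] at h2
  have h3 : Ideal.ofList (x.map (· ^ q)) ⊔ Ideal.ofList z ≤
      Submodule.comap (LinearMap.mulLeft T s) (Ideal.ofList (x.map (· ^ (k + 1)))) := by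
    refine sup_le (Ideal.span_le.2 fun a ha => ?_) (Ideal.span_le.2 fun a ha => hs a ha)
    obtain ⟨b, hb, rfl⟩ := List.mem_map.1 ha
    obtain ⟨m, rfl⟩ := Nat.exists_eq_add_of_le hq
    change s * b ^ (k + 1 + m) ∈ Ideal.ofList (x.map (· ^ (k + 1)))
    refine Ideal.mul_mem_left _ s ?_
    rw [pow_add]
    exact Ideal.mul_mem_right _ _ (Ideal.subset_span (List.mem_map.2 ⟨b, hb, rfl⟩))
  have h4 : s * (r * v) ∈ Ideal.ofList (x.map (· ^ (k + 1))) := h3 (Ideal.mul_mem_left _ r h2)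
  have h5 := Ideal.sub_mem _ h4 hr
  rw [sub_sub_cancel] at h5
  have h6 := mem_of_prod_pow_smul_mem k x (fun a ha => hxm ▸ Ideal.subset_span ha) (M := T) hx
    (hxm ▸ le_sup_left) 1 (by simpa using h5)
  rw [smul_eq_mul, Ideal.mul_top, hxm] at h6
  exact (Ideal.IsPrime.ne_top inferInstance) ((Ideal.eq_top_iff_one _).2 h6)

lemma mk_mem_maximalIdeal {T : Type u} [CommRing T] [IsLocalRing T] (A : Ideal T)
    [IsLocalRing (T ⧸ A)] (hA : A ≤ maximalIdeal T) (y : T) (hy : y ∈ maximalIdeal T) :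
    Ideal.Quotient.mk A y ∈ maximalIdeal (T ⧸ A) := by
  rw [mem_maximalIdeal, mem_nonunits_iff]
  intro hun
  obtain ⟨v, hv⟩ := hun.exists_right_inv
  obtain ⟨v, rfl⟩ := Ideal.Quotient.mk_surjective v
  rw [← map_mul, ← map_one (Ideal.Quotient.mk A), Ideal.Quotient.eq] at hv
  have : (1 : T) ∈ maximalIdeal T := by
    have := (maximalIdeal T).sub_mem (Ideal.mul_mem_right v _ hy) (hA hv)
    simpa only [sub_sub_cancel] using this
  exact Ideal.IsPrime.ne_top (inferInstance : (maximalIdeal T).IsPrime)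
    ((Ideal.eq_top_iff_one _).2 this)

variable {S : Type u} [CommRing S] [IsLocalRing S] [IsNoetherianRing S]

/-- Test modules exist in the presence of models in positive characteristic. -/
theorem hasTestModule_of_models {n : ℕ} (hcm : IsCM S n)
    (hn : (n : ℕ∞) ≤ (maximalIdeal S).height) (x : List S) (hxn : x.length = n)
    (hx : IsWeaklyRegular S x) (hxm : Ideal.ofList x = maximalIdeal S) (hmod : HasModels S x)
    (J : Ideal S) (z : List S)
    (hz : ∀ r ∈ z, r ∈ maximalIdeal S) (hzr : IsWeaklyRegular S z) (u : S)
    (hu : u ∉ Ideal.ofList z) (huJ : ∀ j ∈ J, u * j ∈ Ideal.ofList z) :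
    HasTestModule S J (z.length + 1) := by
  classical
  choose p T iC iL iN g hp hchar hone hhom hreg hgen using hmod
  have H : EventuallyHom (Filter.atTop : Filter (Finset S)) g :=
    { add := fun a b => by
        filter_upwards [Filter.eventually_ge_atTop ({a, b} : Finset S)] with C hC
        exact (hhom C a (hC (by simp)) b (hC (by simp))).1
      mul := fun a b => by
        filter_upwards [Filter.eventually_ge_atTop ({a, b} : Finset S)] with C hC
        exact (hhom C a (hC (by simp)) b (hC (by simp))).2
      one := Filter.Eventually.of_forall hone }
  obtain ⟨e, he⟩ := exists_notMem_sup_pow (Ideal.ofList z) u hu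
  obtain ⟨w, hw, hlen, hrad⟩ := exists_parameters hcm hn z hz hzr
  have hxmem : ∀ r ∈ x, r ∈ maximalIdeal S := fun r hr => hxm ▸ Ideal.subset_span hr
  obtain ⟨s, hs, r, hr⟩ := exists_certificate hcm hn x hxn hx hxm e
    (Ideal.ofList (x.map (· ^ (e + 1))) ⊔ Ideal.ofList z) le_sup_left u (fun hmem => he (by
      refine (sup_le (le_sup_of_le_right ?_) le_sup_left :
        Ideal.ofList (x.map (· ^ (e + 1))) ⊔ Ideal.ofList z ≤ _) hmem
      refine Ideal.span_le.2 fun a ha => ?_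
      obtain ⟨b, hb, rfl⟩ := List.mem_map.1 ha
      exact Ideal.pow_le_pow_right (Nat.le_succ e) (Ideal.pow_mem_pow (hxmem b hb) _)))
  have hmax : ∀ y ∈ maximalIdeal S, ∀ᶠ C in Filter.atTop, g C y ∈ maximalIdeal (T C) := by
    intro y hy
    filter_upwards [H.mem_ofList x y (hxm ▸ hy)] with C hC
    exact hgen C ▸ hC
  have hmaxl : ∀ v : List S, (∀ y ∈ v, y ∈ maximalIdeal S) →
      ∀ᶠ C in Filter.atTop, ∀ y ∈ v.map (g C), y ∈ maximalIdeal (T C) := by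
    intro v hv
    have := (Filter.eventually_all_finite (List.finite_toSet v)
      (p := fun a C => g C a ∈ maximalIdeal (T C)) (l := Filter.atTop)).2 fun a ha =>
        hmax a (hv a ha)
    filter_upwards [this] with C hC
    intro y hy
    obtain ⟨a, ha, rfl⟩ := List.mem_map.1 hy
    exact hC a ha
  let A : ∀ C, Ideal (T C) := fun C => Ideal.ofList (z.map (g C)) ⊓ maximalIdeal (T C)
  have hA : ∀ᶠ C in Filter.atTop, A C = Ideal.ofList (z.map (g C)) := by
    filter_upwards [hmaxl z hz] with C hC
    exact inf_eq_left.2 (Ideal.span_le.2 hC)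
  have hAm : ∀ C, A C ≤ maximalIdeal (T C) := fun C => inf_le_right
  have iNt : ∀ C, Nontrivial (T C ⧸ A C) := fun C => Ideal.Quotient.nontrivial_iff.2 fun h =>
    Ideal.IsPrime.ne_top (inferInstance : (maximalIdeal (T C)).IsPrime) (top_le_iff.1 (h ▸ hAm C))
  have iLT : ∀ C, IsLocalRing (T C ⧸ A C) := fun C =>
    IsLocalRing.of_surjective' (Ideal.Quotient.mk _) Ideal.Quotient.mk_surjective
  let q : Finset S → ℕ := fun C => p C ^ (e + 1)
  have hq0 : ∀ C, q C ≠ 0 := fun C => pow_ne_zero _ (hp C).ne_zero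
  have hqe : ∀ C, e + 1 ≤ q C := fun C => (Nat.lt_pow_self (hp C).one_lt).le
  have hfr : ∀ C, ∀ a b : T C, (a + b) ^ q C = a ^ q C + b ^ q C := fun C a b => by
    have := Fact.mk (hp C)
    have := hchar C
    exact add_pow_char_pow (p := p C) ..
  have hmm : ∀ C (v : List S), (v.map fun s => Ideal.Quotient.mk (A C) (g C s ^ q C)) =
      ((v.map (g C)).map (· ^ q C)).map (Ideal.Quotient.mk (A C)) := fun C v => by
    simp [List.map_map, Function.comp_def]
  refine hasTestModule_of_germ x hx hxm J (ι := Finset S) Filter.atTop (fun C => T C ⧸ A C)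
    (fun s C => Ideal.Quotient.mk (A C) (g C s ^ q C)) ?_ ?_ ?_ ?_ w hw ?_
    (fun C => Ideal.Quotient.mk (A C) (g C u)) ?_ ?_ _ ?_
  · intro a b
    filter_upwards [H.add a b] with C hC
    rw [hC, hfr, map_add]
  · intro a b
    filter_upwards [H.mul a b] with C hC
    rw [hC, mul_pow, map_mul]
  · filter_upwards [H.one] with C hC
    rw [hC, one_pow, map_one]
  · intro y hy
    filter_upwards [hmax y hy] with C hC
    exact mk_mem_maximalIdeal _ (hAm C) _
      (Ideal.pow_mem_of_mem _ hC _ (Nat.pos_of_ne_zero (hq0 C)))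
  · obtain ⟨c, hc⟩ := Ideal.exists_pow_le_of_le_radical_of_fg hrad (IsNoetherian.noetherian _)
    have hle : Ideal.ofList (x.map (· ^ c)) ≤ Ideal.ofList (z ++ w) := by
      refine Ideal.span_le.2 fun a ha => ?_
      obtain ⟨b, hb, rfl⟩ := List.mem_map.1 ha
      exact hc (Ideal.pow_mem_pow (hxmem b hb) c)
    filter_upwards [H.ofList_le _ _ hle, H.list_pow x c, hA, hmaxl z hz, hmaxl w hw]
      with C h1 h2 h3 h4 h5
    rw [hmm]
    refine isWeaklyRegular_pow_quotient (x.map (g C)) (z.map (g C)) (w.map (g C)) (hreg C)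
      (fun r hr => hgen C ▸ Ideal.subset_span hr) h4 h5 (by simp [hlen, hxn]) ?_ (q C) (hq0 C) _ h3
    rw [← hgen C]
    refine Ideal.span_le.2 fun a ha => ⟨c, ?_⟩
    rw [← List.map_append]
    refine h1 ?_
    rw [h2]
    exact Ideal.subset_span (List.mem_map.2 ⟨a, ha, rfl⟩)
  · refine Filter.Eventually.frequently ?_
    have hsz : ∀ᶠ C in Filter.atTop, ∀ a ∈ z,
        g C (s * a) ∈ Ideal.ofList ((x.map (· ^ (e + 1))).map (g C)) :=
      (Filter.eventually_all_finite (List.finite_toSet z)).2 fun a ha =>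
        H.mem_ofList _ _ (hs a (Ideal.mem_sup_right (Ideal.subset_span ha)))
    have hsz' : ∀ᶠ C in Filter.atTop, ∀ a ∈ z, g C (s * a) = g C s * g C a :=
      (Filter.eventually_all_finite (List.finite_toSet z)).2 fun a ha => H.mul s a
    filter_upwards [hsz, hsz', hA, H.list_pow x (e + 1), H.list_pow x e, H.mem_ofList _ _ hr,
      H.sub (s * (r * u)) (x.map (· ^ e)).prod, H.mul s (r * u), H.mul r u,
      H.list_prod (x.map (· ^ e))] with C h1 h2 h3 h4 h5 h6 h7 h8 h9 h10
    rw [hmm]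
    refine notMem_of_certificate (x.map (g C)) (z.map (g C)) (hreg C) (hgen C) e (q C) (hqe C)
      (g C s) (g C r) (g C u) ?_ ?_ _ h3
    · intro a ha
      obtain ⟨b, hb, rfl⟩ := List.mem_map.1 ha
      rw [← h2 b hb, ← h4]
      exact h1 b hb
    · rw [← h9, ← h8, ← h5, ← h10, ← h7, ← h4]
      exact h6
  · intro j hj
    filter_upwards [hA, H.mem_ofList z _ (huJ j hj), H.mul u j] with C h1 h2 h3
    rw [← map_mul, Ideal.Quotient.eq_zero_iff_mem, h1]
    obtain ⟨m, hm⟩ := Nat.exists_eq_succ_of_ne_zero (hq0 C)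
    rw [hm, pow_succ, mul_assoc, mul_comm (g C j), ← h3]
    exact Ideal.mul_mem_left _ _ h2
  · omega

end ExtTools

namespace Specialize
open Polynomial

/-- A polynomial contraction of a complete ring has a fixed point. -/
lemma exists_fixed_point {B : Type*} [CommRing B] (t : B) [IsAdicComplete (Ideal.span {t}) B]
    (f : B[X]) : ∃ w : B, w = t * f.eval w := by
  let s : ℕ → B := fun n => (fun w => t * f.eval w)^[n] 0
  have hs : ∀ n, s (n + 1) = t * f.eval (s n) := fun n => Function.iterate_succ_apply' _ _ _
  have hd : ∀ n, t ^ n ∣ s (n + 1) - s n := by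
    intro n
    induction n with
    | zero => simp
    | succ n ih =>
      have h : s (n + 1 + 1) - s (n + 1) = t * (f.eval (s (n + 1)) - f.eval (s n)) := by
        rw [mul_sub, ← hs, ← hs]
      rw [h, pow_succ']
      exact mul_dvd_mul_left t (ih.trans (sub_dvd_eval_sub _ _ _))
  have hle : ∀ m d, t ^ m ∣ s (m + d) - s m := by
    intro m d
    induction d with
    | zero => simp
    | succ d ih =>
      have : s (m + (d + 1)) - s m = (s (m + d + 1) - s (m + d)) + (s (m + d) - s m) := by
        rw [← add_assoc]; ring
      rw [this]
      exact dvd_add ((pow_dvd_pow t (Nat.le_add_right m d)).trans (hd _)) ih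
  have key : ∀ (m : ℕ) (a b : B), a ≡ b [SMOD (Ideal.span {t} ^ m • ⊤ : Submodule B B)] ↔
      t ^ m ∣ a - b := by
    intro m a b
    rw [SModEq.sub_mem, smul_eq_mul, Ideal.mul_top, Ideal.span_singleton_pow,
      Ideal.mem_span_singleton]
  obtain ⟨w, hw⟩ := IsPrecomplete.prec (I := Ideal.span {t}) (M := B) inferInstance (f := s)
    (fun {m n} hmn => by
      rw [key]
      obtain ⟨d, rfl⟩ := Nat.exists_eq_add_of_le hmn
      rw [dvd_sub_comm]
      exact hle m d)
  refine ⟨w, ?_⟩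
  rw [← sub_eq_zero]
  refine IsHausdorff.haus (I := Ideal.span {t}) (M := B) inferInstance _ fun m => ?_
  rw [key, sub_zero]
  have h1 := (key _ _ _).1 (hw m)
  have h2 := (key _ _ _).1 (hw (m + 1))
  have h3 : w - t * f.eval w = -(s (m + 1) - w) + t * (f.eval (s m) - f.eval w) := by
    rw [hs]; ring
  rw [h3]
  refine dvd_add ((dvd_neg).2 ((pow_dvd_pow t (Nat.le_succ m)).trans h2)) ?_
  exact (h1.trans (sub_dvd_eval_sub _ _ _)).mul_left t

/-- Newton's method at a point where the derivative is small but nonzero. -/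
lemma exists_root_of_newton {B : Type*} [CommRing B] (t : B) [IsAdicComplete (Ideal.span {t}) B]
    (f : B[X]) (h a Q : B) (hf : f.eval a = t ^ 2 * h * f.derivative.eval a ^ 2 * Q) :
    ∃ b, f.eval b = 0 ∧ h ∣ b - a := by
  set g := f.derivative.eval a with hg
  obtain ⟨e, he⟩ : ∃ e : B[X], ∀ y, f.eval (a + y) = f.eval a + g * y + y ^ 2 * e.eval y := by
    refine ⟨divX (divX (taylor a f)), fun y => ?_⟩
    have h1 : f.eval (a + y) = (taylor a f).eval y := by rw [taylor_eval, add_comm]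
    have h2 : (taylor a f) = (divX (divX (taylor a f)) * X + C g) * X + C (f.eval a) := by
      conv_lhs => rw [← divX_mul_X_add (taylor a f)]
      congr 2
      · conv_lhs => rw [← divX_mul_X_add (divX (taylor a f))]
        rw [coeff_divX, zero_add, taylor_coeff_one]
      · rw [taylor_coeff_zero]
    rw [h1]
    conv_lhs => rw [h2]
    simp only [eval_add, eval_mul, eval_X, eval_C]
    ring
  obtain ⟨w, hw⟩ := exists_fixed_point t
    (-(C (Q) + C h * X ^ 2 * e.comp (C (g * t * h) * X)) : B[X])
  simp only [eval_neg, eval_add, eval_mul, eval_C, eval_pow, eval_X, eval_comp] at hw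
  refine ⟨a + g * t * h * w, ?_, ⟨g * t * w, by ring⟩⟩
  rw [he, hf]
  linear_combination t * h * g ^ 2 * hw

/-- An approximate solution of `F = 0`, `H c = G` can be refined to a solution. -/
theorem exists_solution_of_approx {B : Type*} [CommRing B] (t : B)
    [IsAdicComplete (Ideal.span {t}) B] {ι : Type*} (F : B[X]) (H : B) (G : ι → B[X])
    (W θ Q₁ Q₂ : B) (c Q₃ : ι → B) (hF : F.eval θ = W ^ 3 * Q₁)
    (hW : t * H * F.derivative.eval θ = W * Q₂) (hG : ∀ j, (G j).eval θ - H * c j = W ^ 3 * Q₃ j)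
    (hQ₂ : IsUnit Q₂) (hW0 : W ≠ 0) :
    H ≠ 0 ∧ ∃ (θ' : B) (c' : ι → B), F.eval θ' = 0 ∧ ∀ j, H * c' j = (G j).eval θ' := by
  obtain ⟨v, hv⟩ := hQ₂.exists_right_inv
  have hW' : W = t * H * F.derivative.eval θ * v := by
    rw [hW, mul_assoc, hv, mul_one]
  refine ⟨fun h0 => hW0 (by rw [hW', h0]; ring), ?_⟩
  obtain ⟨θ', h1, h2⟩ := exists_root_of_newton t F H θ
    (t * H ^ 2 * F.derivative.eval θ * v ^ 3 * Q₁) (by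
      rw [hF]
      conv_lhs => rw [hW']
      ring)
  have h3 : ∀ j, H ∣ (G j).eval θ' := by
    intro j
    have h4 : (G j).eval θ' = ((G j).eval θ' - (G j).eval θ) + (H * c j + W ^ 3 * Q₃ j) := by
      rw [← hG]; ring
    rw [h4]
    refine dvd_add (h2.trans (sub_dvd_eval_sub _ _ _)) (dvd_add (dvd_mul_right _ _) ?_)
    have hHW : H ∣ W := ⟨t * F.derivative.eval θ * v, hW'.trans (by ring)⟩
    exact Dvd.dvd.mul_right (hHW.trans (dvd_pow_self W (by norm_num))) _
  choose c' hc' using h3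
  exact ⟨θ', c', h1, fun j => (hc' j).symm⟩

end Specialize

namespace Specialize
open Polynomial

/-- A generic point of a hypersurface specializes to every point of the hypersurface at which the
denominator does not vanish. -/
theorem exists_subring_hom {A B B' : Type*} [CommRing A] [CommRing B] [CommRing B'] [IsDomain B']
    (ψ : A →+* B) (φ : A →+* B') (F : A[X]) (H : A) (θ : B) (θ' : B')
    (hD : ∀ Q : A[X], Q.eval₂ ψ θ = 0 → ∃ N : ℕ, F ∣ C H ^ N * Q)
    (hF : F.eval₂ φ θ' = 0) (hH : φ H ≠ 0) :
    ∃ (K : Subring B) (σ : K →+* B'), ∀ a a', (∃ Q : A[X], ψ H * a = Q.eval₂ ψ θ ∧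
      φ H * a' = Q.eval₂ φ θ') → ∃ h : a ∈ K, σ ⟨a, h⟩ = a' := by
  let Γ : Subring (B × B') :=
    { carrier := {x | ∃ (N : ℕ) (Q : A[X]), ψ H ^ N * x.1 = Q.eval₂ ψ θ ∧
        φ H ^ N * x.2 = Q.eval₂ φ θ'}
      one_mem' := ⟨0, 1, by simp, by simp⟩
      zero_mem' := ⟨0, 0, by simp, by simp⟩
      mul_mem' := by
        rintro x y ⟨N, Q, h1, h2⟩ ⟨M, Q', h3, h4⟩
        refine ⟨N + M, Q * Q', ?_, ?_⟩
        · rw [eval₂_mul, ← h1, ← h3, Prod.fst_mul]; ring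
        · rw [eval₂_mul, ← h2, ← h4, Prod.snd_mul]; ring
      add_mem' := by
        rintro x y ⟨N, Q, h1, h2⟩ ⟨M, Q', h3, h4⟩
        refine ⟨N + M, C H ^ M * Q + C H ^ N * Q', ?_, ?_⟩
        · simp only [eval₂_add, eval₂_mul, eval₂_pow, eval₂_C, ← h1, ← h3, Prod.fst_add]; ring
        · simp only [eval₂_add, eval₂_mul, eval₂_pow, eval₂_C, ← h2, ← h4, Prod.snd_add]; ring
      neg_mem' := by
        rintro x ⟨N, Q, h1, h2⟩
        refine ⟨N, -Q, ?_, ?_⟩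
        · rw [eval₂_neg, ← h1, Prod.fst_neg]; ring
        · rw [eval₂_neg, ← h2, Prod.snd_neg]; ring }
  let f : Γ →+* B := (RingHom.fst B B').comp Γ.subtype
  have hf : Function.Injective f := by
    rw [injective_iff_map_eq_zero]
    rintro ⟨⟨a, a'⟩, N, Q, h1, h2⟩ (h0 : a = 0)
    subst h0
    obtain ⟨M, Y, hY⟩ := hD Q (by rw [← h1]; simp)
    have h3 := congrArg (eval₂ φ θ') hY
    simp only [eval₂_mul, eval₂_pow, eval₂_C, hF, zero_mul, ← h2] at h3
    have h4 : a' = 0 := by simpa [hH] using h3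
    subst h4
    rfl
  let e : Γ ≃+* f.range := RingEquiv.ofBijective f.rangeRestrict
    ⟨fun x y h => hf (congrArg Subtype.val h), f.rangeRestrict_surjective⟩
  refine ⟨f.range, (RingHom.snd B B').comp (Γ.subtype.comp e.symm.toRingHom), ?_⟩
  rintro a a' ⟨Q, h1, h2⟩
  have hm : (a, a') ∈ Γ := ⟨1, Q, by simpa using h1, by simpa using h2⟩
  refine ⟨⟨⟨_, hm⟩, rfl⟩, ?_⟩
  have h3 : e ⟨_, hm⟩ = ⟨a, ⟨⟨_, hm⟩, rfl⟩⟩ := rfl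
  have h4 := (e.symm_apply_eq).2 h3.symm
  change ((e.symm ⟨a, _⟩ : Γ) : B × B').2 = a'
  rw [h4]

/-- Over a ring of characteristic zero acting faithfully on a domain, an algebraic element is a
simple root of a polynomial that generates its relations up to powers of the leading coefficient. -/
theorem exists_simple_root {A B : Type*} [CommRing A] [IsDomain A] [CharZero A] [CommRing B]
    [IsDomain B] (ψ : A →+* B) (hψ : Function.Injective ψ) (θ : B)
    (h : ∃ Q : A[X], Q ≠ 0 ∧ Q.eval₂ ψ θ = 0) :
    ∃ F : A[X], F ≠ 0 ∧ F.eval₂ ψ θ = 0 ∧ F.derivative.eval₂ ψ θ ≠ 0 ∧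
      ∀ Q : A[X], Q.eval₂ ψ θ = 0 → ∃ N : ℕ, F ∣ C F.leadingCoeff ^ N * Q := by
  classical
  obtain ⟨F, ⟨hF0, hF⟩, hmin⟩ : ∃ F : A[X], (F ≠ 0 ∧ F.eval₂ ψ θ = 0) ∧
      ∀ Q : A[X], Q ≠ 0 → Q.eval₂ ψ θ = 0 → F.natDegree ≤ Q.natDegree := by
    have hw := (measure (natDegree (R := A))).wf
    refine ⟨hw.min {Q | Q ≠ 0 ∧ Q.eval₂ ψ θ = 0} h, hw.min_mem _ h, fun Q h1 h2 => ?_⟩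
    exact not_lt.1 (hw.not_lt_min _ (show Q ∈ {Q | Q ≠ 0 ∧ Q.eval₂ ψ θ = 0} from ⟨h1, h2⟩))
  have hdeg : F.natDegree ≠ 0 := by
    intro h0
    rw [eq_C_of_natDegree_eq_zero h0, eval₂_C] at hF
    apply hF0
    rw [eq_C_of_natDegree_eq_zero h0, hψ (hF.trans (map_zero ψ).symm), C_0]
  refine ⟨F, hF0, hF, fun h0 => ?_, ?_⟩
  · have h1 : F.derivative ≠ 0 := fun h2 => hdeg (derivative_eq_zero.1 h2)
    exact absurd (hmin _ h1 h0) (not_le.2 (natDegree_derivative_lt hdeg))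
  · suffices hs : ∀ n, ∀ Q : A[X], Q.natDegree < n → Q.eval₂ ψ θ = 0 →
        ∃ N : ℕ, F ∣ C F.leadingCoeff ^ N * Q from fun Q => hs _ Q (Nat.lt_succ_self _)
    intro n
    induction n with
    | zero => intro Q hQ; omega
    | succ n ih =>
      intro Q hQn hQ
      by_cases hQ0 : Q = 0
      · exact ⟨0, by simp [hQ0]⟩
      have hle := hmin Q hQ0 hQ
      have h1 : (F.cancelLeads Q).eval₂ ψ θ = 0 := by
        simp [cancelLeads, eval₂_sub, eval₂_mul, hF, hQ]
      have h2 : (F.cancelLeads Q).natDegree < n :=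
        (natDegree_cancelLeads_lt_of_natDegree_le_natDegree hle (by omega)).trans_le (by omega)
      obtain ⟨N, hN⟩ := ih _ h2 h1
      refine ⟨N + 1, ?_⟩
      have h3 : C F.leadingCoeff ^ (N + 1) * Q = C F.leadingCoeff ^ N * F.cancelLeads Q +
          F * (C F.leadingCoeff ^ N * C Q.leadingCoeff * X ^ (Q.natDegree - F.natDegree)) := by
        rw [cancelLeads, Nat.sub_eq_zero_of_le hle]; ring
      rw [h3]
      exact dvd_add hN (dvd_mul_right _ _)

end Specialize

namespace Specialize
open Polynomial

lemma exists_smul_mem_adjoin (A K Ω : Type*) [CommRing A] [IsDomain A] [Field K] [Algebra A K]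
    [IsFractionRing A K] [CommRing Ω] [Algebra A Ω] [Algebra K Ω] [IsScalarTower A K Ω] (S : Set Ω)
    {α : Ω} (h : α ∈ Algebra.adjoin K S) : ∃ a : A, a ≠ 0 ∧ a • α ∈ Algebra.adjoin A S := by
  induction h using Algebra.adjoin_induction with
  | mem x hx => exact ⟨1, one_ne_zero, by rw [one_smul]; exact Algebra.subset_adjoin hx⟩
  | algebraMap r =>
    obtain ⟨a, b, hb, rfl⟩ := IsFractionRing.div_surjective (A := A) r
    have hb0 := nonZeroDivisors.ne_zero hb
    refine ⟨b, hb0, ?_⟩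
    have h1 : b • algebraMap K Ω (algebraMap A K a / algebraMap A K b) = algebraMap A Ω a := by
      rw [Algebra.smul_def, IsScalarTower.algebraMap_apply A K Ω b, ← map_mul,
        mul_div_cancel₀, ← IsScalarTower.algebraMap_apply]
      simpa using hb0
    rw [h1]
    exact Subalgebra.algebraMap_mem _ a
  | add x y _ _ hx hy =>
    obtain ⟨a, ha, hx⟩ := hx
    obtain ⟨b, hb, hy⟩ := hy
    refine ⟨a * b, mul_ne_zero ha hb, ?_⟩
    have h1 : (a * b) • (x + y) = b • (a • x) + a • (b • y) := by
      rw [smul_add, smul_smul, smul_smul, mul_comm a b]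
    rw [h1]
    exact add_mem (Subalgebra.smul_mem _ hx _) (Subalgebra.smul_mem _ hy _)
  | mul x y _ _ hx hy =>
    obtain ⟨a, ha, hx⟩ := hx
    obtain ⟨b, hb, hy⟩ := hy
    refine ⟨a * b, mul_ne_zero ha hb, ?_⟩
    rw [← smul_mul_smul_comm]
    exact mul_mem hx hy

lemma exists_primitive_of_field (A B K Ω : Type*) [CommRing A] [IsDomain A] [CharZero A]
    [CommRing B] [Algebra A B] [Field K] [Field Ω] [Algebra A K] [IsFractionRing A K] [Algebra K Ω]
    [Algebra A Ω] [IsScalarTower A K Ω] (j : B →ₐ[A] Ω) (hj : Function.Injective j)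
    (E : Set B) (hE : E.Finite) (halg : ∀ c ∈ E, IsAlgebraic A c) :
    ∃ θ : B, IsAlgebraic A θ ∧ ∀ c ∈ E, ∃ a : A, a ≠ 0 ∧ a • c ∈ Algebra.adjoin A {θ} := by
  classical
  have : CharZero K := charZero_of_injective_algebraMap (IsFractionRing.injective A K)
  have halg' : ∀ x ∈ j '' E, IsAlgebraic K x := by
    rintro _ ⟨c, hc, rfl⟩
    exact (IsFractionRing.isAlgebraic_iff A K Ω).1 ((halg c hc).algHom j)
  let L := IntermediateField.adjoin K (j '' E)
  have : Finite (j '' E) := (hE.image j).to_subtype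
  have : FiniteDimensional K L := IntermediateField.finiteDimensional_adjoin
    fun x hx => (halg' x hx).isIntegral
  obtain ⟨γ, hγ⟩ := Field.exists_primitive_element K L
  have hγL : (γ : Ω) ∈ Algebra.adjoin K (j '' E) := by
    have := γ.2
    rwa [← IntermediateField.mem_toSubalgebra,
      IntermediateField.adjoin_toSubalgebra_of_isAlgebraic halg'] at this
  obtain ⟨a, ha, hθ⟩ := exists_smul_mem_adjoin A K Ω _ hγL
  rw [← AlgHom.map_adjoin] at hθ
  obtain ⟨θ, hθE, hθ⟩ := hθ
  have hθ' : j θ = a • (γ : Ω) := hθ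
  have haK : algebraMap A K a ≠ 0 := by simpa using ha
  have hθalg : IsAlgebraic K (j θ) := by
    rw [hθ', ← algebraMap_smul K a (γ : Ω), Algebra.smul_def]
    refine (isAlgebraic_algebraMap _).mul ?_
    exact (IntermediateField.isAlgebraic_iff.1 (Algebra.IsAlgebraic.isAlgebraic γ))
  refine ⟨θ, ?_, fun c hc => ?_⟩
  · have h1 : IsAlgebraic A (j θ) := (IsFractionRing.isAlgebraic_iff A K Ω).2 hθalg
    exact (isAlgebraic_algHom_iff j hj).1 h1
  · have hcL : j c ∈ L := IntermediateField.subset_adjoin _ _ ⟨c, hc, rfl⟩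
    have h2 : (⟨j c, hcL⟩ : L) ∈ Algebra.adjoin K {γ} := by
      have h3 : (⟨j c, hcL⟩ : L) ∈ IntermediateField.adjoin K {γ} := by rw [hγ]; trivial
      rwa [← IntermediateField.mem_toSubalgebra,
        IntermediateField.adjoin_toSubalgebra_of_isAlgebraic
          (fun x _ => Algebra.IsAlgebraic.isAlgebraic x)] at h3
    have h3 : j c ∈ Algebra.adjoin K {(γ : Ω)} := by
      have h4 : j c ∈ (Algebra.adjoin K {γ}).map L.val := ⟨_, h2, rfl⟩
      rw [AlgHom.map_adjoin, Set.image_singleton] at h4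
      exact h4
    have h5 : Algebra.adjoin K {(γ : Ω)} ≤ Algebra.adjoin K {j θ} := by
      refine Algebra.adjoin_le (Set.singleton_subset_iff.2 ?_)
      have h6 : (γ : Ω) = (algebraMap A K a)⁻¹ • j θ := by
        rw [hθ', ← algebraMap_smul K a, smul_smul, inv_mul_cancel₀ haK, one_smul]
      have h7 : j θ ∈ Algebra.adjoin K {j θ} := Algebra.self_mem_adjoin_singleton K _
      have h8 := Subalgebra.smul_mem _ h7 (algebraMap A K a)⁻¹
      rwa [← h6] at h8
    obtain ⟨b, hb, h7⟩ := exists_smul_mem_adjoin A K Ω _ (h5 h3)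
    refine ⟨b, hb, ?_⟩
    rw [← Set.image_singleton, ← AlgHom.map_adjoin] at h7
    obtain ⟨y, hy, hy'⟩ := h7
    have h8 : j y = j (b • c) := by rw [map_smul]; exact hy'
    rw [← hj h8]
    exact hy

/-- Finitely many algebraic elements are polynomials in a single one, up to denominators. -/
theorem exists_primitive {A B : Type*} [CommRing A] [IsDomain A] [CharZero A] [CommRing B]
    [IsDomain B] [Algebra A B] [FaithfulSMul A B] (E : Set B) (hE : E.Finite)
    (halg : ∀ c ∈ E, IsAlgebraic A c) :
    ∃ θ : B, IsAlgebraic A θ ∧ ∀ c ∈ E, ∃ a : A, a ≠ 0 ∧ a • c ∈ Algebra.adjoin A {θ} := by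
  let _ : Algebra (FractionRing A) (FractionRing B) := FractionRing.liftAlgebra A _
  have : IsScalarTower A (FractionRing A) (FractionRing B) :=
    FractionRing.isScalarTower_liftAlgebra A _
  exact exists_primitive_of_field A B (FractionRing A) (FractionRing B)
    (IsScalarTower.toAlgHom A B _) (IsFractionRing.injective B _) E hE halg

/-- A finite set in a domain of characteristic zero lies, up to denominators, in a ring generated
by a finite algebraically independent set together with one simple root. -/
theorem exists_generic_point {B : Type*} [CommRing B] [IsDomain B] [CharZero B] (S E : Set B)
    (hS : S.Finite) (hE : E.Finite) (hind : AlgebraicIndepOn ℤ id S) :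
    ∃ u : Set B, u.Finite ∧ S ⊆ u ∧ ∃ (θ : B) (F : (MvPolynomial u ℤ)[X]) (H : MvPolynomial u ℤ),
      let ψ : MvPolynomial u ℤ →+* B := (MvPolynomial.aeval ((↑) : u → B)).toRingHom
      F.eval₂ ψ θ = 0 ∧ F.derivative.eval₂ ψ θ ≠ 0 ∧ ψ H ≠ 0 ∧
      (∀ Q : (MvPolynomial u ℤ)[X], Q.eval₂ ψ θ = 0 → ∃ N : ℕ, F ∣ C H ^ N * Q) ∧
      ∀ c ∈ E, ∃ G : (MvPolynomial u ℤ)[X], ψ H * c = G.eval₂ ψ θ := by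
  classical
  obtain ⟨u, hSu, ⟨hu, huSE⟩, hmax⟩ := exists_maximal_algebraicIndependent S (S ∪ E)
    Set.subset_union_left hind
  refine ⟨u, (hS.union hE).subset huSE, hSu, ?_⟩
  let A := MvPolynomial u ℤ
  let ψ : A →+* B := (MvPolynomial.aeval ((↑) : u → B)).toRingHom
  have hψ : Function.Injective ψ := hu
  let _ : Algebra A B := ψ.toAlgebra
  have : FaithfulSMul A B := (faithfulSMul_iff_algebraMap_injective A B).2 hψ
  have halg : ∀ c ∈ E, IsAlgebraic A c := by
    intro c hc
    by_contra hcon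
    have h1 : Transcendental (Algebra.adjoin ℤ (id '' u)) (id c) := by
      intro h2
      apply hcon
      obtain ⟨Q, hQ0, hQ⟩ := h2
      have h3 : ∀ y : Algebra.adjoin ℤ (id '' u), ∃ a : A, ψ a = y := by
        rintro ⟨y, hy⟩
        rw [Set.image_id, Algebra.adjoin_eq_range] at hy
        exact hy
      choose g hg using h3
      let g' : Algebra.adjoin ℤ (id '' u) →+* A :=
        { toFun := g
          map_one' := hψ (by rw [hg, map_one]; rfl)
          map_zero' := hψ (by rw [hg, map_zero]; rfl)
          map_mul' := fun a b => hψ (by rw [hg, map_mul, hg, hg]; rfl)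
          map_add' := fun a b => hψ (by rw [hg, map_add, hg, hg]; rfl) }
      have hg' : ψ.comp g' = algebraMap (Algebra.adjoin ℤ (id '' u)) B := RingHom.ext hg
      refine ⟨Q.map g', (Polynomial.map_ne_zero_iff (f := g') fun a b hab => ?_).2 hQ0, ?_⟩
      · apply Subtype.ext
        rw [← hg a, ← hg b]
        exact congrArg ψ hab
      · rw [aeval_def, eval₂_map]
        change eval₂ (ψ.comp g') c Q = 0
        rw [hg']
        exact hQ
    have h4 := hu.insert h1
    have h5 : c ∈ u := hmax ⟨h4, Set.insert_subset (Or.inr hc) huSE⟩ (Set.subset_insert c u)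
      (Set.mem_insert c u)
    exact h1 (isAlgebraic_algebraMap (⟨c, Algebra.subset_adjoin (by simpa using h5)⟩ :
      Algebra.adjoin ℤ (id '' u)))
  obtain ⟨θ, hθ, hprim⟩ := exists_primitive E hE halg
  obtain ⟨F, hF0, hF, hF', hD⟩ := exists_simple_root ψ hψ θ hθ
  have hG : ∀ c : hE.toFinset, ∃ a : A, a ≠ 0 ∧ ∃ G : A[X], ψ a * c = G.eval₂ ψ θ := by
    rintro ⟨c, hc⟩
    obtain ⟨a, ha, hc⟩ := hprim c (by simpa using hc)
    rw [Algebra.adjoin_singleton_eq_range_aeval] at hc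
    obtain ⟨G, hG⟩ := hc
    exact ⟨a, ha, G, hG.symm⟩
  choose a ha G hG using hG
  refine ⟨θ, F, F.leadingCoeff * ∏ c, a c, hF, hF', ?_, fun Q hQ => ?_, fun c hc => ?_⟩
  · rw [Ne, map_eq_zero_iff _ hψ]
    exact mul_ne_zero (leadingCoeff_ne_zero.2 hF0) (Finset.prod_ne_zero_iff.2 fun c _ => ha c)
  · obtain ⟨N, hN⟩ := hD Q hQ
    refine ⟨N, ?_⟩
    rw [C_mul, mul_pow, mul_right_comm]
    exact Dvd.dvd.mul_right hN _
  · let c' : hE.toFinset := ⟨c, by simpa using hc⟩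
    refine ⟨C (F.leadingCoeff * ∏ d ∈ Finset.univ.erase c', a d) * G c', ?_⟩
    rw [eval₂_mul, eval₂_C, ← hG c', ← Finset.mul_prod_erase _ _ (Finset.mem_univ c')]
    change ψ _ * c = _
    simp only [map_mul, map_prod]
    change _ = _ * (_ * c)
    ring

end Specialize

namespace Specialize
open Polynomial

lemma exists_coe_sub_dvd {P : Type*} [CommRing P] {I : Ideal P} [IsAdicComplete I P] {M : P[X]}
    (hM : M.IsDistinguishedAt I) (b : PowerSeries P) :
    ∃ p : P[X], (M : PowerSeries P) ∣ (p : PowerSeries P) - b ∧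
      ∀ q : P[X], b = (q : PowerSeries P) → p = q := by
  by_cases h : ∃ q : P[X], b = (q : PowerSeries P)
  · obtain ⟨q, rfl⟩ := h
    exact ⟨q, by simp, fun q' h' => Polynomial.coe_injective P h'⟩
  · obtain ⟨y, hy⟩ := hM.algEquivQuotient.surjective (Ideal.Quotient.mk _ b)
    obtain ⟨p, rfl⟩ := Ideal.Quotient.mk_surjective y
    refine ⟨p, ?_, fun q hq => absurd ⟨q, hq⟩ h⟩
    have h1 : Ideal.Quotient.mk (Ideal.span {(M : PowerSeries P)}) (p : PowerSeries P) =
        Ideal.Quotient.mk _ b := by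
      rw [← hy, Polynomial.IsDistinguishedAt.algEquivQuotient_apply]
      simp
    rwa [Ideal.Quotient.mk_eq_mk_iff_sub_mem, Ideal.mem_span_singleton] at h1

lemma dvd_of_coe_dvd {P : Type*} [CommRing P] {I : Ideal P} [IsAdicComplete I P] {M : P[X]}
    (hM : M.IsDistinguishedAt I) {p : P[X]} (h : (M : PowerSeries P) ∣ (p : PowerSeries P)) :
    M ∣ p := by
  rw [← Ideal.mem_span_singleton, ← Ideal.Quotient.eq_zero_iff_mem]
  apply hM.algEquivQuotient.injective
  rw [map_zero]
  have h1 : Ideal.Quotient.mk (Ideal.span {(M : PowerSeries P)}) (p : PowerSeries P) = 0 := by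
    rwa [Ideal.Quotient.eq_zero_iff_mem, Ideal.mem_span_singleton]
  rw [← h1]
  simp

/-- Near a solution over `P⟦X⟧` there is an approximate solution over `P[X]`. -/
theorem exists_polynomial_approx {P : Type*} [CommRing P] [IsDomain P] [IsLocalRing P]
    [IsAdicComplete (maximalIdeal P) P] {u ι : Type*}
    (φ : MvPolynomial u ℤ →+* PowerSeries P) (θ : PowerSeries P) (F : (MvPolynomial u ℤ)[X])
    (H : MvPolynomial u ℤ) (G : ι → (MvPolynomial u ℤ)[X]) (c : ι → PowerSeries P)
    (hF : F.eval₂ φ θ = 0) (hG : ∀ j, φ H * c j = (G j).eval₂ φ θ)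
    (hΔ : (PowerSeries.X * φ H * F.derivative.eval₂ φ θ).map (residue P) ≠ 0) :
    ∃ (W Q₁ Q₂ θ' : P[X]) (τ : u → P[X]) (c' Q₃ : ι → P[X]) (v : P), W.Monic ∧
      F.eval₂ (MvPolynomial.eval₂Hom (Int.castRingHom _) τ) θ' = W ^ 3 * Q₁ ∧
      X * MvPolynomial.eval₂Hom (Int.castRingHom _) τ H *
        F.derivative.eval₂ (MvPolynomial.eval₂Hom (Int.castRingHom _) τ) θ' = W * Q₂ ∧
      (∀ j, (G j).eval₂ (MvPolynomial.eval₂Hom (Int.castRingHom _) τ) θ' -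
        MvPolynomial.eval₂Hom (Int.castRingHom _) τ H * c' j = W ^ 3 * Q₃ j) ∧
      Q₂.coeff 0 * v = 1 ∧
      ∀ i, ∀ p : P[X], φ (MvPolynomial.X i) = (p : PowerSeries P) → τ i = p := by
  obtain ⟨W, U, hWU⟩ := PowerSeries.exists_isWeierstrassFactorization hΔ
  have hW := hWU.isDistinguishedAt
  have hW3 : (W ^ 3).IsDistinguishedAt (maximalIdeal P) := by
    rw [pow_succ, pow_two]
    exact (hW.mul hW).mul hW
  choose ap hap hap' using exists_coe_sub_dvd hW3
  let φ' : MvPolynomial u ℤ →+* P[X] :=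
    MvPolynomial.eval₂Hom (Int.castRingHom _) fun i => ap (φ (MvPolynomial.X i))
  let θ' := ap θ
  let κ : P[X] →+* PowerSeries P := coeToPowerSeries.ringHom
  have hκ : ∀ p, κ p = (p : PowerSeries P) := fun _ => rfl
  have hmap : ∀ Q : (MvPolynomial u ℤ)[X],
      κ W ^ 3 ∣ κ (Q.eval₂ φ' θ') - Q.eval₂ φ θ := by
    intro Q
    let q := Ideal.Quotient.mk (Ideal.span {κ W ^ 3})
    have hq : ∀ x y, q x = q y ↔ κ W ^ 3 ∣ x - y := fun x y => by
      rw [Ideal.Quotient.mk_eq_mk_iff_sub_mem, Ideal.mem_span_singleton]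
    rw [← hq, hom_eval₂, hom_eval₂, hom_eval₂]
    have h1 : q.comp (κ.comp φ') = q.comp φ := by
      refine MvPolynomial.ringHom_ext' (Subsingleton.elim _ _) fun i => ?_
      have h2 : φ' (MvPolynomial.X i) = ap (φ (MvPolynomial.X i)) := by simp [φ']
      change q (κ (φ' _)) = q (φ _)
      rw [h2, hq]
      simpa [hκ] using hap (φ (MvPolynomial.X i))
    have h3 : q (κ θ') = q θ := by
      rw [hq]
      simpa [hκ] using hap θ
    rw [h1, h3]
  have hdvd : ∀ p, κ W ^ 3 ∣ κ p → W ^ 3 ∣ p := fun p hp =>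
    dvd_of_coe_dvd hW3 (by simpa [hκ] using hp)
  have hκW0 : κ W ≠ 0 := by
    rw [hκ]
    simpa using hW.monic.ne_zero
  have hΔ' : PowerSeries.X * φ H * F.derivative.eval₂ φ θ = κ W * U := hWU.eq_mul
  obtain ⟨Q₁, hQ₁⟩ := hdvd (F.eval₂ φ' θ') (by simpa [hF] using hmap F)
  have h3 : ∀ j, ∃ Q, (G j).eval₂ φ' θ' - φ' H * ap (c j) = W ^ 3 * Q := by
    intro j
    refine hdvd _ ?_
    have h4 := hmap (G j - C H * C 0)
    have h5 := hmap (C H)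
    rw [eval₂_C, eval₂_C] at h5
    have h6 : κ W ^ 3 ∣ κ (ap (c j)) - c j := by simpa [hκ] using hap (c j)
    have h7 : κ ((G j).eval₂ φ' θ' - φ' H * ap (c j)) =
        (κ ((G j).eval₂ φ' θ') - (G j).eval₂ φ θ) - (κ (φ' H) - φ H) * κ (ap (c j)) -
          φ H * (κ (ap (c j)) - c j) := by
      rw [← hG, map_sub, map_mul]; ring
    rw [h7]
    exact dvd_sub (dvd_sub (hmap _) (Dvd.dvd.mul_right h5 _)) (Dvd.dvd.mul_left h6 _)
  choose Q₃ hQ₃ using h3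
  have h4 : κ W ^ 3 ∣ κ (X * φ' H * F.derivative.eval₂ φ' θ') - κ W * U := by
    have h5 := hmap (C H * F.derivative)
    rw [eval₂_mul, eval₂_C, eval₂_mul, eval₂_C] at h5
    have h6 : κ (X * φ' H * F.derivative.eval₂ φ' θ') - κ W * U =
        PowerSeries.X * (κ (φ' H * F.derivative.eval₂ φ' θ') -
          φ H * F.derivative.eval₂ φ θ) := by
      rw [← hΔ', mul_assoc X, map_mul κ X, hκ X, Polynomial.coe_X]; ring
    rw [h6]
    exact Dvd.dvd.mul_left h5 _
  obtain ⟨s, hs⟩ := h4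
  obtain ⟨Q₂, hQ₂⟩ : W ∣ X * φ' H * F.derivative.eval₂ φ' θ' := by
    refine dvd_of_coe_dvd hW ?_
    rw [← hκ, ← hκ, sub_eq_iff_eq_add.1 hs]
    exact dvd_add ((dvd_pow_self _ (by norm_num)).mul_right _) (dvd_mul_right _ _)
  have hUu : IsUnit (PowerSeries.constantCoeff U) :=
    PowerSeries.isUnit_iff_constantCoeff.1 hWU.isUnit
  have hW0 : PowerSeries.constantCoeff (κ W) = 0 := by
    have h5 := congrArg PowerSeries.constantCoeff hΔ'
    rw [map_mul, map_mul, map_mul, PowerSeries.constantCoeff_X, zero_mul, zero_mul] at h5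
    exact (hUu.mul_left_eq_zero).1 h5.symm
  have hQ₂U : κ Q₂ = U + κ W ^ 2 * s := by
    apply mul_left_cancel₀ hκW0
    rw [← map_mul, ← hQ₂, sub_eq_iff_eq_add.1 hs]
    ring
  have h5 : Q₂.coeff 0 = PowerSeries.constantCoeff U := by
    have h6 := congrArg PowerSeries.constantCoeff hQ₂U
    rw [map_add, map_mul, map_pow, hW0, zero_pow two_ne_zero, zero_mul, add_zero, hκ,
      ← PowerSeries.coeff_zero_eq_constantCoeff_apply, Polynomial.coeff_coe] at h6
    exact h6
  obtain ⟨v, hv⟩ := hUu.exists_right_inv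
  exact ⟨W, Q₁, Q₂, θ', fun i => ap (φ (MvPolynomial.X i)), fun j => ap (c j), Q₃, v,
    hW.monic, hQ₁, hQ₂, hQ₃, by rw [h5, hv], fun i p hp => hap' _ _ hp⟩

end Specialize

namespace Specialize
open Polynomial

lemma exists_map_subtype {P : Type*} [CommRing P] (K : Subring P) (p : P[X])
    (h : (p.coeffs : Set P) ⊆ K) : ∃ q : K[X], q.map K.subtype = p :=
  ⟨p.toSubring K h, map_toSubring p K h⟩

/-- Only finitely many coefficients matter for specializing an approximate solution. -/
theorem exists_finite_coeffs {P : Type u} [CommRing P] [IsDomain P] [IsLocalRing P]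
    [IsAdicComplete (maximalIdeal P) P] {u ι : Type*} [Finite u] [Finite ι]
    (φ : MvPolynomial u ℤ →+* PowerSeries P) (θ : PowerSeries P) (F : (MvPolynomial u ℤ)[X])
    (H : MvPolynomial u ℤ) (G : ι → (MvPolynomial u ℤ)[X]) (c : ι → PowerSeries P)
    (hF : F.eval₂ φ θ = 0) (hG : ∀ j, φ H * c j = (G j).eval₂ φ θ)
    (hΔ : (PowerSeries.X * φ H * F.derivative.eval₂ φ θ).map (residue P) ≠ 0) :
    ∃ E : Set P, E.Finite ∧ ∀ K : Subring P, E ⊆ K → ∀ (P' : Type u) [CommRing P'] [IsDomain P']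
      (σ : K →+* P'), ∃ (φ' : MvPolynomial u ℤ →+* PowerSeries P') (θ' : PowerSeries P')
        (c' : ι → PowerSeries P'), F.eval₂ φ' θ' = 0 ∧ φ' H ≠ 0 ∧
        (∀ j, φ' H * c' j = (G j).eval₂ φ' θ') ∧
        ∀ i, ∀ p : K[X], φ (MvPolynomial.X i) = ((p.map K.subtype : P[X]) : PowerSeries P) →
          φ' (MvPolynomial.X i) = ((p.map σ : P'[X]) : PowerSeries P') := by
  obtain ⟨W, Q₁, Q₂, θ', τ, c', Q₃, v, hW, h1, h2, h3, hv, hτ⟩ :=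
    exists_polynomial_approx φ θ F H G c hF hG hΔ
  let fin (p : P[X]) : Set P := p.coeffs
  have hfin : ∀ p, (fin p).Finite := fun p => p.coeffs.finite_toSet
  refine ⟨{v} ∪ (fin W ∪ (fin Q₁ ∪ (fin Q₂ ∪ (fin θ' ∪ ((⋃ i, fin (τ i)) ∪
    ((⋃ j, fin (c' j)) ∪ ⋃ j, fin (Q₃ j))))))), ?_, fun K hK P' _ _ σ => ?_⟩
  · exact (Set.finite_singleton v).union ((hfin _).union ((hfin _).union ((hfin _).union
      ((hfin _).union ((Set.finite_iUnion fun _ => hfin _).union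
        ((Set.finite_iUnion fun _ => hfin _).union (Set.finite_iUnion fun _ => hfin _)))))))
  simp only [Set.union_subset_iff, Set.iUnion_subset_iff, Set.singleton_subset_iff] at hK
  obtain ⟨kv, kW, k1, k2, kθ, kτ, kc, k3⟩ := hK
  obtain ⟨W, rfl⟩ := exists_map_subtype K W kW
  obtain ⟨Q₁, rfl⟩ := exists_map_subtype K Q₁ k1
  obtain ⟨Q₂, rfl⟩ := exists_map_subtype K Q₂ k2
  obtain ⟨θ', rfl⟩ := exists_map_subtype K θ' kθ
  choose τ' hτ' using fun i => exists_map_subtype K (τ i) (kτ i)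
  choose d hd using fun j => exists_map_subtype K (c' j) (kc j)
  choose Q₃' hQ₃ using fun j => exists_map_subtype K (Q₃ j) (k3 j)
  let ν : K[X] →+* P[X] := mapRingHom K.subtype
  have hν : Function.Injective ν := map_injective _ K.subtype_injective
  let φ₁ : MvPolynomial u ℤ →+* K[X] := MvPolynomial.eval₂Hom (Int.castRingHom _) τ'
  have hφ₁ : MvPolynomial.eval₂Hom (Int.castRingHom _) τ = ν.comp φ₁ := by
    refine MvPolynomial.ringHom_ext' (Subsingleton.elim _ _) fun i => ?_
    simp [φ₁, ν, hτ']
  have hmap : ∀ q : K[X], q.map K.subtype = ν q := fun _ => rfl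
  simp only [hφ₁, hmap, ← hd, ← hQ₃, RingHom.comp_apply] at h1 h2 h3
  have e1 : F.eval₂ φ₁ θ' = W ^ 3 * Q₁ := hν (by
    rw [hom_eval₂, h1, map_mul, map_pow])
  have e2 : X * φ₁ H * F.derivative.eval₂ φ₁ θ' = W * Q₂ := hν (by
    rw [map_mul, map_mul, hom_eval₂, map_mul, ← h2]
    simp [ν])
  have e3 : ∀ j, (G j).eval₂ φ₁ θ' - φ₁ H * d j = W ^ 3 * Q₃' j := fun j => hν (by
    rw [map_sub, hom_eval₂, map_mul, map_mul, map_pow, ← h3])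
  let μ : K[X] →+* PowerSeries P' := coeToPowerSeries.ringHom.comp (mapRingHom σ)
  have hμ : ∀ q, μ q = ((q.map σ : P'[X]) : PowerSeries P') := fun _ => rfl
  have hμX : μ X = PowerSeries.X := by simp [hμ]
  have hWm : W.Monic := by
    have h4 : (W.map K.subtype).leadingCoeff = 1 := hW
    rw [leadingCoeff_map_of_injective K.subtype_injective] at h4
    exact K.subtype_injective h4
  have hunit : IsUnit (μ Q₂) := by
    rw [PowerSeries.isUnit_iff_constantCoeff, hμ, ← PowerSeries.coeff_zero_eq_constantCoeff_apply,
      Polynomial.coeff_coe, coeff_map]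
    refine IsUnit.of_mul_eq_one (σ ⟨v, kv⟩) ?_
    rw [← map_mul, ← map_one σ]
    congr 1
    apply Subtype.ext
    rw [coeff_map] at hv
    exact hv
  have hW0 : μ W ≠ 0 := by
    rw [hμ, Ne, Polynomial.coe_eq_zero_iff]
    exact (hWm.map σ).ne_zero
  obtain ⟨hH, θ₂, c₂, s1, s2⟩ := exists_solution_of_approx (PowerSeries.X : PowerSeries P')
    (F.map (μ.comp φ₁)) (μ (φ₁ H)) (fun j => (G j).map (μ.comp φ₁)) (μ W) (μ θ') (μ Q₁) (μ Q₂)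
    (fun j => μ (d j)) (fun j => μ (Q₃' j))
    (by rw [eval_map, ← hom_eval₂, e1, map_mul, map_pow])
    (by rw [derivative_map, eval_map, ← hom_eval₂, ← hμX, ← map_mul, ← map_mul, e2, map_mul])
    (fun j => by rw [eval_map, ← hom_eval₂, ← map_mul, ← map_sub, e3, map_mul, map_pow])
    hunit hW0
  refine ⟨μ.comp φ₁, θ₂, c₂, by rwa [eval_map] at s1, hH, fun j => ?_, fun i p hp => ?_⟩
  · have h4 := s2 j
    rwa [eval_map] at h4
  · have h4 : φ₁ (MvPolynomial.X i) = p := hν (by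
      have h5 := hτ i _ hp
      rw [← hτ'] at h5
      simpa [φ₁, hmap] using h5)
    rw [RingHom.comp_apply, h4, hμ]

end Specialize

namespace Specialize
open MvPowerSeries

lemma mem_span_X_pow {σ k : Type*} [Finite σ] [CommRing k] (m : ℕ) (f : MvPowerSeries σ k)
    (hf : ∀ x : σ →₀ ℕ, x.degree < m → coeff x f = 0) :
    f ∈ Ideal.span (Set.range (X : σ → MvPowerSeries σ k)) ^ m := by
  classical
  cases nonempty_fintype σ
  induction m generalizing f with
  | zero => simp
  | succ m ih =>
    have hsel : ∀ e : σ →₀ ℕ, e ≠ 0 → ∃ i, Finsupp.single i 1 ≤ e := by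
      intro e he
      obtain ⟨i, hi⟩ := Finsupp.ne_iff.mp he
      exact ⟨i, by
        rw [Finsupp.single_le_iff]
        exact Nat.one_le_iff_ne_zero.mpr (by simpa using hi)⟩
    rcases isEmpty_or_nonempty σ with hσ | hσ
    · have : f = 0 := by
        ext e
        rw [hf e (by simp [Subsingleton.elim e 0]), map_zero]
      rw [this]
      exact zero_mem _
    choose! s hs using hsel
    let g : σ → MvPowerSeries σ k := fun i e =>
      if s (e + Finsupp.single i 1) = i then coeff (e + Finsupp.single i 1) f else 0
    have hg : ∀ i e, coeff e (g i) =
      if s (e + Finsupp.single i 1) = i then coeff (e + Finsupp.single i 1) f else 0 :=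
      fun i e => rfl
    have hsum : f = ∑ i, X i * g i := by
      ext e
      rw [map_sum]
      have key : ∀ i, coeff e (X i * g i) =
          if Finsupp.single i 1 ≤ e ∧ s e = i then coeff e f else 0 := by
        intro i
        rw [X, coeff_monomial_mul]
        by_cases h : Finsupp.single i 1 ≤ e
        · simp [h, hg, tsub_add_cancel_of_le h]
        · simp [h]
      simp_rw [key]
      by_cases he : e = 0
      · subst he
        rw [hf 0 (by simp)]
        simp
      · rw [Finset.sum_eq_single (s e)]
        · simp [hs e he]
        · intro i _ hi
          simp [hi.symm]
        · simp
    rw [hsum, pow_succ']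
    refine Ideal.sum_mem _ fun i _ => Ideal.mul_mem_mul (Ideal.subset_span ⟨i, rfl⟩) (ih _ ?_)
    intro x hx
    rw [hg]
    split_ifs
    · exact hf _ (by simpa using hx)
    · rfl

lemma maximalIdeal_eq_span_X {σ k : Type*} [Finite σ] [Field k] :
    maximalIdeal (MvPowerSeries σ k) = Ideal.span (Set.range X) := by
  apply le_antisymm
  · intro f hf
    rw [← pow_one (Ideal.span _)]
    refine mem_span_X_pow 1 f fun x hx => ?_
    have : x = 0 := (Finsupp.degree_eq_zero_iff x).mp (by omega)
    subst this
    rw [coeff_zero_eq_constantCoeff_apply]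
    by_contra h
    exact (mem_maximalIdeal _).mp hf (isUnit_iff_constantCoeff.mpr (isUnit_iff_ne_zero.mpr h))
  · rw [Ideal.span_le]
    rintro _ ⟨i, rfl⟩
    refine (mem_maximalIdeal _).mpr fun h => ?_
    simpa using isUnit_iff_constantCoeff.mp h

instance isAdicComplete_maximalIdeal {σ k : Type*} [Finite σ] [Field k] :
    IsAdicComplete (maximalIdeal (MvPowerSeries σ k)) (MvPowerSeries σ k) := by
  rw [maximalIdeal_eq_span_X]
  infer_instance

lemma aeval_smul_of_isHomogeneous {σ k A : Type*} [CommRing k] [CommRing A] [Algebra k A]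
    {p : MvPolynomial σ k} {e : ℕ} (hp : p.IsHomogeneous e) (c : σ → k) (t : A) :
    MvPolynomial.aeval (fun i => algebraMap k A (c i) * t) p =
      algebraMap k A (MvPolynomial.eval c p) * t ^ e := by
  rw [MvPolynomial.aeval_def, MvPolynomial.eval₂_eq, MvPolynomial.eval_eq, map_sum,
    Finset.sum_mul]
  refine Finset.sum_congr rfl fun d hd => ?_
  have hd' : ∑ i ∈ d.support, d i = e := by
    have := hp (MvPolynomial.mem_support_iff.mp hd)
    rw [Finsupp.weight_apply, Finsupp.sum] at this
    simpa using this
  simp_rw [mul_pow]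
  rw [Finset.prod_mul_distrib, Finset.prod_pow_eq_pow_sum, hd', map_mul, map_prod]
  simp_rw [map_pow]
  ring

lemma exists_int_eval_ne_zero {b : ℕ} {k : Type*} [Field k] [CharZero k]
    {p : MvPolynomial (Fin (b + 1)) k} {e : ℕ} (hp : p.IsHomogeneous e) (h0 : p ≠ 0) :
    ∃ l : Fin b → ℤ, MvPolynomial.eval (Fin.cons 1 (fun i => (l i : k))) p ≠ 0 := by
  by_contra hcon
  push Not at hcon
  let q : MvPolynomial (Fin b) k :=
    MvPolynomial.aeval (Fin.cons 1 MvPolynomial.X : Fin (b + 1) → MvPolynomial (Fin b) k) p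
  have hq : ∀ y : Fin b → k, MvPolynomial.eval y q = MvPolynomial.eval (Fin.cons 1 y) p := by
    intro y
    have : (MvPolynomial.aeval y).comp (MvPolynomial.aeval
        (Fin.cons 1 MvPolynomial.X : Fin (b + 1) → MvPolynomial (Fin b) k)) =
        MvPolynomial.aeval (R := k) (Fin.cons 1 y : Fin (b + 1) → k) := by
      apply MvPolynomial.algHom_ext
      intro i
      refine Fin.cases ?_ (fun j => ?_) i <;> simp
    have h := DFunLike.congr_fun this p
    simpa [MvPolynomial.aeval_eq_eval, q] using h
  have hq0 : q = 0 := by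
    refine MvPolynomial.funext_set (fun _ => Set.range ((↑) : ℤ → k))
      (fun _ => Set.infinite_range_of_injective Int.cast_injective) fun x hx => ?_
    choose l hl using fun i => hx i trivial
    have hx' : x = fun i => (l i : k) := funext fun i => (hl i).symm
    rw [hq, map_zero, hx', hcon l]
  have hX : MvPolynomial.X 0 * p = 0 := by
    refine MvPolynomial.funext fun a => ?_
    rw [map_mul, MvPolynomial.eval_X, map_zero]
    by_cases ha : a 0 = 0
    · rw [ha, zero_mul]
    · have h1 := aeval_smul_of_isHomogeneous hp
        (Fin.cons 1 (fun i => a i.succ / a 0) : Fin (b + 1) → k) (a 0)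
      have h2 : (fun i => algebraMap k k ((Fin.cons 1 (fun i => a i.succ / a 0) :
          Fin (b + 1) → k) i) * a 0) = a := by
        funext i
        refine Fin.cases ?_ (fun j => ?_) i
        · simp
        · simp [ha]
      rw [h2, ← hq, hq0] at h1
      rw [← MvPolynomial.aeval_eq_eval]
      simp [h1]
  rcases mul_eq_zero.mp hX with h | h
  · exact MvPolynomial.X_ne_zero _ h
  · exact h0 h

/-- A power series does not vanish on a general integral line through the origin. -/
theorem exists_line_ne_zero {b : ℕ} {k : Type*} [Field k] [CharZero k]
    {f : MvPowerSeries (Fin (b + 1)) k} (hf : f ≠ 0) :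
    ∃ l : Fin b → ℤ, ∀ ρ : MvPowerSeries (Fin (b + 1)) k →ₐ[k] PowerSeries k,
      ρ (X 0) = PowerSeries.X → (∀ i : Fin b, ρ (X i.succ) = (l i : PowerSeries k) * PowerSeries.X) →
      ρ f ≠ 0 := by
  obtain ⟨e, he⟩ : ∃ e : ℕ, (e : ℕ∞) = f.order :=
    ⟨_, ne_zero_iff_order_finite.mp hf⟩
  set p := truncTotal (e + 1) f with hpdef
  have hcoeff : ∀ d, MvPolynomial.coeff d p = if d.degree < e + 1 then coeff d f else 0 :=
    fun d => coeff_truncTotal_eq_ite ..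
  have hlow : ∀ d : Fin (b + 1) →₀ ℕ, d.degree < e → coeff d f = 0 := fun d hd =>
    coeff_of_lt_order (by rw [← he]; exact_mod_cast hd)
  have hp : p.IsHomogeneous e := by
    intro d hd
    rw [hcoeff] at hd
    have h1 : d.degree = e := by
      by_contra hne
      split_ifs at hd with h
      · exact hd (hlow d (by omega))
      · exact hd rfl
    rwa [Finsupp.degree_eq_weight_one] at h1
  have hp0 : p ≠ 0 := by
    obtain ⟨d, hd, hd'⟩ := exists_coeff_ne_zero_and_order (ne_zero_iff_order_finite.mp hf)
    intro h
    have h1 := hcoeff d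
    have h2 : d.degree = e := by rw [← he] at hd'; exact_mod_cast hd'
    rw [h, if_pos (by omega)] at h1
    exact hd (by simpa using h1.symm)
  obtain ⟨l, hl⟩ := exists_int_eval_ne_zero hp hp0
  refine ⟨l, fun ρ h0 hs hρ => hl ?_⟩
  have hdiff : f - (p : MvPowerSeries (Fin (b + 1)) k) ∈
      Ideal.span (Set.range (X : Fin (b + 1) → MvPowerSeries (Fin (b + 1)) k)) ^ (e + 1) := by
    refine mem_span_X_pow _ _ fun x hx => ?_
    rw [map_sub, MvPolynomial.coeff_coe, hcoeff, if_pos hx, sub_self]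
  have hρX : ∀ i, ρ (X i) = algebraMap k (PowerSeries k)
      ((Fin.cons 1 (fun i => (l i : k)) : Fin (b + 1) → k) i) * PowerSeries.X := by
    intro i
    refine Fin.cases ?_ (fun j => ?_) i
    · simp [h0]
    · simp [hs]
  have hmem : ρ (f - p) ∈ Ideal.span {(PowerSeries.X : PowerSeries k)} ^ (e + 1) := by
    have h1 := Ideal.mem_map_of_mem ρ hdiff
    rw [Ideal.map_pow, Ideal.map_span] at h1
    refine Ideal.pow_right_mono ?_ _ h1
    rw [Ideal.span_le]
    rintro _ ⟨_, ⟨i, rfl⟩, rfl⟩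
    rw [hρX]
    exact Ideal.mul_mem_left _ _ (Ideal.mem_span_singleton_self _)
  have hρp : ρ p = algebraMap k (PowerSeries k)
      (MvPolynomial.eval (Fin.cons 1 (fun i => (l i : k))) p) * PowerSeries.X ^ e := by
    rw [← aeval_smul_of_isHomogeneous hp]
    have : ρ.comp (MvPolynomial.coeToMvPowerSeries.algHom k) = MvPolynomial.aeval
        (fun i => algebraMap k (PowerSeries k)
          ((Fin.cons 1 (fun i => (l i : k)) : Fin (b + 1) → k) i) * PowerSeries.X) := by
      apply MvPolynomial.algHom_ext
      intro i
      simp [hρX]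
    have h := DFunLike.congr_fun this p
    simpa using h
  rw [map_sub, hρ, zero_sub, hρp, Ideal.span_singleton_pow, Ideal.mem_span_singleton, dvd_neg,
    PowerSeries.X_pow_dvd_iff] at hmem
  simpa [PowerSeries.coeff_X_pow] using hmem e (Nat.lt_succ_self e)

end Specialize

namespace Specialize
open MvPowerSeries

lemma algebraicIndepOn_range {σ B : Type*} [CommRing B] (x : σ → B) (χ : MvPolynomial σ ℤ →+* B)
    (hχ : Function.Injective χ) (hx : ∀ i, χ (MvPolynomial.X i) = x i) :
    AlgebraicIndepOn ℤ id (Set.range x) := by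
  have h : (MvPolynomial.aeval (R := ℤ) x).toRingHom = χ := by
    apply MvPolynomial.ringHom_ext
    · intro n
      exact DFunLike.congr_fun (Subsingleton.elim
        ((MvPolynomial.aeval (R := ℤ) x).toRingHom.comp MvPolynomial.C) (χ.comp MvPolynomial.C)) n
    · intro i
      simp [hx]
  have : AlgebraicIndependent ℤ x := by
    intro p q hpq
    have h1 : (MvPolynomial.aeval (R := ℤ) x).toRingHom p =
      (MvPolynomial.aeval (R := ℤ) x).toRingHom q := hpq
    rw [h] at h1
    exact hχ h1
  exact this.coe_range

theorem exists_generic_point_of_injective {σ B : Type*} [Finite σ] [CommRing B] [IsDomain B]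
    [CharZero B] (x : σ → B) (χ : MvPolynomial σ ℤ →+* B) (hχ : Function.Injective χ)
    (hx : ∀ i, χ (MvPolynomial.X i) = x i) (E : Set B) (hE : E.Finite) :
    ∃ u : Set B, u.Finite ∧ Set.range x ⊆ u ∧ ∃ ψ : MvPolynomial u ℤ →+* B,
      (∀ i, ψ (MvPolynomial.X i) = i) ∧ ∃ (θ : B) (F : Polynomial (MvPolynomial u ℤ))
        (H : MvPolynomial u ℤ), F.eval₂ ψ θ = 0 ∧ F.derivative.eval₂ ψ θ ≠ 0 ∧ ψ H ≠ 0 ∧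
        (∀ Q : Polynomial (MvPolynomial u ℤ), Q.eval₂ ψ θ = 0 →
          ∃ N : ℕ, F ∣ Polynomial.C H ^ N * Q) ∧
        ∀ c ∈ E, ∃ G : Polynomial (MvPolynomial u ℤ), ψ H * c = G.eval₂ ψ θ := by
  obtain ⟨u, hu, hxu, θ, F, H, h⟩ := exists_generic_point (Set.range x) E (Set.finite_range x) hE
    (algebraicIndepOn_range x χ hχ hx)
  exact ⟨u, hu, hxu, _, fun i => by simp, θ, F, H, h⟩

lemma exists_injective_X (σ k : Type*) [Field k] [CharZero k] :
    ∃ χ : MvPolynomial σ ℤ →+* MvPowerSeries σ k, Function.Injective χ ∧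
      ∀ i, χ (MvPolynomial.X i) = X i :=
  ⟨(MvPolynomial.coeToMvPowerSeries.ringHom).comp (MvPolynomial.map (Int.castRingHom k)),
    fun _ _ h => MvPolynomial.map_injective (Int.castRingHom k) (RingHom.injective_int _)
      (MvPolynomial.coe_injective _ _ h), fun i => by simp⟩

/-- The substitution `X₀ ↦ X₀`, `Xᵢ₊₁ ↦ Xᵢ₊₁ + lᵢ X₀`. -/
noncomputable def shearFun {b : ℕ} (k : Type*) [CommRing k] (l : Fin b → ℤ) :
    Fin (b + 1) → MvPowerSeries (Fin (b + 1)) k :=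
  Fin.cons (X 0) (fun i => X i.succ + (l i : MvPowerSeries (Fin (b + 1)) k) * X 0)

lemma hasSubst_shearFun {b : ℕ} (k : Type*) [CommRing k] (l : Fin b → ℤ) :
    HasSubst (shearFun k l) := by
  refine hasSubst_of_constantCoeff_zero fun i => ?_
  refine Fin.cases ?_ (fun j => ?_) i <;> simp [shearFun]

noncomputable def shear {b : ℕ} (k : Type*) [CommRing k] (l : Fin b → ℤ) :
    MvPowerSeries (Fin (b + 1)) k →ₐ[k] MvPowerSeries (Fin (b + 1)) k :=
  substAlgHom (hasSubst_shearFun k l)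

lemma shear_X_zero {b : ℕ} (k : Type*) [CommRing k] (l : Fin b → ℤ) :
    shear k l (X 0) = X 0 :=
  substAlgHom_X _ _

lemma shear_X_succ {b : ℕ} (k : Type*) [CommRing k] (l : Fin b → ℤ) (i : Fin b) :
    shear k l (X i.succ) = X i.succ + (l i : MvPowerSeries (Fin (b + 1)) k) * X 0 :=
  substAlgHom_X _ _

lemma shear_neg_shear {b : ℕ} (k : Type*) [CommRing k] (l : Fin b → ℤ)
    (f : MvPowerSeries (Fin (b + 1)) k) : shear k (-l) (shear k l f) = f := by
  have h : (fun i => substAlgHom (R := k) (hasSubst_shearFun k (-l)) (shearFun k l i)) =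
      (X : Fin (b + 1) → MvPowerSeries (Fin (b + 1)) k) := by
    funext i
    change shear k (-l) _ = _
    refine Fin.cases ?_ (fun j => ?_) i
    · simp [shearFun, shear_X_zero]
    · simp [shearFun, shear_X_zero, shear_X_succ]
  unfold shear
  rw [substAlgHom_comp_substAlgHom_apply, substAlgHom_apply, h, subst_self, id]

lemma shear_injective {b : ℕ} (k : Type*) [CommRing k] (l : Fin b → ℤ) :
    Function.Injective (shear k l) :=
  Function.LeftInverse.injective (shear_neg_shear k l)

/-- Power series in `b + 1` variables as power series in one variable, after a shear. -/
noncomputable def shearEquiv {b : ℕ} (k : Type*) [CommRing k] (l : Fin b → ℤ) :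
    MvPowerSeries (Fin (b + 1)) k →ₐ[k] PowerSeries (MvPowerSeries (Fin b) k) :=
  (finSuccEquiv k b).toAlgHom.comp (shear k l)

lemma shearEquiv_X_zero {b : ℕ} (k : Type*) [CommRing k] (l : Fin b → ℤ) :
    shearEquiv k l (X 0) = PowerSeries.X := by
  simp [shearEquiv, shear_X_zero, finSuccEquiv_X_zero]

lemma shearEquiv_X_succ {b : ℕ} (k : Type*) [CommRing k] (l : Fin b → ℤ) (i : Fin b) :
    shearEquiv k l (X i.succ) =
      PowerSeries.C (X i) + (l i : PowerSeries (MvPowerSeries (Fin b) k)) * PowerSeries.X := by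
  simp [shearEquiv, shear_X_succ, finSuccEquiv_X_zero, finSuccEquiv_X_succ]

lemma exists_shearEquiv_inverse {b : ℕ} (k : Type*) [CommRing k] (l : Fin b → ℤ) :
    ∃ β : PowerSeries (MvPowerSeries (Fin b) k) →+* MvPowerSeries (Fin (b + 1)) k,
      Function.Injective β ∧ β PowerSeries.X = X 0 ∧ ∀ i : Fin b,
        β (PowerSeries.C (X i) + (l i : PowerSeries (MvPowerSeries (Fin b) k)) *
          PowerSeries.X) = X i.succ := by
  refine ⟨(shear k (-l)).toRingHom.comp (finSuccEquiv k b).symm.toAlgHom.toRingHom,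
    (shear_injective k (-l)).comp (finSuccEquiv k b).symm.injective, ?_, fun i => ?_⟩
  · change shear k (-l) ((finSuccEquiv k b).symm _) = _
    rw [← finSuccEquiv_X_zero, AlgEquiv.symm_apply_apply, shear_X_zero]
  · change shear k (-l) ((finSuccEquiv k b).symm _) = _
    rw [← finSuccEquiv_X_succ, ← finSuccEquiv_X_zero, map_add, map_mul, map_intCast,
      AlgEquiv.symm_apply_apply, AlgEquiv.symm_apply_apply, map_add, map_mul, map_intCast,
      shear_X_succ, shear_X_zero]
    simp

lemma map_residue_ne_zero {b : ℕ} {k : Type*} [Field k]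
    (f : PowerSeries (MvPowerSeries (Fin b) k))
    (h : f.map (constantCoeff : MvPowerSeries (Fin b) k →+* k) ≠ 0) :
    f.map (residue (MvPowerSeries (Fin b) k)) ≠ 0 := by
  intro h0
  apply h
  ext n
  have h1 := congrArg (PowerSeries.coeff n) h0
  rw [PowerSeries.coeff_map, map_zero, residue_eq_zero_iff] at h1
  rw [PowerSeries.coeff_map, map_zero]
  by_contra hne
  exact (mem_maximalIdeal _).mp h1 (isUnit_iff_constantCoeff.mpr (isUnit_iff_ne_zero.mpr hne))

/-- After a suitable integral shear a nonzero power series is regular in the first variable. -/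
theorem exists_map_shearEquiv_ne_zero {b : ℕ} {k : Type*} [Field k] [CharZero k]
    {f : MvPowerSeries (Fin (b + 1)) k} (hf : f ≠ 0) :
    ∃ l : Fin b → ℤ, (shearEquiv k l f).map (residue (MvPowerSeries (Fin b) k)) ≠ 0 := by
  obtain ⟨l, hl⟩ := exists_line_ne_zero hf
  let κ : PowerSeries (MvPowerSeries (Fin b) k) →ₐ[k] PowerSeries k :=
    { PowerSeries.map (constantCoeff : MvPowerSeries (Fin b) k →+* k) with
      commutes' := fun r => by
        ext n
        simp only [PowerSeries.algebraMap_apply, RingHom.toMonoidHom_eq_coe,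
          OneHom.toFun_eq_coe, MonoidHom.toOneHom_coe, MonoidHom.coe_coe, PowerSeries.map_C]
        simp [MvPowerSeries.algebraMap_apply] }
  have hκ : ∀ f, κ f = PowerSeries.map (constantCoeff : MvPowerSeries (Fin b) k →+* k) f :=
    fun f => rfl
  refine ⟨l, map_residue_ne_zero _ ?_⟩
  rw [← hκ]
  refine hl (κ.comp (shearEquiv k l)) ?_ fun i => ?_
  · rw [AlgHom.comp_apply, shearEquiv_X_zero, hκ, PowerSeries.map_X]
  · rw [AlgHom.comp_apply, shearEquiv_X_succ, map_add, map_mul, map_intCast, hκ, hκ,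
      PowerSeries.map_X, PowerSeries.map_C, constantCoeff_X, map_zero, zero_add]

end Specialize

namespace Specialize
open MvPowerSeries

/-- Finitely many power series in `b` variables over a field of characteristic zero can be
specialized to power series over a field of positive characteristic. -/
def HasSpecializations (b : ℕ) : Prop :=
  ∀ (k : Type u) [Field k] [CharZero k] (E : Set (MvPowerSeries (Fin b) k)), E.Finite →
    ∃ (p : ℕ) (k' : Type u) (_ : Field k') (_ : CharP k' p) (C : Subring (MvPowerSeries (Fin b) k))
      (σ : C →+* MvPowerSeries (Fin b) k'), p.Prime ∧ E ⊆ C ∧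
      ∀ i, ∃ h : X i ∈ C, σ ⟨X i, h⟩ = X i

lemma coe_map_linear {K P : Type*} [CommRing K] [CommRing P] (σ : K →+* P) (y : K) (n : ℤ) :
    (((Polynomial.C y + (n : Polynomial K) * Polynomial.X).map σ : Polynomial P) : PowerSeries P) =
      PowerSeries.C (σ y) + (n : PowerSeries P) * PowerSeries.X := by
  have h : (((n : Polynomial P)) : PowerSeries P) = n :=
    map_intCast (Polynomial.coeToPowerSeries.ringHom (R := P)) n
  rw [Polynomial.map_add, Polynomial.map_mul, Polynomial.map_C, Polynomial.map_X,
    Polynomial.map_intCast, Polynomial.coe_add, Polynomial.coe_mul, Polynomial.coe_C,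
    Polynomial.coe_X, h]

theorem hasSpecializations_succ {b : ℕ} (ih : HasSpecializations.{u} b) :
    HasSpecializations.{u} (b + 1) := by
  intro k _ _ E hE
  have : CharZero (MvPowerSeries (Fin (b + 1)) k) :=
    ⟨fun m n h => Nat.cast_injective (R := k) (by simpa using congrArg constantCoeff h)⟩
  have : IsDomain (MvPowerSeries (Fin (b + 1)) k) := NoZeroDivisors.to_isDomain _
  obtain ⟨χ, hχ, hχX⟩ := exists_injective_X (Fin (b + 1)) k
  obtain ⟨u, hu, hXu, ψ, hψX, θ, F, H, hF, hF', hH, hD, hG⟩ :=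
    exists_generic_point_of_injective X χ hχ hχX E hE
  choose! G hG using hG
  have hΔ : X 0 * ψ H * F.derivative.eval₂ ψ θ ≠ 0 := by
    refine mul_ne_zero (mul_ne_zero ?_ hH) hF'
    intro h
    simpa using congrArg (coeff (Finsupp.single 0 1)) h
  obtain ⟨l, hl⟩ := exists_map_shearEquiv_ne_zero hΔ
  have hΦ0 := shearEquiv_X_zero k l
  have hΦs := shearEquiv_X_succ k l
  generalize shearEquiv k l = Φ at hl hΦ0 hΦs
  have hΔ' : (PowerSeries.X * Φ.toRingHom.comp ψ H *
      F.derivative.eval₂ (Φ.toRingHom.comp ψ) (Φ θ)).map (residue _) ≠ 0 := by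
    rw [map_mul Φ, map_mul Φ, hΦ0] at hl
    have h2 : Φ (F.derivative.eval₂ ψ θ) = F.derivative.eval₂ (Φ.toRingHom.comp ψ) (Φ θ) :=
      Polynomial.hom_eval₂ _ _ Φ.toRingHom _
    rwa [h2] at hl
  have : IsDomain (MvPowerSeries (Fin b) k) := NoZeroDivisors.to_isDomain _
  have : Finite u := hu
  have : Finite E := hE
  obtain ⟨E₁, hE₁, hK⟩ := exists_finite_coeffs (Φ.toRingHom.comp ψ) (Φ θ) F H
    (fun j : E => G j) (fun j : E => Φ j)
    (by
      have := Polynomial.hom_eval₂ F ψ Φ.toRingHom θ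
      rw [hF, map_zero] at this
      exact this.symm)
    (fun j => by
      have h1 := congrArg Φ (hG j j.2)
      rw [map_mul] at h1
      exact h1.trans (Polynomial.hom_eval₂ _ ψ Φ.toRingHom θ)) hΔ'
  obtain ⟨p, k', _, _, C₁, σ₁, hp, hEC, hX⟩ := ih k E₁ hE₁
  have : IsDomain (MvPowerSeries (Fin b) k') := NoZeroDivisors.to_isDomain _
  have : IsDomain (MvPowerSeries (Fin (b + 1)) k') := NoZeroDivisors.to_isDomain _
  obtain ⟨φ', θ', c', hFφ, hHφ, hcφ, hφX⟩ := hK C₁ hEC (MvPowerSeries (Fin b) k') σ₁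
  obtain ⟨β, hβi, hβ0, hβs⟩ := exists_shearEquiv_inverse k' l
  have hβφ : ∀ i (hi : X i ∈ u), β (φ' (MvPolynomial.X ⟨X i, hi⟩)) = X i := by
    intro i
    refine Fin.cases (fun hi => ?_) (fun j hi => ?_) i
    · have h1 := hφX ⟨X 0, hi⟩ Polynomial.X (by
        rw [Polynomial.map_X, Polynomial.coe_X, RingHom.comp_apply, hψX]
        exact hΦ0)
      rw [h1, Polynomial.map_X, Polynomial.coe_X, hβ0]
    · obtain ⟨hj, hσj⟩ := hX j
      have h1 := hφX ⟨X j.succ, hi⟩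
        (Polynomial.C ⟨X j, hj⟩ + (l j : Polynomial C₁) * Polynomial.X) (by
        rw [RingHom.comp_apply, hψX]
        rw [coe_map_linear]
        exact hΦs j)
      rw [h1, ← hβs, coe_map_linear, hσj]
  obtain ⟨K, σ, hKσ⟩ := exists_subring_hom ψ (β.comp φ') F H θ (β θ') hD
    (by rw [← Polynomial.hom_eval₂, hFφ, map_zero])
    (by rw [RingHom.comp_apply]; exact (map_ne_zero_iff β hβi).mpr hHφ)
  refine ⟨p, k', _, ‹_›, K, σ, hp, fun c hc => (hKσ c (β (c' ⟨c, hc⟩)) ⟨G c, hG c hc, ?_⟩).1,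
    fun i => hKσ (X i) (X i) ⟨Polynomial.C (H * MvPolynomial.X ⟨X i, hXu ⟨i, rfl⟩⟩), ?_, ?_⟩⟩
  · rw [← Polynomial.hom_eval₂, ← hcφ ⟨c, hc⟩, map_mul, RingHom.comp_apply]
  · rw [Polynomial.eval₂_C, map_mul, hψX]
  · rw [Polynomial.eval₂_C, map_mul, RingHom.comp_apply, RingHom.comp_apply, hβφ]

end Specialize

namespace Specialize

lemma isJacobsonRing_int : IsJacobsonRing ℤ := by
  rw [isJacobsonRing_iff_prime_eq]
  intro P hP
  by_cases h : P = ⊥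
  · subst h
    rw [eq_bot_iff]
    intro x hx
    rw [Ideal.mem_jacobson_bot] at hx
    have h1 := Int.isUnit_iff.mp (hx x)
    have h2 := Int.isUnit_iff.mp (hx 3)
    have : 0 ≤ x * x := mul_self_nonneg x
    change x = 0
    rcases h1 with h1 | h1
    · simpa using h1
    · omega
  · have := hP.isMaximal h
    exact Ideal.jacobson_eq_self_of_isMaximal

lemma exists_charP_of_finiteType {K : Type*} [Field K] (f : ℤ →+* K)
    (hf : f.FiniteType) :
    ∃ p : ℕ, p.Prime ∧ CharP K p := by
  have := isJacobsonRing_int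
  rw [Subsingleton.elim f (algebraMap ℤ K), RingHom.finiteType_algebraMap] at hf
  have hfin : Module.Finite ℤ K := finite_of_finite_type_of_isJacobsonRing ℤ K
  obtain ⟨p, hp⟩ := CharP.exists K
  rcases CharP.char_is_prime_or_zero K p with h | h
  · exact ⟨p, h, hp⟩
  · subst h
    have : CharZero K := CharP.charP_to_charZero K
    have h_integral : Algebra.IsIntegral ℤ K := inferInstance
    have h1 := isField_of_isIntegral_of_isField (R := ℤ) (S := K)
      (RingHom.injective_int (algebraMap ℤ K)) (Field.toIsField K)
    exact absurd h1 Int.not_isField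

lemma exists_finiteType_reduction {B : Type u} [CommRing B] [Nontrivial B] (E : Set B)
    (hE : E.Finite) : ∃ (p : ℕ) (k' : Type u) (_ : Field k') (_ : CharP k' p) (C : Subring B)
      (_ : C →+* k'), p.Prime ∧ E ⊆ C := by
  have hft : Algebra.FiniteType ℤ (Algebra.adjoin ℤ E) :=
    (Subalgebra.fg_iff_finiteType _).mp (Subalgebra.fg_def.mpr ⟨E, hE, rfl⟩)
  obtain ⟨M, hM⟩ := Ideal.exists_maximal (Algebra.adjoin ℤ E)
  let _ : Field (Algebra.adjoin ℤ E ⧸ M) := Ideal.Quotient.field M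
  obtain ⟨p, hp, hc⟩ := exists_charP_of_finiteType
    ((Ideal.Quotient.mk M).comp (algebraMap ℤ (Algebra.adjoin ℤ E)))
    (RingHom.FiniteType.comp_surjective (RingHom.finiteType_algebraMap.mpr hft)
      Ideal.Quotient.mk_surjective)
  exact ⟨p, _, _, hc, (Algebra.adjoin ℤ E).toSubring, Ideal.Quotient.mk M, hp,
    Algebra.subset_adjoin⟩

theorem hasSpecializations (b : ℕ) : HasSpecializations.{u} b := by
  induction b with
  | zero =>
    intro k _ _ E hE
    obtain ⟨p, k', _, hc, C, σ, hp, hEC⟩ := exists_finiteType_reduction E hE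
    exact ⟨p, k', _, hc, C, MvPowerSeries.C.comp σ, hp, hEC, fun i => i.elim0⟩
  | succ b ih => exact hasSpecializations_succ ih

end Specialize

namespace Specialize

lemma charZero_residueField {S : Type*} [CommRing S] [IsLocalRing S]
    (h0 : ∀ p : ℕ, p.Prime → (p : S) ∉ maximalIdeal S) : CharZero (ResidueField S) := by
  obtain ⟨q, hq⟩ := CharP.exists (ResidueField S)
  rcases CharP.char_is_prime_or_zero (ResidueField S) q with hp | hp
  · refine absurd ?_ (h0 q hp)
    rw [← residue_eq_zero_iff, map_natCast]
    exact CharP.cast_eq_zero _ q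
  · subst hp
    exact CharP.charP_to_charZero _

lemma isUnit_natCast {S : Type*} [CommRing S] [IsLocalRing S]
    (h0 : ∀ p : ℕ, p.Prime → (p : S) ∉ maximalIdeal S) (n : ℕ) (hn : n ≠ 0) :
    IsUnit (n : S) := by
  have := charZero_residueField h0
  rw [← residue_ne_zero_iff_isUnit, map_natCast]
  exact_mod_cast hn

lemma formallySmooth_of_charZero (K L : Type*) [Field K] [Field L] [Algebra K L] [CharZero K] :
    Algebra.FormallySmooth K L := by
  obtain ⟨s, hs⟩ := exists_isTranscendenceBasis K L
  have h1 := hs.isAlgebraic_field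
  have h2 : CharZero (IntermediateField.adjoin K (Set.range ((↑) : s → L))) :=
    charZero_of_injective_algebraMap (algebraMap K _).injective
  have h3 : Algebra.IsSeparable (IntermediateField.adjoin K (Set.range ((↑) : s → L))) L :=
    Algebra.IsAlgebraic.isSeparable_of_perfectField
  exact .of_algebraicIndependent_of_isSeparable hs.1

/-- A compatible system of coefficient fields in the quotients by powers of the maximal ideal. -/
lemma exists_coefficient_system {S : Type u} [CommRing S] [IsLocalRing S]
    (h0 : ∀ p : ℕ, p.Prime → (p : S) ∉ maximalIdeal S) :
    ∃ s : ∀ m : ℕ, ResidueField S →+* S ⧸ maximalIdeal S ^ m,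
      (∀ (m n : ℕ) (h : m ≤ n), (Ideal.Quotient.factorPow (maximalIdeal S) h).comp (s n) = s m) ∧
      ∀ (m : ℕ) (a : S), ∃ (c : ResidueField S) (a' : S),
        s m c = Ideal.Quotient.mk _ a' ∧ a - a' ∈ maximalIdeal S := by
  have hz := charZero_residueField h0
  let ι : ℤ →+* S := Int.castRingHom S
  have hu : ∀ y : nonZeroDivisors ℤ, IsUnit (ι y) := by
    rintro ⟨y, hy⟩
    have hy0 : y.natAbs ≠ 0 := by simpa using nonZeroDivisors.ne_zero hy
    have h := isUnit_natCast h0 _ hy0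
    change IsUnit ((y : ℤ) : S)
    rcases Int.natAbs_eq y with e | e
    · rw [e, Int.cast_natCast]
      exact h
    · rw [e, Int.cast_neg, Int.cast_natCast]
      exact h.neg
  let _ : Algebra ℚ S := (IsLocalization.lift hu : ℚ →+* S).toAlgebra
  let f : ResidueField S →ₐ[ℚ] S ⧸ maximalIdeal S :=
    { RingHom.id (ResidueField S) with
      commutes' := fun r => RingHom.congr_fun (Subsingleton.elim
        ((RingHom.id (ResidueField S)).comp (algebraMap ℚ (ResidueField S)))
        (algebraMap ℚ (S ⧸ maximalIdeal S))) r }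
  have hsm := formallySmooth_of_charZero ℚ (ResidueField S)
  obtain ⟨g, hg⟩ := Algebra.FormallySmooth.exists_adicCompletionEvalOneₐ_comp_eq f
  have hg' : ∀ c : ResidueField S, AdicCompletion.evalOneₐ (maximalIdeal S) (g c) = c :=
    fun c => DFunLike.congr_fun hg c
  refine ⟨fun m => ((AdicCompletion.evalₐ (maximalIdeal S) m : _ →+* _)).comp g.toRingHom, ?_, ?_⟩
  · intro m n h
    ext c
    obtain ⟨y, hy⟩ := AdicCompletion.mk_surjective (maximalIdeal S) S (g c)
    change Ideal.Quotient.factorPow (maximalIdeal S) h (AdicCompletion.evalₐ (maximalIdeal S) n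
      (g c)) = AdicCompletion.evalₐ (maximalIdeal S) m (g c)
    rw [← hy, AdicCompletion.evalₐ_mk, AdicCompletion.evalₐ_mk]
    exact AdicCompletion.Ideal.mk_eq_mk (maximalIdeal S) h y
  · intro m a
    refine ⟨residue S a, ?_⟩
    rcases Nat.eq_zero_or_pos m with rfl | hm
    · refine ⟨a, ?_, by simp⟩
      have : Subsingleton (S ⧸ maximalIdeal S ^ 0) :=
        Ideal.Quotient.subsingleton_iff.mpr (by simp)
      exact Subsingleton.elim _ _
    · obtain ⟨y, hy⟩ := AdicCompletion.mk_surjective (maximalIdeal S) S (g (residue S a))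
      refine ⟨y.val m, ?_, ?_⟩
      · change AdicCompletion.evalₐ (maximalIdeal S) m (g (residue S a)) = _
        rw [← hy, AdicCompletion.evalₐ_mk]
      · have h1 := hg' (residue S a)
        rw [← AdicCompletion.factorₐ_evalₐ_one, ← hy, AdicCompletion.evalₐ_mk,
          ← AdicCompletion.Ideal.mk_eq_mk (maximalIdeal S) hm y] at h1
        exact Ideal.Quotient.eq.mp h1.symm

end Specialize

namespace Specialize

lemma eval₂_mul_of_isHomogeneous {σ k A : Type*} [CommRing k] [CommRing A]
    {p : MvPolynomial σ k} {e : ℕ} (hp : p.IsHomogeneous e) (φ : k →+* A) (c : σ → k) (t : A) :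
    MvPolynomial.eval₂ φ (fun i => φ (c i) * t) p = φ (MvPolynomial.eval c p) * t ^ e := by
  let _ : Algebra k A := φ.toAlgebra
  exact aeval_smul_of_isHomogeneous hp c t

lemma exists_pow_mem_span {b e : ℕ} {k A : Type*} [Field k] [CharZero k] [CommRing A]
    {p : MvPolynomial (Fin (b + 1)) k} (hp : p.IsHomogeneous e) (h0 : p ≠ 0)
    (φ : k →+* A) (v : Fin (b + 1) → A) (hv : MvPolynomial.eval₂ φ v p = 0) :
    ∃ l : Fin b → ℤ, v 0 ^ e ∈ Ideal.span (Set.range fun i : Fin b => v i.succ - (l i : A) * v 0) := by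
  obtain ⟨l, hl⟩ := exists_int_eval_ne_zero hp h0
  refine ⟨l, ?_⟩
  set J := Ideal.span (Set.range fun i : Fin b => v i.succ - (l i : A) * v 0) with hJ
  let π : A →+* A ⧸ J := Ideal.Quotient.mk J
  let c : Fin (b + 1) → k := Fin.cons 1 fun i => (l i : k)
  have h1 := congrArg π hv
  rw [MvPolynomial.hom_eval₂, map_zero] at h1
  have h2 : (fun i => π (v i)) = fun i => (π.comp φ) (c i) * π (v 0) := by
    ext i
    refine Fin.cases ?_ (fun j => ?_) i
    · simp [c]
    · have h3 : π (v j.succ - (l j : A) * v 0) = 0 :=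
        Ideal.Quotient.eq_zero_iff_mem.mpr (Ideal.subset_span ⟨j, rfl⟩)
      rw [map_sub, map_mul, map_intCast, sub_eq_zero] at h3
      simp only [c, Fin.cons_succ, map_intCast]
      exact h3
  rw [h2, eval₂_mul_of_isHomogeneous hp] at h1
  have hu : IsUnit ((π.comp φ) (MvPolynomial.eval c p)) := (isUnit_iff_ne_zero.mpr hl).map _
  rw [hu.mul_right_eq_zero, ← map_pow] at h1
  exact Ideal.Quotient.eq_zero_iff_mem.mp h1

lemma sup_pow_le_sup {A : Type*} [CommRing A] (J K : Ideal A) (e : ℕ) :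
    (J ⊔ K) ^ e ≤ J ⊔ K ^ e := by
  induction e with
  | zero => simp
  | succ e ih =>
    have h1 : (J ⊔ K) ^ e * J ≤ J := Ideal.mul_le_right
    have h2 : J * K ≤ J := Ideal.mul_le_left
    calc (J ⊔ K) ^ (e + 1) = (J ⊔ K) ^ e * J ⊔ (J ⊔ K) ^ e * K := by rw [pow_succ, Ideal.mul_sup]
      _ ≤ J ⊔ (J ⊔ K ^ e) * K := sup_le_sup h1 (Ideal.mul_mono_left ih)
      _ = J ⊔ (J * K ⊔ K ^ (e + 1)) := by rw [Ideal.sup_mul, pow_succ]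
      _ ≤ J ⊔ K ^ (e + 1) := sup_le le_sup_left (sup_le (h2.trans le_sup_left) le_sup_right)

/-- Forms over a coefficient field do not vanish on a regular system of parameters. -/
lemma eval₂_ne_zero_of_isHomogeneous {S : Type*} [CommRing S] [IsLocalRing S] [IsNoetherianRing S]
    {k : Type*} [Field k] [CharZero k] {n e : ℕ} (x : Fin n → S)
    (hx : Ideal.span (Set.range x) = maximalIdeal S) (hn : (n : ℕ∞) ≤ (maximalIdeal S).height)
    (φ : k →+* S ⧸ maximalIdeal S ^ (e + 1)) {p : MvPolynomial (Fin n) k}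
    (hp : p.IsHomogeneous e) (h0 : p ≠ 0) :
    MvPolynomial.eval₂ φ (fun i => Ideal.Quotient.mk _ (x i)) p ≠ 0 := by
  intro hv
  cases n with
  | zero =>
    obtain ⟨c, rfl⟩ := MvPolynomial.C_surjective (Fin 0) p
    have hc : c ≠ 0 := by rintro rfl; exact h0 (map_zero _)
    have : Nontrivial (S ⧸ maximalIdeal S ^ (e + 1)) := by
      rw [Ideal.Quotient.nontrivial_iff]
      intro h
      exact (maximalIdeal.isMaximal S).ne_top (top_le_iff.mp (h ▸ Ideal.pow_le_self (by omega)))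
    rw [MvPolynomial.eval₂_C] at hv
    exact hc ((map_eq_zero φ).mp hv)
  | succ b =>
    obtain ⟨l, hl⟩ := exists_pow_mem_span hp h0 φ _ hv
    set w : Fin b → S := fun i => x i.succ - (l i : S) * x 0 with hw
    set J := Ideal.span (Set.range w) with hJ
    have hxm : ∀ i, x i ∈ maximalIdeal S := fun i => hx ▸ Ideal.subset_span ⟨i, rfl⟩
    have hJm : J ≤ maximalIdeal S := by
      rw [hJ, Ideal.span_le]
      rintro _ ⟨i, rfl⟩
      exact sub_mem (hxm _) (Ideal.mul_mem_left _ _ (hxm 0))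
    have hm : maximalIdeal S = J ⊔ Ideal.span {x 0} := by
      refine le_antisymm ?_ (sup_le hJm (by simpa [Ideal.span_le] using hxm 0))
      rw [← hx, Ideal.span_le]
      rintro _ ⟨i, rfl⟩
      have h00 : x 0 ∈ J ⊔ Ideal.span {x 0} := Ideal.mem_sup_right (Ideal.mem_span_singleton_self _)
      refine Fin.cases h00 (fun j => ?_) i
      have h1 : w j ∈ J ⊔ Ideal.span {x 0} := Ideal.mem_sup_left (Ideal.subset_span ⟨j, rfl⟩)
      have h2 : x j.succ = w j + (l j : S) * x 0 := by simp [hw]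
      rw [h2]
      exact add_mem h1 (Ideal.mul_mem_left _ _ h00)
    have hpow : x 0 ^ e ∈ J ⊔ maximalIdeal S ^ (e + 1) := by
      rw [← Ideal.mem_quotient_iff_mem_sup, hJ, Ideal.map_span, ← Set.range_comp, map_pow]
      have h5 : (Ideal.Quotient.mk (maximalIdeal S ^ (e + 1)) : S → _) ∘ w = fun i =>
          Ideal.Quotient.mk _ (x i.succ) - ((l i : ℤ) : S ⧸ maximalIdeal S ^ (e + 1)) *
            Ideal.Quotient.mk _ (x 0) := by
        ext i
        simp only [hw, Function.comp_apply, map_sub, map_mul, map_intCast]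
      rw [h5]
      exact hl
    have hle : maximalIdeal S ^ e ≤ J ⊔ maximalIdeal S • maximalIdeal S ^ e := by
      calc maximalIdeal S ^ e = (J ⊔ Ideal.span {x 0}) ^ e := by rw [← hm]
        _ ≤ J ⊔ Ideal.span {x 0} ^ e := sup_pow_le_sup _ _ _
        _ ≤ J ⊔ maximalIdeal S • maximalIdeal S ^ e := by
          refine sup_le le_sup_left ?_
          rw [Ideal.span_singleton_pow, Ideal.span_singleton_le_iff_mem, smul_eq_mul, ← pow_succ']
          exact hpow
    have hJe : maximalIdeal S ^ e ≤ J :=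
      Submodule.le_of_le_smul_of_le_jacobson_bot (IsNoetherian.noetherian _)
        (maximalIdeal_le_jacobson _) hle
    have hmin : maximalIdeal S ∈ J.minimalPrimes := by
      refine ⟨⟨inferInstance, hJm⟩, fun P hP _ => ?_⟩
      have := hP.1
      exact Ideal.IsPrime.le_of_pow_le (hJe.trans hP.2)
    have h1 := Ideal.height_le_card_of_mem_minimalPrimes_span (Set.finite_range w) hmin
    have h2 : (Set.range w).ncard ≤ b := by
      rw [← Set.image_univ]
      refine (Set.ncard_image_le Set.finite_univ).trans ?_
      simp [Set.ncard_univ]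
    have h3 : ((b + 1 : ℕ) : ℕ∞) ≤ (b : ℕ) := (hn.trans h1).trans (by exact_mod_cast h2)
    have h4 : b + 1 ≤ b := by exact_mod_cast h3
    omega

lemma eval₂_eq_zero_of_mem_pow {σ k A : Type*} [CommRing k] [CommRing A] (I : Ideal A) (m : ℕ)
    (φ : k →+* A ⧸ I ^ m) (v : σ → A) (hv : ∀ i, v i ∈ I) (p : MvPolynomial σ k)
    (hp : p ∈ MvPolynomial.idealOfVars σ k ^ m) :
    MvPolynomial.eval₂ φ (fun i => Ideal.Quotient.mk _ (v i)) p = 0 := by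
  let τ := MvPolynomial.eval₂Hom φ (fun i => Ideal.Quotient.mk (I ^ m) (v i))
  have h1 : Ideal.map τ (MvPolynomial.idealOfVars σ k) ≤ Ideal.map (Ideal.Quotient.mk (I ^ m)) I := by
    rw [MvPolynomial.idealOfVars, Ideal.map_span, Ideal.span_le]
    rintro _ ⟨_, ⟨i, rfl⟩, rfl⟩
    simp only [τ, MvPolynomial.coe_eval₂Hom, MvPolynomial.eval₂_X]
    exact Ideal.mem_map_of_mem _ (hv i)
  have h2 : τ p ∈ Ideal.map (Ideal.Quotient.mk (I ^ m)) I ^ m :=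
    Ideal.pow_right_mono h1 m (Ideal.map_pow τ _ m ▸ Ideal.mem_map_of_mem τ hp)
  rw [← Ideal.map_pow, Ideal.map_quotient_self] at h2
  exact h2

end Specialize

namespace Specialize

lemma mem_pow_of_eval₂_eq_zero {S : Type*} [CommRing S] [IsLocalRing S] [IsNoetherianRing S]
    {k : Type*} [Field k] [CharZero k] {n : ℕ} (x : Fin n → S)
    (hx : Ideal.span (Set.range x) = maximalIdeal S) (hn : (n : ℕ∞) ≤ (maximalIdeal S).height)
    (s : ∀ m : ℕ, k →+* S ⧸ maximalIdeal S ^ m)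
    (hs : ∀ (m m' : ℕ) (h : m ≤ m'),
      (Ideal.Quotient.factorPow (maximalIdeal S) h).comp (s m') = s m)
    (m : ℕ) (p : MvPolynomial (Fin n) k)
    (hp : MvPolynomial.eval₂ (s m) (fun i => Ideal.Quotient.mk _ (x i)) p = 0) :
    p ∈ MvPolynomial.idealOfVars (Fin n) k ^ m := by
  classical
  rw [MvPolynomial.mem_pow_idealOfVars_iff']
  by_contra! hcon
  have hex : ∃ e, ∃ d : Fin n →₀ ℕ, d.degree = e ∧ e < m ∧ p.coeff d ≠ 0 := by
    obtain ⟨d, hd, hd0⟩ := hcon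
    exact ⟨_, d, rfl, hd, hd0⟩
  obtain ⟨d, hde, hem, hd0⟩ := Nat.find_spec hex
  have hmin : ∀ d' : Fin n →₀ ℕ, d'.degree < Nat.find hex → p.coeff d' = 0 := by
    intro d' hd'
    by_contra h
    exact Nat.find_min hex hd' ⟨d', rfl, hd'.trans hem, h⟩
  generalize Nat.find hex = e at hde hem hmin
  have hxm : ∀ i, x i ∈ maximalIdeal S := fun i => hx ▸ Ideal.subset_span ⟨i, rfl⟩
  have h1 := congrArg (Ideal.Quotient.factorPow (maximalIdeal S) (show e + 1 ≤ m from hem)) hp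
  rw [MvPolynomial.hom_eval₂, hs, map_zero] at h1
  change MvPolynomial.eval₂ (s (e + 1)) (fun i => Ideal.Quotient.mk _ (x i)) p = 0 at h1
  have h2 : p - MvPolynomial.homogeneousComponent e p ∈
      MvPolynomial.idealOfVars (Fin n) k ^ (e + 1) := by
    rw [MvPolynomial.mem_pow_idealOfVars_iff']
    intro d' hd'
    rw [MvPolynomial.coeff_sub, MvPolynomial.coeff_homogeneousComponent]
    split_ifs with h
    · exact sub_self _
    · rw [hmin d' (by omega), sub_zero]
  have h3 := eval₂_eq_zero_of_mem_pow (maximalIdeal S) (e + 1) (s (e + 1)) x hxm _ h2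
  rw [MvPolynomial.eval₂_sub, h1, zero_sub, neg_eq_zero] at h3
  refine eval₂_ne_zero_of_isHomogeneous x hx hn (s (e + 1))
    (MvPolynomial.homogeneousComponent_isHomogeneous e p) ?_ h3
  intro h
  apply hd0
  have h4 := MvPolynomial.coeff_homogeneousComponent e p d
  rw [if_pos hde, h, MvPolynomial.coeff_zero] at h4
  exact h4.symm

lemma exists_eval₂_add {S k : Type*} [CommRing S] [CommRing k] (I : Ideal S) {n : ℕ}
    (x : Fin n → S) (hx : Ideal.span (Set.range x) = I) (m : ℕ) (φ : k →+* S ⧸ I ^ m)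
    (hφ : ∀ a : S, ∃ (c : k) (a' : S), φ c = Ideal.Quotient.mk _ a' ∧ a - a' ∈ I)
    (j : ℕ) (a : S) (ha : a ∈ I ^ j) :
    ∃ (q : MvPolynomial (Fin n) k) (b : S), b ∈ I ^ (j + 1) ∧ Ideal.Quotient.mk (I ^ m) a =
      MvPolynomial.eval₂Hom φ (fun i => Ideal.Quotient.mk _ (x i)) q + Ideal.Quotient.mk _ b := by
  induction j generalizing a with
  | zero =>
    obtain ⟨c, a', hc, ha'⟩ := hφ a
    refine ⟨MvPolynomial.C c, a - a', by simpa using ha', ?_⟩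
    rw [MvPolynomial.eval₂Hom_C, hc, ← map_add, add_sub_cancel]
  | succ j ih =>
    have h1 : a ∈ (I ^ j) • Submodule.span S (Set.range x) := by
      have h2 : Submodule.span S (Set.range x) = I := hx
      rw [h2, smul_eq_mul, ← pow_succ]
      exact ha
    obtain ⟨c, hc, rfl⟩ := (Submodule.mem_ideal_smul_span_iff_exists_sum _ _ _).mp h1
    choose q b hb hq using fun i => ih (c i) (hc i)
    refine ⟨∑ i, q i * MvPolynomial.X i, ∑ i, b i * x i, ?_, ?_⟩
    · refine Ideal.sum_mem _ fun i _ => ?_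
      rw [pow_succ]
      exact Ideal.mul_mem_mul (hb i) (hx ▸ Ideal.subset_span ⟨i, rfl⟩)
    · rw [Finsupp.sum_fintype _ _ (by simp), map_sum, map_sum, map_sum, ← Finset.sum_add_distrib]
      refine Finset.sum_congr rfl fun i _ => ?_
      rw [smul_eq_mul, map_mul, map_mul, map_mul, MvPolynomial.eval₂Hom_X', hq, add_mul]

lemma eval₂Hom_surjective {S k : Type*} [CommRing S] [CommRing k] (I : Ideal S) {n : ℕ}
    (x : Fin n → S) (hx : Ideal.span (Set.range x) = I) (m : ℕ) (φ : k →+* S ⧸ I ^ m)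
    (hφ : ∀ a : S, ∃ (c : k) (a' : S), φ c = Ideal.Quotient.mk _ a' ∧ a - a' ∈ I) :
    Function.Surjective (MvPolynomial.eval₂Hom φ (fun i => Ideal.Quotient.mk (I ^ m) (x i))) := by
  intro r
  obtain ⟨r, rfl⟩ := Ideal.Quotient.mk_surjective r
  have key : ∀ j : ℕ, ∃ (q : MvPolynomial (Fin n) k) (b : S), b ∈ I ^ j ∧
      Ideal.Quotient.mk (I ^ m) r =
      MvPolynomial.eval₂Hom φ (fun i => Ideal.Quotient.mk _ (x i)) q + Ideal.Quotient.mk _ b := by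
    intro j
    induction j with
    | zero => exact ⟨0, r, by simp, by simp⟩
    | succ j ih =>
      obtain ⟨q, b, hb, hq⟩ := ih
      obtain ⟨q', b', hb', hq'⟩ := exists_eval₂_add I x hx m φ hφ j b hb
      exact ⟨q + q', b', hb', by rw [hq, hq', map_add, add_assoc]⟩
  obtain ⟨q, b, hb, hq⟩ := key m
  exact ⟨q, by rw [hq, Ideal.Quotient.eq_zero_iff_mem.mpr hb, add_zero]⟩

lemma coe_mem_maximalIdeal_pow {σ k : Type*} [Finite σ] [Field k] (m : ℕ) (p : MvPolynomial σ k)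
    (hp : p ∈ MvPolynomial.idealOfVars σ k ^ m) :
    (p : MvPowerSeries σ k) ∈ maximalIdeal (MvPowerSeries σ k) ^ m := by
  rw [maximalIdeal_eq_span_X]
  refine mem_span_X_pow m _ fun d hd => ?_
  rw [MvPolynomial.coeff_coe]
  exact (MvPolynomial.mem_pow_idealOfVars_iff' m p).mp hp d hd

lemma exists_ringHom_of_coefficient_system {S : Type*} [CommRing S] [IsLocalRing S]
    [IsNoetherianRing S] {k : Type*} [Field k] [CharZero k] {n : ℕ} (x : Fin n → S)
    (hx : Ideal.span (Set.range x) = maximalIdeal S) (hn : (n : ℕ∞) ≤ (maximalIdeal S).height)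
    (s : ∀ m : ℕ, k →+* S ⧸ maximalIdeal S ^ m)
    (hs : ∀ (m m' : ℕ) (h : m ≤ m'),
      (Ideal.Quotient.factorPow (maximalIdeal S) h).comp (s m') = s m)
    (hφ : ∀ (m : ℕ) (a : S), ∃ (c : k) (a' : S),
        s m c = Ideal.Quotient.mk _ a' ∧ a - a' ∈ maximalIdeal S) :
    ∃ Γ : S →+* MvPowerSeries (Fin n) k, ∀ i, Γ (x i) = MvPowerSeries.X i := by
  let τ : ∀ m : ℕ, MvPolynomial (Fin n) k →+* S ⧸ maximalIdeal S ^ m := fun m =>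
    MvPolynomial.eval₂Hom (s m) (fun i => Ideal.Quotient.mk _ (x i))
  have hτ : ∀ m, Function.Surjective (τ m) := fun m =>
    eval₂Hom_surjective (maximalIdeal S) x hx m (s m) (hφ m)
  let ρ : ∀ m : ℕ, MvPolynomial (Fin n) k →+*
      MvPowerSeries (Fin n) k ⧸ maximalIdeal (MvPowerSeries (Fin n) k) ^ m := fun m =>
    (Ideal.Quotient.mk _).comp MvPolynomial.coeToMvPowerSeries.ringHom
  have hker : ∀ m, RingHom.ker (τ m) ≤ RingHom.ker (ρ m) := by
    intro m p hp
    refine Ideal.Quotient.eq_zero_iff_mem.mpr (coe_mem_maximalIdeal_pow m p ?_)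
    exact mem_pow_of_eval₂_eq_zero x hx hn s hs m p hp
  have hg : ∀ m, ∃ g : S →+* MvPowerSeries (Fin n) k ⧸ maximalIdeal (MvPowerSeries (Fin n) k) ^ m,
      ∀ r q, τ m q = Ideal.Quotient.mk _ r → g r = ρ m q := by
    intro m
    refine ⟨((τ m).liftOfSurjective (hτ m) ⟨ρ m, hker m⟩).comp (Ideal.Quotient.mk _), ?_⟩
    intro r q h
    rw [RingHom.comp_apply, ← h, RingHom.liftOfSurjective_comp_apply]
  choose g hg using hg
  have hcomp : ∀ {m m' : ℕ} (h : m ≤ m'),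
      (Ideal.Quotient.factorPow (maximalIdeal (MvPowerSeries (Fin n) k)) h).comp (g m') = g m := by
    intro m m' h
    ext r
    obtain ⟨q, hq⟩ := hτ m' (Ideal.Quotient.mk _ r)
    rw [RingHom.comp_apply, hg m' r q hq, hg m r q]
    · rfl
    · have h1 := congrArg (Ideal.Quotient.factorPow (maximalIdeal S) h) hq
      simp only [τ, MvPolynomial.coe_eval₂Hom] at h1 ⊢
      rw [MvPolynomial.hom_eval₂, hs] at h1
      exact h1
  refine ⟨IsAdicComplete.liftRingHom (maximalIdeal (MvPowerSeries (Fin n) k)) g hcomp, fun i => ?_⟩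
  have hH : IsHausdorff (maximalIdeal (MvPowerSeries (Fin n) k)) (MvPowerSeries (Fin n) k) :=
    inferInstance
  rw [← sub_eq_zero]
  refine hH.haus _ fun m => ?_
  rw [smul_eq_mul, Ideal.mul_top, SModEq.zero, ← Ideal.Quotient.eq_zero_iff_mem, map_sub,
    IsAdicComplete.mk_liftRingHom, hg m (x i) (MvPolynomial.X i), sub_eq_zero]
  · simp [ρ]
  · simp [τ]

/-- A regular local ring of residue characteristic zero maps to a formal power series ring over
its residue field, carrying a regular system of parameters to the variables. -/
theorem exists_ringHom_mvPowerSeries {S : Type u} [CommRing S] [IsLocalRing S] [IsNoetherianRing S]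
    (h0 : ∀ p : ℕ, p.Prime → (p : S) ∉ maximalIdeal S) {n : ℕ} (x : Fin n → S)
    (hx : Ideal.span (Set.range x) = maximalIdeal S) (hn : (n : ℕ∞) ≤ (maximalIdeal S).height) :
    ∃ Γ : S →+* MvPowerSeries (Fin n) (ResidueField S), ∀ i, Γ (x i) = MvPowerSeries.X i := by
  have hz := charZero_residueField h0
  obtain ⟨s, hs, hφ⟩ := exists_coefficient_system h0
  exact exists_ringHom_of_coefficient_system x hx hn s hs hφ

end Specialize

namespace Specialize
open MvPowerSeries

lemma mem_span_X_image {σ k : Type*} [Fintype σ] [CommRing k] (A : Set σ) (f : MvPowerSeries σ k) :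
    f ∈ Ideal.span (X '' A : Set (MvPowerSeries σ k)) ↔
      ∀ d : σ →₀ ℕ, (∀ j ∈ A, d j = 0) → coeff d f = 0 := by
  classical
  constructor
  · intro hf
    refine Submodule.span_induction (p := fun f _ => ∀ d : σ →₀ ℕ, (∀ j ∈ A, d j = 0) →
      coeff d f = 0) ?_ (fun d _ => map_zero _) ?_ ?_ hf
    · rintro _ ⟨j, hj, rfl⟩ d hd
      rw [coeff_X, if_neg]
      rintro rfl
      simpa using hd j hj
    · intro f g _ _ h1 h2 d hd
      rw [map_add, h1 d hd, h2 d hd, add_zero]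
    · intro a f _ h d hd
      rw [smul_eq_mul, coeff_mul]
      refine Finset.sum_eq_zero fun y hy => ?_
      rw [h y.2, mul_zero]
      intro j hj
      have h1 := DFunLike.congr_fun (Finset.HasAntidiagonal.mem_antidiagonal.mp hy) j
      rw [Finsupp.add_apply, hd j hj] at h1
      omega
  · intro hf
    have hsel : ∀ e : σ →₀ ℕ, (∃ j ∈ A, e j ≠ 0) → ∃ i, i ∈ A ∧ Finsupp.single i 1 ≤ e := by
      rintro e ⟨i, hi, h⟩
      exact ⟨i, hi, by rw [Finsupp.single_le_iff]; omega⟩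
    rcases A.eq_empty_or_nonempty with rfl | ⟨j₀, hj₀⟩
    · have : f = 0 := by
        ext e
        rw [hf e (by simp), map_zero]
      rw [this]
      exact zero_mem _
    have : Nonempty σ := ⟨j₀⟩
    choose! s hs using hsel
    let g : σ → MvPowerSeries σ k := fun i e =>
      if s (e + Finsupp.single i 1) = i then coeff (e + Finsupp.single i 1) f else 0
    have hg : ∀ i e, coeff e (g i) =
      if s (e + Finsupp.single i 1) = i then coeff (e + Finsupp.single i 1) f else 0 :=
      fun i e => rfl
    have hsum : f = ∑ i ∈ Finset.univ.filter (· ∈ A), X i * g i := by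
      ext e
      rw [map_sum]
      have key : ∀ i, coeff e (X i * g i) =
          if Finsupp.single i 1 ≤ e ∧ s e = i then coeff e f else 0 := by
        intro i
        rw [X, coeff_monomial_mul]
        by_cases h : Finsupp.single i 1 ≤ e
        · simp [h, hg, tsub_add_cancel_of_le h]
        · simp [h]
      simp_rw [key]
      by_cases he : ∃ j ∈ A, e j ≠ 0
      · rw [Finset.sum_eq_single (s e)]
        · simp [(hs e he).2]
        · intro i _ hi
          simp [hi.symm]
        · intro h
          exact absurd (Finset.mem_filter.mpr ⟨Finset.mem_univ _, (hs e he).1⟩) h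
      · push Not at he
        rw [hf e he]
        simp
    rw [hsum]
    refine Ideal.sum_mem _ fun i hi => Ideal.mul_mem_right _ _ (Ideal.subset_span ⟨i, ?_, rfl⟩)
    exact (Finset.mem_filter.mp hi).2

lemma isWeaklyRegular_X {k : Type*} [CommRing k] (n : ℕ) :
    RingTheory.Sequence.IsWeaklyRegular (MvPowerSeries (Fin n) k)
      (List.ofFn (X : Fin n → MvPowerSeries (Fin n) k)) := by
  constructor
  intro i hi
  have hin : i < n := by simpa using hi
  have hspan : Ideal.ofList ((List.ofFn (X : Fin n → MvPowerSeries (Fin n) k)).take i) =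
      Ideal.span (X '' {j : Fin n | (j : ℕ) < i}) := by
    rw [Ideal.ofList]
    congr 1
    ext f
    simp only [Set.mem_ofPred_eq, List.mem_take_iff_getElem, List.getElem_ofFn, Set.mem_image]
    constructor
    · rintro ⟨j, hj, rfl⟩
      have h1 : j < i := by omega
      exact ⟨⟨j, by omega⟩, h1, rfl⟩
    · rintro ⟨j, hj, rfl⟩
      exact ⟨j, by simp; omega, rfl⟩
  rw [hspan, isSMulRegular_quotient_iff_mem_of_smul_mem]
  intro f hf
  rw [smul_eq_mul, Ideal.mul_top] at hf ⊢
  rw [List.getElem_ofFn, smul_eq_mul, mem_span_X_image] at hf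
  rw [mem_span_X_image]
  intro d hd
  have h1 := hf (d + Finsupp.single ⟨i, hin⟩ 1) ?_
  · rwa [mul_comm, X, coeff_add_mul_monomial, mul_one] at h1
  · intro j hj
    have hne : (⟨i, hin⟩ : Fin n) ≠ j := by
      rintro rfl
      exact lt_irrefl i hj
    rw [Finsupp.add_apply, hd j hj, Finsupp.single_eq_of_ne hne.symm, add_zero]

end Specialize

namespace ExtTools

lemma hasModels_of_residue_charZero {S : Type u} [CommRing S] [IsLocalRing S] [IsNoetherianRing S]
    (h0 : ∀ p : ℕ, p.Prime → (p : S) ∉ maximalIdeal S) {n : ℕ} (x : Fin n → S)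
    (hx : Ideal.span (Set.range x) = maximalIdeal S) (hn : (n : ℕ∞) ≤ (maximalIdeal S).height) :
    HasModels S (List.ofFn x) := by
  classical
  intro E
  have hz := Specialize.charZero_residueField h0
  obtain ⟨Γ, hΓ⟩ := Specialize.exists_ringHom_mvPowerSeries h0 x hx hn
  obtain ⟨p, k', _, _, C, σ, hp, hE, hX⟩ := Specialize.hasSpecializations.{u} n (ResidueField S)
    (Γ '' (E : Set S)) (E.finite_toSet.image _)
  have hEC : ∀ a ∈ E, Γ a ∈ C := fun a ha => hE ⟨a, ha, rfl⟩
  let g : S → MvPowerSeries (Fin n) k' := fun r => if h : Γ r ∈ C then σ ⟨Γ r, h⟩ else 0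
  have hg : ∀ r (h : Γ r ∈ C), g r = σ ⟨Γ r, h⟩ := fun r h => dif_pos h
  have hgx : (List.ofFn x).map g = List.ofFn (MvPowerSeries.X : Fin n → MvPowerSeries (Fin n) k') := by
    rw [List.map_ofFn]
    congr 1
    ext1 i
    obtain ⟨h, hi⟩ := hX i
    rw [Function.comp_apply, hg (x i) (by rw [hΓ]; exact h), ← hi]
    congr 2
    exact hΓ i
  refine ⟨p, MvPowerSeries (Fin n) k', inferInstance, inferInstance, inferInstance, g, hp,
    ?_, ?_, ?_, ?_, ?_⟩
  · exact charP_of_injective_ringHom (f := (MvPowerSeries.C : k' →+* MvPowerSeries (Fin n) k'))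
      (RingHom.injective _) p
  · rw [hg 1 (by rw [map_one]; exact one_mem C), ← map_one σ]
    congr 2
    exact map_one Γ
  · intro a ha b hb
    have h1 := hEC a ha
    have h2 := hEC b hb
    have h3 : Γ (a + b) ∈ C := by rw [map_add]; exact add_mem h1 h2
    have h4 : Γ (a * b) ∈ C := by rw [map_mul]; exact mul_mem h1 h2
    constructor
    · refine (hg _ h3).trans ?_
      rw [hg a h1, hg b h2, ← map_add σ]
      exact congrArg σ (Subtype.ext (map_add Γ a b))
    · refine (hg _ h4).trans ?_
      rw [hg a h1, hg b h2, ← map_mul σ]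
      exact congrArg σ (Subtype.ext (map_mul Γ a b))
  · rw [hgx]
    exact Specialize.isWeaklyRegular_X n
  · rw [hgx, Koszul.ofList_ofFn, Specialize.maximalIdeal_eq_span_X]

end ExtTools

/-- Let `(R,m,k)` be a regular local ring, let `I` be an ideal
of height `d` such that `R/I` satisfies Serre's condition `S_2`, and let
`z₁,…,z_d ∈ I` be an `R`-regular sequence with `(z₁,…,z_d) ≠ I`.  Let `P_•` be a
minimal free resolution of the `R`-module `I/(z₁,…,z_d)` and let
`ψ_• : P_• → K_•(z;R)` be a chain map lifting the inclusion `I/(z) ↪ R/(z)`,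
where the Koszul complex `K_•(z;R)` is a free resolution of `R/(z)`.  Then
`ψ_d : P_d → K_d(z;R) = R` is surjective. -/
theorem statement11
    (R : Type u) [CommRing R] [IsLocalRing R] (hreg : IsRegularLocal R)
    (I : Ideal R) (d : ℕ) (hht : HeightEq R I d)
    (hS2 : SerreS (R ⧸ I) 2)
    (z : Fin d → R) (hzI : ∀ j, z j ∈ I)
    (hzreg : RingTheory.Sequence.IsRegular R (List.ofFn z))
    (hne : Ideal.span (Set.range z) ≠ I)
    -- a minimal free resolution `P_•` of `I/(z₁,…,z_d)`
    (P : MinFreeRes R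
      (↥I ⧸ Submodule.comap I.subtype (Ideal.span (Set.range z))))
    -- a chain map `ψ_• : P_• → K_•(z;R)` …
    (ψ : ∀ n, P.F n →ₗ[R] KMod R d n)
    (hcomm : ∀ n, (koszulD R z n).comp (ψ (n + 1)) = (ψ n).comp (P.d n))
    -- … lifting the inclusion `I/(z) ↪ R/(z)`
    (haug : ∀ w : P.F 0,
      Ideal.Quotient.mk (Ideal.span (Set.range z)) ((ψ 0 w) ⟨∅, rfl⟩) =
        Submodule.mapQ (Submodule.comap I.subtype (Ideal.span (Set.range z)))
          (Ideal.span (Set.range z)) I.subtype (fun a ha => ha) (P.ε w)) :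
    Function.Surjective (ψ d) := by
  obtain ⟨hN, n, x, hx, hdim⟩ := hreg
  have hheight : (maximalIdeal R).height = n := by
    have h1 := IsLocalRing.maximalIdeal_height_eq_ringKrullDim (R := R)
    rw [hdim] at h1
    exact_mod_cast h1
  have hxl : Ideal.ofList (List.ofFn x) = maximalIdeal R := by rw [Koszul.ofList_ofFn, hx]
  obtain ⟨hdom, hxr⟩ := CMTools.isDomain_of_params n R (List.ofFn x) (by simp) hxl hheight.ge
  have hxm : ∀ r ∈ List.ofFn x, r ∈ maximalIdeal R := fun r hr =>
    hxl ▸ Ideal.subset_span hr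
  have hcm : CMTools.IsCM R n := ⟨hheight.le, List.ofFn x, by simp, hxm, hxr⟩
  have hzw : RingTheory.Sequence.IsWeaklyRegular R (List.ofFn z) := hzreg.toIsWeaklyRegular
  obtain ⟨⟨P₀, hP₀, hIP₀, hPd⟩, hall⟩ := hht
  have h₁ : ∃ Q : Ideal R, Q.IsPrime ∧ I ≤ Q ∧ Q.height ≤ (List.ofFn z).length := by
    refine ⟨P₀, hP₀, hIP₀, ?_⟩
    rw [IsLocalization.AtPrime.ringKrullDim_eq_height P₀ (Localization.AtPrime P₀)] at hPd
    rw [List.length_ofFn]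
    exact le_of_eq (by exact_mod_cast hPd)
  have h₂ : ∀ Q : Ideal R, Q.IsPrime → I ≤ Q → (List.ofFn z).length ≤ Q.height := by
    intro Q hQ hIQ
    have h := hall Q hQ hIQ
    rw [IsLocalization.AtPrime.ringKrullDim_eq_height Q (Localization.AtPrime Q)] at h
    rw [List.length_ofFn]
    exact_mod_cast h
  have hzle : Ideal.span (Set.range z) ≤ I := by
    rw [Ideal.span_le]
    rintro _ ⟨j, rfl⟩
    exact hzI j
  have hIm : I ≤ maximalIdeal R := hIP₀.trans (le_maximalIdeal hP₀.ne_top)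
  have hzm : ∀ r ∈ List.ofFn z, r ∈ maximalIdeal R := by
    intro r hr
    obtain ⟨j, rfl⟩ := (List.mem_ofFn' _ _).mp hr
    exact hIm (hzI j)
  cases d with
  | zero =>
    exfalso
    apply hne
    obtain ⟨Q, hQ, hIQ, hQ0⟩ := h₁
    have hQb : Q = ⊥ := by
      rw [← Ideal.height_eq_zero_iff_eq_bot]
      simpa using hQ0
    have hIb : I = ⊥ := le_bot_iff.mp (hQb ▸ hIQ)
    rw [hIb]
    exact le_bot_iff.mp (hIb ▸ hzle)
  | succ d =>
    obtain ⟨u, huI, hu⟩ := SetLike.exists_of_lt (lt_of_le_of_ne hzle hne)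
    let J : Ideal R :=
      { carrier := {j | ∀ a ∈ I, j * a ∈ Ideal.ofList (List.ofFn z)}
        add_mem' := fun h h' a ha => by rw [add_mul]; exact add_mem (h a ha) (h' a ha)
        zero_mem' := fun a _ => by rw [zero_mul]; exact zero_mem _
        smul_mem' := fun c j h a ha => by
          rw [smul_eq_mul, mul_assoc]; exact Ideal.mul_mem_left _ _ (h a ha) }
    have hJ : ∀ j, j ∈ J ↔ ∀ a ∈ I, j * a ∈ Ideal.ofList (List.ofFn z) := fun j => Iff.rfl
    have hV : ∀ (Q : Ideal R) [Q.IsPrime] (t : ℕ), Q.height = t →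
        ∀ (N : Type u) [AddCommGroup N] [Module R N] [Module.Finite R N],
          ExtTools.VanAt Q t R N := fun Q _ t ht N _ _ _ =>
      ExtTools.vanAt_of_height hcm (List.ofFn x) (by simp) hxl hxr Q t ht N
    have hIl : Ideal.ofList (List.ofFn z) ≤ I := by rw [Koszul.ofList_ofFn]; exact hzle
    have hU1 := ExtTools.mem_of_mul_le hcm hV hS2 (List.ofFn z) hzw hIl h₁ h₂ hJ
    have hU2 := ExtTools.exists_eq_mul hcm hV hS2 (List.ofFn z) hzw hIl h₁ h₂ hJ
    have hul : u ∉ Ideal.ofList (List.ofFn z) := by rw [Koszul.ofList_ofFn]; exact hu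
    have huJ : ∀ j ∈ J, u * j ∈ Ideal.ofList (List.ofFn z) := fun j hj => by
      rw [mul_comm]; exact hj u huI
    have htest : ExtTools.HasTestModule R J ((List.ofFn z).length + 1) := by
      by_cases hp : ∃ p : ℕ, p.Prime ∧ (p : R) ∈ maximalIdeal R
      · obtain ⟨p, hp, hpm⟩ := hp
        exact ExtTools.hasTestModule_of_prime hcm hheight.ge (List.ofFn x) (by simp) hxr hxl J p hp
          hpm (List.ofFn z) hzm hzw u hul huJ
      · push Not at hp
        exact ExtTools.hasTestModule_of_models hcm hheight.ge (List.ofFn x) (by simp) hxr hxl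
          (ExtTools.hasModels_of_residue_charZero hp x hx hheight.ge) J
          (List.ofFn z) hzm hzw u hul huJ
    rw [List.length_ofFn] at htest
    obtain ⟨X, _, _, ξ, hJξ, hξ, hX⟩ := htest
    rw [Koszul.ofList_ofFn] at hJ hU1 hU2
    refine ExtTools.psi_surj I J d z hzle hzw (fun a ha j hj => ?_) hU1 hU2 (fun a ha => ?_)
      X ξ hJξ hξ hX P.toProjRes ψ hcomm haug
    · rw [mul_comm]
      exact (hJ j).mp hj a ha
    · exact (hJ a).mpr fun b _ => Ideal.mul_mem_right _ _ ha
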